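/- Let n ≥ 2, 0 ≤ p ≤ n/2 and 2 − n + 2p < a ≤ 2. Then the operator Δ_{a,p}, defined initially on the dense subspace of Schwartz p-forms in the Hilbert space Ḣ^{(2−a)/2,p}(ℝ^n) equipped with the conformally invariant inner product associated to ‖·‖_{(2−a)/2,p}, is symmetric and essentially self-adjoint. -/

import Mathlib

open MeasureTheory Complex Finset

noncomputable section

/-- Euclidean space ℝ^n -/
abbrev Rn (n : ℕ) := EuclideanSpace ℝ (Fin n)

/-- The full exterior algebra Λ^•ℂ^n, realized as the Euclidean space with orthonormal
basis indexed by subsets of {1,…,n} (the basis e_S = e_{i_1}∧…∧e_{i_p}). -/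
abbrev Lam (n : ℕ) := EuclideanSpace ℂ (Finset (Fin n))

variable {n : ℕ}

/-- the sign (-1)^{#{i ∈ S : i < j}} -/
def wsign (j : Fin n) (S : Finset (Fin n)) : ℂ := (-1) ^ (S.filter (· < j)).card

/-- exterior multiplication ε_x by x ∈ ℂ^n -/
def eps (x : Fin n → ℂ) (v : Lam n) : Lam n :=
  WithLp.toLp 2 fun S => ∑ j ∈ S, wsign j S * x j * v (S.erase j)

/-- interior multiplication i_x by x ∈ ℂ^n (adjoint of ε_x for real x) -/
def iot (x : Fin n → ℂ) (v : Lam n) : Lam n :=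
  WithLp.toLp 2 fun S => ∑ j ∈ Sᶜ, wsign j S * x j * v (insert j S)

/-- v lies in the degree-p part Λ^p ℂ^n ⊆ Λ^• ℂ^n -/
def IsForm (p : ℕ) (v : Lam n) : Prop := ∀ S, S.card ≠ p → v S = 0

/-- complexification of a real vector -/
def rc (x : Fin n → ℝ) : Fin n → ℂ := fun j => (x j : ℂ)

/-- the j-th standard basis vector of ℂ^n -/
def ee (j : Fin n) : Fin n → ℂ := fun i => if i = j then 1 else 0

/-- extend x' ∈ ℝ^{n-1} by last coordinate t to the vector (x',t) ∈ ℝ^n -/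
def app (x' : Rn (n-1)) (t : ℝ) : Rn n :=
  WithLp.toLp 2 fun j => if h : (j : ℕ) < n - 1 then x' ⟨j, h⟩ else t

/-- restriction ℝ^n → ℝ^{n-1}, x ↦ x' -/
def restr (ξ : Rn n) : Rn (n-1) := WithLp.toLp 2 fun i => ξ (Fin.castLE (Nat.sub_le n 1) i)

/-- the embedding Fin (n-1) ↪ Fin n -/
def embF : Fin (n-1) ↪ Fin n := ⟨Fin.castLE (Nat.sub_le n 1), (Fin.castLE_injective _)⟩

/-- pullback Λ^• ℂ^n → Λ^• ℂ^{n-1}; on p-forms this is the projection i_{e_n} ε_{e_n}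
followed by restriction of indices. -/
def projL (v : Lam n) : Lam (n-1) := WithLp.toLp 2 fun T => v (T.map embF)

/-- the inclusion Λ^• ℂ^{n-1} ⊆ Λ^• ℂ^n -/
def incL (v : Lam (n-1)) : Lam n :=
  WithLp.toLp 2 fun S => ∑ T : Finset (Fin (n-1)), if T.map embF = S then v T else 0

/-- the operator i_z ε_z - ε_z i_z -/
def cmm (z : Fin n → ℂ) (v : Lam n) : Lam n := iot z (eps z v) - eps z (iot z v)

/-- partial derivative ∂/∂x_j -/
def pd (j : Fin n) (u : Rn n → Lam n) : Rn n → Lam n :=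
  fun x => fderiv ℝ u x (EuclideanSpace.single j 1)

/-- the differential operator Δ_{a,p} = x_n²Δ + a x_n ∂_n + 2x_n(i_{e_n}d' - ε_{e_n}δ')
- (n-2p) ε_{e_n} i_{e_n}; here ℓ is the index of the last coordinate. -/
def Dap (a : ℝ) (p : ℕ) (ℓ : Fin n) (u : Rn n → Lam n) (x : Rn n) : Lam n :=
  ((x ℓ)^2 : ℝ) • (∑ j, pd j (pd j u) x)
  + (a * x ℓ) • pd ℓ u x
  + (2 * x ℓ) • (iot (ee ℓ) (∑ j ∈ univ.erase ℓ, eps (ee j) (pd j u x))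
      - eps (ee ℓ) (-(∑ j ∈ univ.erase ℓ, iot (ee j) (pd j u x))))
  - ((n : ℝ) - 2*p) • eps (ee ℓ) (iot (ee ℓ) (u x))

/-- the formal transpose of Δ_{a,p} with respect to the bilinear pairing
∫ ⟨u(x), φ(x)⟩ dx (⟨·,·⟩ the bilinear form with ⟨e_S, e_T⟩ = δ_{ST}):
Δ_{a,p}ᵗφ = Δ(x_n²φ) - a ∂_n(x_n φ) - 2x_n Σ_j (i_{e_j}ε_{e_n} + ε_{e_j}i_{e_n}) ∂_j φ
- (n-2p) ε_{e_n} i_{e_n} φ. -/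
def DapT (a : ℝ) (p : ℕ) (ℓ : Fin n) (φ : Rn n → Lam n) (x : Rn n) : Lam n :=
  (∑ j, pd j (pd j (fun y => ((y ℓ)^2 : ℝ) • φ y)) x)
  - a • pd ℓ (fun y => (y ℓ) • φ y) x
  - (2 * x ℓ) • (∑ j ∈ univ.erase ℓ,
      (iot (ee j) (eps (ee ℓ) (pd j φ x)) + eps (ee j) (iot (ee ℓ) (pd j φ x))))
  - ((n : ℝ) - 2*p) • eps (ee ℓ) (iot (ee ℓ) (φ x))

/-- the Fourier transform with the convention û(ξ) = (2π)^{-n/2} ∫ e^{-i x·ξ} u(x) dx -/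
def ft (u : Rn n → Lam n) : Rn n → Lam n := fun ξ =>
  ((2 * Real.pi) ^ (-(n:ℝ)/2) : ℝ) •
    ∫ x, Complex.exp (-(((∑ j, x j * ξ j : ℝ) : ℂ) * Complex.I)) • u x

/-- the inverse Fourier transform -/
def ftInv (u : Rn n → Lam n) : Rn n → Lam n := fun ξ =>
  ((2 * Real.pi) ^ (-(n:ℝ)/2) : ℝ) •
    ∫ x, Complex.exp ((((∑ j, x j * ξ j : ℝ) : ℂ) * Complex.I)) • u x

/-- The homogeneous Sobolev space Ḣ^{s,p}(ℝ^n) of Λ^pℂ^n-valued tempered distributions,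
modeled on the Fourier transform side: an element of the set is the function g = û. -/
def Hdot (n : ℕ) (s : ℝ) (p : ℕ) : Set (Rn n → Lam n) :=
  {g | AEStronglyMeasurable g volume ∧ (∀ ξ, IsForm p (g ξ)) ∧
    Integrable (fun ξ => ‖ξ‖ ^ (2*s) * ‖g ξ‖^2)}

/-- squared weighted L² norm ∫ ‖ξ‖^t ‖g(ξ)‖² dξ on the Fourier side;
wInt (2s) g is the squared homogeneous Sobolev norm of degree s of u with û = g. -/
def wInt (t : ℝ) (g : Rn n → Lam n) : ℝ := ∫ ξ, ‖ξ‖ ^ t * ‖g ξ‖^2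

/-- the operator (c - λ) i_x ε_x + (c + λ) ε_x i_x on Λ^•ℂ^n -/
def opC (c lam : ℝ) (x : Fin n → ℝ) (v : Lam n) : Lam n :=
  ((c - lam : ℝ) : ℂ) • iot (rc x) (eps (rc x) v)
    + ((c + lam : ℝ) : ℂ) • eps (rc x) (iot (rc x) v)

/-- the conformally invariant squared norm ‖u‖_λ² on the Fourier side (for û = g);
c is dim/2 - p, i.e. n/2 - p on ℝ^n and (n-1)/2 - p on ℝ^{n-1}. -/
def cSq (c lam : ℝ) (g : Rn n → Lam n) : ℝ :=
  ∫ ξ, ‖ξ‖ ^ (-(2*lam)) * (inner ℂ (g ξ) (opC c lam (‖ξ‖⁻¹ • ξ).ofLp (g ξ)) : ℂ).re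

/-- the conformally invariant inner product on the Fourier side -/
def cIp (c lam : ℝ) (g h : Rn n → Lam n) : ℂ :=
  ∫ ξ, (‖ξ‖ ^ (-(2*lam)) : ℝ) • (inner ℂ (g ξ) (opC c lam (‖ξ‖⁻¹ • ξ).ofLp (h ξ)) : ℂ)

/-- the bilinear pairing on Λ^•ℂ^n with ⟨e_S, e_T⟩ = δ_{ST} -/
def blin (v w : Lam n) : ℂ := ∑ S, v S * w S

/-- the pairing ⟨u, ψ⟩ of the tempered distribution u whose Fourier transform is g
with a Schwartz function ψ: ⟨u, ψ⟩ = ⟨û, 𝓕⁻¹ψ⟩ = ∫ ⟨g(ξ), (𝓕⁻¹ψ)(ξ)⟩ dξ. -/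
def dpair (g : Rn n → Lam n) (ψ : Rn n → Lam n) : ℂ :=
  ∫ ξ, blin (g ξ) (ftInv ψ ξ)

/-- "Δ_{a,p} u = μ u in the sense of tempered distributions", expressed for the
distribution u whose Fourier transform is g: testing against all Λ^•ℂ^n-valued
Schwartz functions φ via the formal transpose of Δ_{a,p}. -/
def WeakEig (a : ℝ) (p : ℕ) (ℓ : Fin n) (g : Rn n → Lam n) (μ : ℂ) : Prop :=
  ∀ φ : SchwartzMap (Rn n) (Lam n),
    dpair g (fun x => DapT a p ℓ (fun y => φ y) x - μ • φ x) = 0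

/-- the Fourier side of the trace map u ↦ u|_{ℝ^{n-1}}:
(Ru)^(ξ') = (2π)^{-1/2} ∫_ℝ û(ξ', ξ_n) dξ_n, composed with the pullback
Λ^pℂ^n → Λ^pℂ^{n-1}. -/
def ftrace (g : Rn n → Lam n) : Rn (n-1) → Lam (n-1) := fun ξ' =>
  ((2 * Real.pi) ^ (-(1:ℝ)/2) : ℝ) • ∫ t : ℝ, projL (g (app ξ' t))

/-- the constant c_{a,p} -/
def cP (n p : ℕ) (a : ℝ) : ℝ :=
  2 * Real.Gamma (((n:ℝ) - a + 2)/2) /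
    (Real.pi ^ (((n:ℝ)-1)/2) * ((n:ℝ) - 2*p - a) * Real.Gamma ((1-a)/2))

/-- the Poisson transform P_{a,p}f(x) = c_{a,p} ∫_{ℝ^{n-1}} |x_n|^{1-a}
(|x'-y|²+x_n²)^{-(n-a+2)/2} (i_{x-y}ε_{x-y} - ε_{x-y}i_{x-y}) f(y) dy,
where ℓ is the index of the last coordinate. -/
def Pois (a : ℝ) (p : ℕ) (ℓ : Fin n) (f : Rn (n-1) → Lam (n-1)) (x : Rn n) : Lam n :=
  cP n p a • ∫ y : Rn (n-1),
    (|x ℓ| ^ (1-a) * ‖x - app y 0‖ ^ (-((n:ℝ) - a + 2))) •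
      cmm (rc (x - app y 0).ofLp) (incL (f y))

/-- "G is the Fourier transform of the (polynomially bounded, locally integrable)
function u in the sense of tempered distributions":
∫ ⟨G(ξ), ψ(ξ)⟩ dξ = ∫ ⟨u(x), ψ̂(x)⟩ dx for every Schwartz function ψ. -/
def IsFTof (G : Rn n → Lam n) (u : Rn n → Lam n) : Prop :=
  ∀ ψ : SchwartzMap (Rn n) (Lam n),
    ∫ ξ, blin (G ξ) (ψ ξ) = ∫ x, blin (u x) (ft (fun y => ψ y) x)



set_option linter.unusedSimpArgs false
set_option linter.unusedVariables false
set_option linter.deprecated false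

/-! ### Exterior algebra -/

lemma wsign_sq (j : Fin n) (S : Finset (Fin n)) : wsign j S * wsign j S = 1 := by
  unfold wsign
  rw [← pow_add, ← two_mul, pow_mul]; simp

lemma wsign_conj (j : Fin n) (S : Finset (Fin n)) : (starRingEnd ℂ) (wsign j S) = wsign j S := by
  unfold wsign; simp

/-- commutation sign -/
def sgk (j k : Fin n) : ℂ := if k < j then -1 else 1

lemma sgk_add {j k : Fin n} (h : j ≠ k) : sgk j k + sgk k j = 0 := by
  unfold sgk
  rcases lt_or_gt_of_ne h with h | h
  · simp [h, h.not_gt]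
  · simp [h, h.not_gt]

lemma wsign_insert (j k : Fin n) (S : Finset (Fin n)) (hk : k ∉ S) :
    wsign j (insert k S) = wsign j S * sgk j k := by
  unfold wsign sgk
  rw [Finset.filter_insert]
  split_ifs with h
  · rw [Finset.card_insert_of_notMem (by simp [hk]), pow_succ]
  · simp

lemma wsign_erase (j k : Fin n) (S : Finset (Fin n)) (hk : k ∈ S) :
    wsign j (S.erase k) = wsign j S * sgk j k := by
  have h := wsign_insert j k (S.erase k) (by simp)
  rw [Finset.insert_erase hk] at h
  rw [h, mul_assoc]
  have : sgk j k * sgk j k = 1 := by unfold sgk; split_ifs <;> simp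
  rw [this, mul_one]

lemma sgk_self (j : Fin n) : sgk j j = 1 := by simp [sgk]

/-- exterior multiplication as linear map -/
def epsL (x : Fin n → ℂ) : Module.End ℂ (Lam n) where
  toFun := eps x
  map_add' u v := by
    ext S; simp [eps, mul_add, Finset.sum_add_distrib]
  map_smul' c u := by
    ext S; simp only [eps, PiLp.smul_apply, smul_eq_mul, RingHom.id_apply, Finset.mul_sum]
    refine Finset.sum_congr rfl fun j _ => by ring

/-- interior multiplication as linear map -/
def iotL (x : Fin n → ℂ) : Module.End ℂ (Lam n) where
  toFun := iot x
  map_add' u v := by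
    ext S; simp [iot, mul_add, Finset.sum_add_distrib]
  map_smul' c u := by
    ext S; simp only [iot, PiLp.smul_apply, smul_eq_mul, RingHom.id_apply, Finset.mul_sum]
    refine Finset.sum_congr rfl fun j _ => by ring

lemma epsL_apply (x : Fin n → ℂ) (v : Lam n) : epsL x v = eps x v := rfl
lemma iotL_apply (x : Fin n → ℂ) (v : Lam n) : iotL x v = iot x v := rfl

lemma epsL_eq_sum (x : Fin n → ℂ) : epsL x = ∑ j, x j • epsL (ee j) := by
  ext v S
  simp only [LinearMap.sum_apply, LinearMap.smul_apply, epsL_apply, eps, WithLp.ofLp_sum,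
    WithLp.ofLp_smul, Finset.sum_apply, Pi.smul_apply, smul_eq_mul, ee, LinearMap.coe_sum]
  have : ∀ j, x j * (∑ k ∈ S, wsign k S * (if k = j then 1 else 0) * v (S.erase k))
      = if j ∈ S then wsign j S * x j * v (S.erase j) else 0 := by
    intro j
    simp only [mul_ite, mul_one, mul_zero, ite_mul, zero_mul, Finset.sum_ite_eq']
    split_ifs <;> ring
  simp only [this, Finset.sum_ite_mem, Finset.univ_inter]

lemma iotL_eq_sum (x : Fin n → ℂ) : iotL x = ∑ j, x j • iotL (ee j) := by
  ext v S
  simp only [LinearMap.sum_apply, LinearMap.smul_apply, iotL_apply, iot, WithLp.ofLp_sum,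
    WithLp.ofLp_smul, Finset.sum_apply, Pi.smul_apply, smul_eq_mul, ee, LinearMap.coe_sum]
  have : ∀ j, x j * (∑ k ∈ Sᶜ, wsign k S * (if k = j then 1 else 0) * v (insert k S))
      = if j ∈ Sᶜ then wsign j S * x j * v (insert j S) else 0 := by
    intro j
    simp only [mul_ite, mul_one, mul_zero, ite_mul, zero_mul, Finset.sum_ite_eq']
    split_ifs <;> ring
  simp only [this, Finset.sum_ite_mem, Finset.univ_inter]

lemma eps_ee (j : Fin n) (v : Lam n) (S : Finset (Fin n)) :
    eps (ee j) v S = if j ∈ S then wsign j S * v (S.erase j) else 0 := by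
  simp [eps, ee]

lemma iot_ee (j : Fin n) (v : Lam n) (S : Finset (Fin n)) :
    iot (ee j) v S = if j ∈ S then 0 else wsign j S * v (insert j S) := by
  simp [iot, ee]

lemma eps_eps_ee (j k : Fin n) :
    epsL (ee j) * epsL (ee k) + epsL (ee k) * epsL (ee j) = 0 := by
  ext v S
  simp only [LinearMap.add_apply, Module.End.mul_apply, epsL_apply, PiLp.add_apply, eps_ee,
    LinearMap.zero_apply, PiLp.zero_apply, Finset.mem_erase]
  by_cases hjk : j = k
  · subst hjk; simp
  by_cases hj : j ∈ S <;> by_cases hk : k ∈ S <;>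
    simp only [hj, hk, hjk, Ne.symm hjk, ne_eq, not_false_eq_true, and_self, if_true, if_false,
      and_true, and_false, mul_zero, add_zero, zero_add]
  rw [Finset.erase_right_comm, wsign_erase _ _ _ hj, wsign_erase _ _ _ hk]
  have := sgk_add hjk
  linear_combination (wsign j S * wsign k S * v ((S.erase k).erase j)) * this

lemma iot_iot_ee (j k : Fin n) :
    iotL (ee j) * iotL (ee k) + iotL (ee k) * iotL (ee j) = 0 := by
  ext v S
  simp only [LinearMap.add_apply, Module.End.mul_apply, iotL_apply, PiLp.add_apply, iot_ee,
    LinearMap.zero_apply, PiLp.zero_apply, Finset.mem_insert]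
  by_cases hjk : j = k
  · subst hjk; simp
  by_cases hj : j ∈ S <;> by_cases hk : k ∈ S <;>
    simp only [hj, hk, hjk, Ne.symm hjk, or_self, or_true, or_false, if_true, if_false, mul_zero,
      add_zero, zero_add]
  rw [Finset.insert_comm, wsign_insert _ _ _ hj, wsign_insert _ _ _ hk]
  have := sgk_add hjk
  linear_combination (wsign j S * wsign k S * v (insert j (insert k S))) * this

lemma iot_eps_ee (j k : Fin n) :
    iotL (ee j) * epsL (ee k) + epsL (ee k) * iotL (ee j) = if j = k then 1 else 0 := by
  ext v S
  simp only [LinearMap.add_apply, Module.End.mul_apply, iotL_apply, epsL_apply, PiLp.add_apply,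
    iot_ee, eps_ee, Finset.mem_insert, Finset.mem_erase]
  by_cases hjk : j = k
  · subst hjk
    by_cases hj : j ∈ S
    · simp only [hj, if_true, ne_eq, not_true_eq_false, false_and, if_false, zero_add,
        Finset.insert_erase hj, Module.End.one_apply]
      rw [wsign_erase _ _ _ hj, sgk_self]
      linear_combination v S * wsign_sq j S
    · simp only [hj, if_true, if_false, or_false, Finset.erase_insert hj,
        Module.End.one_apply, add_zero]
      rw [wsign_insert _ _ _ hj, sgk_self]
      linear_combination v S * wsign_sq j S
  simp only [hjk, if_false, LinearMap.zero_apply, PiLp.zero_apply]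
  by_cases hj : j ∈ S <;> by_cases hk : k ∈ S <;>
    simp only [hj, hk, hjk, Ne.symm hjk, or_self, or_true, or_false, if_true, if_false, mul_zero,
      add_zero, zero_add, ne_eq, not_false_eq_true, true_and, and_true, and_false]
  rw [wsign_insert _ _ _ hj, wsign_erase _ _ _ hk, Finset.erase_insert_of_ne hjk]
  have := sgk_add hjk
  linear_combination (wsign j S * wsign k S * v (insert j (S.erase k))) * this

lemma eps_eps (x y : Fin n → ℂ) : epsL x * epsL y = - (epsL y * epsL x) := by
  rw [eq_neg_iff_add_eq_zero, epsL_eq_sum x, epsL_eq_sum y]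
  simp only [Finset.sum_mul_sum, smul_mul_smul_comm]
  rw [Finset.sum_comm, ← Finset.sum_add_distrib]
  refine Finset.sum_eq_zero fun j _ => ?_
  rw [← Finset.sum_add_distrib]
  refine Finset.sum_eq_zero fun k _ => ?_
  rw [mul_comm (y j), ← smul_add, eps_eps_ee, smul_zero]

lemma iot_iot (x y : Fin n → ℂ) : iotL x * iotL y = - (iotL y * iotL x) := by
  rw [eq_neg_iff_add_eq_zero, iotL_eq_sum x, iotL_eq_sum y]
  simp only [Finset.sum_mul_sum, smul_mul_smul_comm]
  rw [Finset.sum_comm, ← Finset.sum_add_distrib]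
  refine Finset.sum_eq_zero fun j _ => ?_
  rw [← Finset.sum_add_distrib]
  refine Finset.sum_eq_zero fun k _ => ?_
  rw [mul_comm (y j), ← smul_add, iot_iot_ee, smul_zero]

lemma iot_eps (x y : Fin n → ℂ) :
    iotL x * epsL y = (∑ j, x j * y j) • (1 : Module.End ℂ (Lam n)) - epsL y * iotL x := by
  rw [eq_sub_iff_add_eq, iotL_eq_sum x, epsL_eq_sum y]
  simp only [Finset.sum_mul_sum, smul_mul_smul_comm]
  conv_lhs => rw [Finset.sum_comm]
  rw [← Finset.sum_add_distrib, Finset.sum_smul]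
  refine Finset.sum_congr rfl fun j _ => ?_
  rw [← Finset.sum_add_distrib]
  simp only [mul_comm (y j), ← smul_add, iot_eps_ee]
  simp

lemma inner_eps_ee (j : Fin n) (u v : Lam n) :
    inner ℂ (epsL (ee j) u) v = inner ℂ u (iotL (ee j) v) := by
  simp only [PiLp.inner_apply, RCLike.inner_apply, epsL_apply, iotL_apply, eps_ee, iot_ee]
  simp only [apply_ite (starRingEnd ℂ), mul_ite, ite_mul, map_zero, mul_zero, zero_mul, map_mul,
    wsign_conj]
  have hite : ∀ (x : Finset (Fin n)) (z : ℂ), (if j ∈ x then 0 else z) = if j ∉ x then z else 0 := by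
    intro x z; split_ifs <;> rfl
  simp only [hite]
  rw [← Finset.sum_filter, ← Finset.sum_filter]
  refine Finset.sum_bij' (fun S _ => S.erase j) (fun S _ => insert j S) ?_ ?_ ?_ ?_ ?_
  · intro S hS; simp
  · intro S hS; simp
  · intro S hS; simp only [Finset.mem_filter, mem_univ, true_and] at hS; exact Finset.insert_erase hS
  · intro S hS; simp only [Finset.mem_filter, mem_univ, true_and] at hS; exact Finset.erase_insert hS
  · intro S hS
    simp only [Finset.mem_filter, mem_univ, true_and] at hS
    rw [wsign_erase _ _ _ hS, sgk_self, Finset.insert_erase hS]; ring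

lemma inner_eps (x : Fin n → ℝ) (u v : Lam n) :
    inner ℂ (epsL (rc x) u) v = inner ℂ u (iotL (rc x) v) := by
  rw [epsL_eq_sum, iotL_eq_sum]
  simp only [LinearMap.sum_apply, LinearMap.smul_apply, sum_inner, inner_sum, inner_smul_left,
    inner_smul_right, inner_eps_ee, rc, Complex.conj_ofReal]

lemma inner_iot (x : Fin n → ℝ) (u v : Lam n) :
    inner ℂ (iotL (rc x) u) v = inner ℂ u (epsL (rc x) v) := by
  rw [← inner_conj_symm, ← inner_eps, inner_conj_symm]

lemma IsForm.eps {p : ℕ} {v : Lam n} (hv : IsForm p v) (x : Fin n → ℂ) :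
    IsForm (p+1) (epsL x v) := by
  intro S hS
  simp only [epsL_apply, _root_.eps]
  refine Finset.sum_eq_zero fun j hj => ?_
  rw [hv _ ?_, mul_zero]
  intro h
  apply hS
  rw [← Finset.card_erase_add_one hj, h]

lemma IsForm.iot {p : ℕ} {v : Lam n} (hv : IsForm (p+1) v) (x : Fin n → ℂ) :
    IsForm p (iotL x v) := by
  intro S hS
  simp only [iotL_apply, _root_.iot]
  refine Finset.sum_eq_zero fun j hj => ?_
  rw [hv _ ?_, mul_zero]
  intro h
  apply hS
  rw [Finset.card_insert_of_notMem (by simpa using hj)] at h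
  omega

lemma iot_zero_form {v : Lam n} (hv : IsForm 0 v) (x : Fin n → ℂ) : iotL x v = 0 := by
  ext S
  simp only [iotL_apply, _root_.iot]
  refine Finset.sum_eq_zero fun j hj => ?_
  rw [hv _ (by simp), mul_zero]

lemma IsForm.eps_iot {p : ℕ} {v : Lam n} (hv : IsForm p v) (x y : Fin n → ℂ) :
    IsForm p (epsL x (iotL y v)) := by
  cases p with
  | zero => rw [iot_zero_form hv, map_zero]; intro S _; rfl
  | succ p => exact (hv.iot y).eps x

lemma IsForm.iot_eps {p : ℕ} {v : Lam n} (hv : IsForm p v) (x y : Fin n → ℂ) :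
    IsForm p (iotL x (epsL y v)) := (hv.eps y).iot x

lemma IsForm.add {p : ℕ} {u v : Lam n} (hu : IsForm p u) (hv : IsForm p v) : IsForm p (u + v) := by
  intro S hS; simp [hu S hS, hv S hS]

lemma IsForm.sub {p : ℕ} {u v : Lam n} (hu : IsForm p u) (hv : IsForm p v) : IsForm p (u - v) := by
  intro S hS; simp [hu S hS, hv S hS]

lemma IsForm.smul {p : ℕ} {u : Lam n} (hu : IsForm p u) (c : ℂ) : IsForm p (c • u) := by
  intro S hS; simp [hu S hS]

lemma IsForm.rsmul {p : ℕ} {u : Lam n} (hu : IsForm p u) (c : ℝ) : IsForm p (c • u) := by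
  intro S hS; simp [hu S hS]

lemma norm_eps_iot (x : Fin n → ℝ) (v : Lam n) :
    ‖epsL (rc x) v‖^2 + ‖iotL (rc x) v‖^2 = (∑ j, x j ^ 2) * ‖v‖^2 := by
  have h1 : (inner ℂ (epsL (rc x) v) (epsL (rc x) v) : ℂ) + inner ℂ (iotL (rc x) v) (iotL (rc x) v)
      = (((∑ j, x j ^ 2) * ‖v‖^2 : ℝ) : ℂ) := by
    rw [inner_eps, inner_iot, ← inner_add_right, ← Module.End.mul_apply, ← Module.End.mul_apply,
      ← LinearMap.add_apply, iot_eps, sub_add_cancel, LinearMap.smul_apply, Module.End.one_apply,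
      inner_smul_right, inner_self_eq_norm_sq_to_K]
    simp [rc, sq]
  rw [inner_self_eq_norm_sq_to_K, inner_self_eq_norm_sq_to_K] at h1
  apply Complex.ofReal_injective
  push_cast at h1 ⊢
  exact h1


/-! ### Fibre operators -/

section car
variable {A : Type*} [Ring A] [Algebra ℂ A] (e i f j : A) (q : ℂ)

lemma car_all (hee : e * e = 0) (hii : i * i = 0) (hff : f * f = 0) (hjj : j * j = 0)
    (hfe : f * e = -(e * f)) (hji : j * i = -(i * j))
    (hie : i * e = 1 - e * i) (hjf : j * f = q • 1 - f * j)
    (hif : i * f = -(f * i)) (hje : j * e = -(e * j)) :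
    ((i*f+e*j)*(f*j) - (f*j)*(i*f+e*j) = q • (e*j+f*i)) ∧
    ((i*f+e*j)*(e*j+f*i) - (e*j+f*i)*(i*f+e*j) = (2:ℂ) • (q • (e*i) - f*j)) ∧
    ((i*f+e*j)*(e*i) - (e*i)*(i*f+e*j) = -(e*j+f*i)) ∧
    ((f*j)*(e*i) = (e*i)*(f*j)) ∧
    ((e*j+f*i)*(e*i) - (e*i)*(e*j+f*i) = -(i*f+e*j)) ∧
    ((f*j)*(i*f+e*j) + (i*f+e*j)*(f*j) = q • (i*f+e*j)) ∧
    ((e*j+f*i)*(i*f+e*j) + (i*f+e*j)*(e*j+f*i) = 0) ∧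
    ((e*i)*(i*f+e*j) + (i*f+e*j)*(e*i) = i*f+e*j) := by
  have a1 : ∀ z, e * (e * z) = 0 := fun z => by rw [← mul_assoc, hee, zero_mul]
  have a2 : ∀ z, i * (i * z) = 0 := fun z => by rw [← mul_assoc, hii, zero_mul]
  have a3 : ∀ z, f * (f * z) = 0 := fun z => by rw [← mul_assoc, hff, zero_mul]
  have a4 : ∀ z, j * (j * z) = 0 := fun z => by rw [← mul_assoc, hjj, zero_mul]
  have a5 : ∀ z, f * (e * z) = -(e * (f * z)) := fun z => by
    rw [← mul_assoc, hfe, neg_mul, mul_assoc]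
  have a6 : ∀ z, j * (i * z) = -(i * (j * z)) := fun z => by
    rw [← mul_assoc, hji, neg_mul, mul_assoc]
  have a7 : ∀ z, i * (e * z) = z - e * (i * z) := fun z => by
    rw [← mul_assoc, hie, sub_mul, one_mul, mul_assoc]
  have a8 : ∀ z, j * (f * z) = q • z - f * (j * z) := fun z => by
    rw [← mul_assoc, hjf, sub_mul, smul_mul_assoc, one_mul, mul_assoc]
  have a9 : ∀ z, i * (f * z) = -(f * (i * z)) := fun z => by
    rw [← mul_assoc, hif, neg_mul, mul_assoc]
  have a10 : ∀ z, j * (e * z) = -(e * (j * z)) := fun z => by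
    rw [← mul_assoc, hje, neg_mul, mul_assoc]
  refine ⟨?_, ?_, ?_, ?_, ?_, ?_, ?_, ?_⟩ <;>
  (simp only [mul_add, add_mul, mul_assoc, mul_sub, hee, hii, hff, hjj, hfe, hji, hie, hjf, hif, hje,
    a1, a2, a3, a4, a5, a6, a7, a8, a9, a10, mul_neg, neg_mul, mul_smul_comm, mul_one, mul_zero,
    neg_zero, neg_neg, smul_add, smul_sub, smul_neg, smul_zero]
   try module)
end car

/-- B = i_n ε_{x} + ε_n i_{x} -/
def opB (ℓ : Fin n) (x : Fin n → ℝ) : Module.End ℂ (Lam n) :=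
  iotL (ee ℓ) * epsL (rc x) + epsL (ee ℓ) * iotL (rc x)
/-- ε_x i_x -/
def opE0 (x : Fin n → ℝ) : Module.End ℂ (Lam n) := epsL (rc x) * iotL (rc x)
/-- mixed -/
def opE1 (ℓ : Fin n) (x : Fin n → ℝ) : Module.End ℂ (Lam n) :=
  epsL (ee ℓ) * iotL (rc x) + epsL (rc x) * iotL (ee ℓ)
/-- N = ε_n i_n -/
def opN (ℓ : Fin n) : Module.End ℂ (Lam n) := epsL (ee ℓ) * iotL (ee ℓ)
/-- |x|² -/
def qq (x : Fin n → ℝ) : ℝ := ∑ j, x j ^ 2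

lemma ee_rc (ℓ : Fin n) : ee ℓ = rc (fun i => if i = ℓ then (1:ℝ) else 0) := by
  ext i; simp only [ee, rc]; split_ifs <;> simp

lemma ops_rel (ℓ : Fin n) (x : Fin n → ℝ) (hx : x ℓ = 0) :
    (opB ℓ x * opE0 x - opE0 x * opB ℓ x = (qq x : ℂ) • opE1 ℓ x) ∧
    (opB ℓ x * opE1 ℓ x - opE1 ℓ x * opB ℓ x = (2:ℂ) • ((qq x : ℂ) • opN ℓ - opE0 x)) ∧
    (opB ℓ x * opN ℓ - opN ℓ * opB ℓ x = - opE1 ℓ x) ∧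
    (opE0 x * opN ℓ = opN ℓ * opE0 x) ∧
    (opE1 ℓ x * opN ℓ - opN ℓ * opE1 ℓ x = - opB ℓ x) ∧
    (opE0 x * opB ℓ x + opB ℓ x * opE0 x = (qq x : ℂ) • opB ℓ x) ∧
    (opE1 ℓ x * opB ℓ x + opB ℓ x * opE1 ℓ x = 0) ∧
    (opN ℓ * opB ℓ x + opB ℓ x * opN ℓ = opB ℓ x) := by
  have two0 : ∀ z : Module.End ℂ (Lam n), z = -z → z = 0 := by
    intro z hz
    have h : (2:ℂ) • z = 0 := by rw [two_smul]; nth_rewrite 1 [hz]; simp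
    exact (smul_eq_zero.1 h).resolve_left two_ne_zero
  have c1 : ∑ j, (ee ℓ j) * (ee ℓ j) = (1:ℂ) := by simp [ee]
  have c2 : ∑ j, (ee ℓ j) * (rc x j) = (0:ℂ) := by simp [ee, rc, hx]
  have c3 : ∑ j, (rc x j) * (ee ℓ j) = (0:ℂ) := by simp [ee, rc, hx]
  have c4 : ∑ j, (rc x j) * (rc x j) = (qq x : ℂ) := by simp [rc, qq, sq]
  refine car_all (epsL (ee ℓ)) (iotL (ee ℓ)) (epsL (rc x)) (iotL (rc x)) (qq x : ℂ)
    (two0 _ (eps_eps _ _)) (two0 _ (iot_iot _ _)) (two0 _ (eps_eps _ _)) (two0 _ (iot_iot _ _))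
    (eps_eps _ _) (iot_iot _ _) ?_ ?_ ?_ ?_
  · rw [iot_eps, c1, one_smul]
  · rw [iot_eps, c4]
  · rw [iot_eps, c2, zero_smul, zero_sub]
  · rw [iot_eps, c3, zero_smul, zero_sub]

lemma inner_opE0 (x : Fin n → ℝ) (u v : Lam n) : inner ℂ (opE0 x u) v = inner ℂ u (opE0 x v) := by
  simp only [opE0, Module.End.mul_apply, inner_eps, inner_iot]

lemma inner_opN (ℓ : Fin n) (u v : Lam n) : inner ℂ (opN ℓ u) v = inner ℂ u (opN ℓ v) := by
  simp only [opN, ee_rc, Module.End.mul_apply, inner_eps, inner_iot]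

lemma inner_opE1 (ℓ : Fin n) (x : Fin n → ℝ) (u v : Lam n) :
    inner ℂ (opE1 ℓ x u) v = inner ℂ u (opE1 ℓ x v) := by
  simp only [opE1, ee_rc, Module.End.mul_apply, LinearMap.add_apply, inner_add_left,
    inner_add_right, inner_eps, inner_iot]
  ring

lemma inner_opB (ℓ : Fin n) (x : Fin n → ℝ) (hx : x ℓ = 0) (u v : Lam n) :
    inner ℂ (opB ℓ x u) v = - inner ℂ u (opB ℓ x v) := by
  have c2 : ∑ j, (ee ℓ j) * (rc x j) = (0:ℂ) := by simp [ee, rc, hx]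
  have c3 : ∑ j, (rc x j) * (ee ℓ j) = (0:ℂ) := by simp [ee, rc, hx]
  have h : opB ℓ x = -(epsL (rc x) * iotL (ee ℓ)) - iotL (rc x) * epsL (ee ℓ) := by
    rw [opB, iot_eps, iot_eps, c2, c3]; simp
  conv_rhs => rw [h]
  simp only [opB, ee_rc, Module.End.mul_apply, LinearMap.add_apply, inner_add_left,
    inner_add_right, inner_eps, inner_iot, LinearMap.sub_apply, LinearMap.neg_apply,
    inner_sub_right, inner_neg_right]
  ring

/-- ρ·weight matrix: (c+σ) ρ - 2 σ ε_ξ i_ξ -/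
def opM (c σ : ℝ) (ℓ : Fin n) (x : Fin n → ℝ) (t : ℝ) : Module.End ℂ (Lam n) :=
  (((c + σ) * (qq x + t^2) : ℝ) : ℂ) • 1
    - ((2 * σ : ℝ) : ℂ) • (opE0 x + (t : ℂ) • opE1 ℓ x + ((t^2 : ℝ) : ℂ) • opN ℓ)

/-- t-derivative of opM -/
def opM' (c σ : ℝ) (ℓ : Fin n) (x : Fin n → ℝ) (t : ℝ) : Module.End ℂ (Lam n) :=
  (((c + σ) * (2 * t) : ℝ) : ℂ) • 1
    - ((2 * σ : ℝ) : ℂ) • (opE1 ℓ x + ((2 * t : ℝ) : ℂ) • opN ℓ)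

lemma opM_comm (c σ : ℝ) (ℓ : Fin n) (x : Fin n → ℝ) (hx : x ℓ = 0) (t : ℝ) :
    ((qq x + t^2 : ℝ) : ℂ) • opM' c σ ℓ x t =
      opB ℓ x * opM c σ ℓ x t - opM c σ ℓ x t * opB ℓ x + ((2 * t : ℝ) : ℂ) • opM c σ ℓ x t := by
  obtain ⟨h1, h2, h3, -⟩ := ops_rel ℓ x hx
  rw [sub_eq_iff_eq_add] at h1 h2 h3
  simp only [opM, opM', mul_sub, sub_mul, mul_add, add_mul, mul_smul_comm, smul_mul_assoc, mul_one,
    one_mul, h1, h2, h3]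
  push_cast
  module

lemma inner_opM (c σ : ℝ) (ℓ : Fin n) (x : Fin n → ℝ) (t : ℝ) (u v : Lam n) :
    inner ℂ (opM c σ ℓ x t u) v = inner ℂ u (opM c σ ℓ x t v) := by
  simp only [opM, LinearMap.sub_apply, LinearMap.smul_apply, LinearMap.add_apply,
    Module.End.one_apply, inner_sub_left, inner_sub_right, inner_smul_left, inner_smul_right,
    inner_add_left, inner_add_right, inner_opE0, inner_opE1, inner_opN, Complex.conj_ofReal]

/-- potential term (times ρ) -/
def opQ (c σ : ℝ) (ℓ : Fin n) (x : Fin n → ℝ) (t : ℝ) : Module.End ℂ (Lam n) :=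
  ((2 * c * (qq x + t^2) : ℝ) : ℂ) • opN ℓ - ((2 * t * σ : ℝ) : ℂ) • opB ℓ x + opB ℓ x * opB ℓ x

lemma inner_opMQ (c σ : ℝ) (ℓ : Fin n) (x : Fin n → ℝ) (hx : x ℓ = 0) (t : ℝ) (u v : Lam n) :
    inner ℂ (opQ c σ ℓ x t u) (opM c σ ℓ x t v) = inner ℂ u (opM c σ ℓ x t (opQ c σ ℓ x t v)) := by
  obtain ⟨h1, h2, h3, h4, h5, h6, h7, h8⟩ := ops_rel ℓ x hx
  have e1 : inner ℂ (opQ c σ ℓ x t u) (opM c σ ℓ x t v) = inner ℂ u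
      ((((2 * c * (qq x + t^2) : ℝ) : ℂ) • opN ℓ + ((2 * t * σ : ℝ) : ℂ) • opB ℓ x
        + opB ℓ x * opB ℓ x) (opM c σ ℓ x t v)) := by
    simp only [opQ, LinearMap.sub_apply, LinearMap.smul_apply, LinearMap.add_apply,
      inner_sub_left, inner_smul_left, inner_smul_right,
      inner_add_left, inner_add_right, inner_opN, inner_opB ℓ x hx, Module.End.mul_apply,
      Complex.conj_ofReal]
    ring
  rw [e1, ← Module.End.mul_apply, ← Module.End.mul_apply]
  congr 2
  rw [sub_eq_iff_eq_add] at h1 h2 h3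
  rw [sub_eq_iff_eq_add] at h5
  rw [← eq_sub_iff_add_eq] at h6 h7 h8
  have b1 : opB ℓ x * opB ℓ x * opE0 x = opE0 x * (opB ℓ x * opB ℓ x) := by
    rw [mul_assoc, eq_sub_iff_add_eq.1 h6 |> eq_sub_iff_add_eq'.2, mul_sub, ← mul_assoc,
      eq_sub_iff_add_eq.1 h6 |> eq_sub_iff_add_eq'.2, mul_smul_comm, sub_mul, smul_mul_assoc,
      mul_assoc]; module
  have b2 : opB ℓ x * opB ℓ x * opE1 ℓ x = opE1 ℓ x * (opB ℓ x * opB ℓ x) := by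
    rw [mul_assoc, eq_sub_iff_add_eq.1 h7 |> eq_sub_iff_add_eq'.2, mul_sub, ← mul_assoc,
      eq_sub_iff_add_eq.1 h7 |> eq_sub_iff_add_eq'.2, mul_zero, sub_mul, zero_mul,
      mul_assoc]; module
  have b3 : opB ℓ x * opB ℓ x * opN ℓ = opN ℓ * (opB ℓ x * opB ℓ x) := by
    rw [mul_assoc, eq_sub_iff_add_eq.1 h8 |> eq_sub_iff_add_eq'.2, mul_sub, ← mul_assoc,
      eq_sub_iff_add_eq.1 h8 |> eq_sub_iff_add_eq'.2, sub_mul,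
      mul_assoc]; module
  simp only [opM, opQ, mul_sub, sub_mul, mul_add, add_mul, mul_smul_comm, smul_mul_assoc, mul_one,
    one_mul, b1, b2, b3, h4, h5, h6, h7, h8]
  push_cast
  module


/-! ### A scalar Gaffney type lemma -/

lemma gaffney (q C : ℝ) (hq : 0 < q) (hC : 0 ≤ C) (P P' w k : ℝ → ℝ)
    (hP : ∀ t, HasDerivAt P (P' t) t) (hP' : Continuous P') (hw : Continuous w)
    (hw0 : ∀ t, 0 ≤ w t) (hk0 : ∀ t, 0 ≤ k t) (hwi : Integrable w)
    (h1 : ∀ t, w t + k t ≤ P' t) (h2 : ∀ t, (P t)^2 ≤ C * (q + t^2) * (w t * k t)) :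
    ∀ t, w t = 0 := by
  -- main inequality
  set K : ℝ := 4 * C * (1 + q) with hK
  have hK0 : 0 ≤ K := by positivity
  have main : ∀ T : ℝ, 0 < T →
      ∫ t in (-T)..T, (1 - Real.log (1 + t^2) / Real.log (1 + T^2))^2 * w t
        ≤ K / (Real.log (1 + T^2))^2 * ∫ t, w t := by
    intro T hT
    set l := Real.log (1 + T^2) with hl
    have hl0 : 0 < l := Real.log_pos (by nlinarith)
    have hpos : ∀ t : ℝ, 0 < 1 + t^2 := fun t => by positivity
    have hφ : ∀ t, HasDerivAt (fun t : ℝ => 1 - Real.log (1 + t^2) / l) (- (2 * t / (1 + t^2) / l)) t := by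
      intro t
      have e1 : HasDerivAt (fun t : ℝ => 1 + t^2) (2 * t) t := by
        simpa using (hasDerivAt_pow 2 t).const_add 1
      have e2 := (e1.log (hpos t).ne').div_const l
      simpa using e2.const_sub 1
    set φ : ℝ → ℝ := fun t : ℝ => 1 - Real.log (1 + t^2) / l with hφd
    set φ' : ℝ → ℝ := fun t : ℝ => - (2 * t / (1 + t^2) / l) with hφd'
    have hcφ : Continuous φ := continuous_iff_continuousAt.2 fun t => (hφ t).continuousAt
    have hcφ' : Continuous φ' := by
      apply Continuous.neg
      apply Continuous.div_const
      exact Continuous.div (by fun_prop) (by fun_prop) (fun t => (hpos t).ne')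
    have hcP : Continuous P := continuous_iff_continuousAt.2 fun t => (hP t).continuousAt
    have hprod : ∀ t, HasDerivAt (fun t => φ t ^ 2 * P t)
        (2 * φ t * φ' t * P t + φ t ^ 2 * P' t) t := by
      intro t
      exact (((hφ t).fun_pow 2).mul (hP t)).congr_deriv (by simp [φ'])
    have hint : ∫ t in (-T)..T, (2 * φ t * φ' t * P t + φ t ^ 2 * P' t) = 0 := by
      rw [intervalIntegral.integral_eq_sub_of_hasDerivAt (fun t _ => hprod t)
        (Continuous.intervalIntegrable (by fun_prop) _ _)]
      have z1 : φ T = 0 := by simp only [φ, ← hl]; rw [div_self hl0.ne', sub_self]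
      have z2 : φ (-T) = 0 := by simp only [φ, neg_sq, ← hl]; rw [div_self hl0.ne', sub_self]
      simp [z1, z2]
    have hpt : ∀ t, φ t ^ 2 * w t - K / l^2 * w t ≤ 2 * φ t * φ' t * P t + φ t ^ 2 * P' t := by
      intro t
      have hφ2 : (φ' t)^2 * (q + t^2) ≤ 4 * (1 + q) / l^2 := by
        simp only [φ']
        rw [neg_sq, div_div, div_pow, div_mul_eq_mul_div, div_le_div_iff₀ (by positivity) (by positivity)]
        have : t^2 * (q+t^2) ≤ (1+q) * (1+t^2)^2 := by nlinarith [sq_nonneg t, sq_nonneg (t^2)]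
        have hl2 : 0 < l^2 := by positivity
        nlinarith
      have hX : (φ' t * P t)^2 ≤ (K / l^2 * w t) * k t := by
        have hwk : 0 ≤ w t * k t := mul_nonneg (hw0 t) (hk0 t)
        calc (φ' t * P t)^2 = φ' t^2 * (P t)^2 := by ring
          _ ≤ φ' t^2 * (C * (q + t^2) * (w t * k t)) := by gcongr; exact h2 t
          _ = (φ' t^2 * (q + t^2)) * (C * (w t * k t)) := by ring
          _ ≤ (4 * (1 + q) / l^2) * (C * (w t * k t)) := by gcongr
          _ = _ := by rw [hK]; ring
      have hA : 0 ≤ K / l^2 * w t := mul_nonneg (by positivity) (hw0 t)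
      have hB : 0 ≤ φ t^2 * k t := mul_nonneg (by positivity) (hk0 t)
      have hab : |2 * φ t * φ' t * P t| ≤ φ t^2 * k t + K / l^2 * w t := by
        apply abs_le_of_sq_le_sq _ (by positivity)
        have : φ t^2 * (φ' t * P t)^2 ≤ φ t^2 * ((K / l^2 * w t) * k t) := by gcongr
        nlinarith [sq_nonneg (φ t^2 * k t - K / l^2 * w t)]
      have := (abs_le.1 hab).1
      have h3 : φ t^2 * (w t + k t) ≤ φ t^2 * P' t := by gcongr; exact h1 t
      nlinarith
    have hTT : -T ≤ T := by linarith
    have h4 : ∫ t in (-T)..T, (φ t ^ 2 * w t - K / l^2 * w t) ≤ 0 := by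
      rw [← hint]
      apply intervalIntegral.integral_mono_on hTT
      · exact Continuous.intervalIntegrable (by fun_prop) _ _
      · exact Continuous.intervalIntegrable (by fun_prop) _ _
      · exact fun t _ => hpt t
    rw [intervalIntegral.integral_sub (Continuous.intervalIntegrable (by fun_prop) _ _)
      (Continuous.intervalIntegrable (by fun_prop) _ _), intervalIntegral.integral_const_mul] at h4
    have h5 : ∫ t in (-T)..T, w t ≤ ∫ t, w t := by
      rw [intervalIntegral.integral_of_le hTT]
      exact setIntegral_le_integral hwi (Filter.Eventually.of_forall hw0)
    have h6 : K / l^2 * ∫ t in (-T)..T, w t ≤ K / l^2 * ∫ t, w t := by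
      gcongr
    linarith
  -- limit
  have hT0 : ∀ T0 : ℝ, 0 < T0 → ∫ t in (-T0)..T0, w t ≤ 0 := by
    intro T0 hT0
    have htend : Filter.Tendsto (fun T : ℝ => Real.log (1 + T^2)) Filter.atTop Filter.atTop := by
      apply Real.tendsto_log_atTop.comp
      apply Filter.tendsto_atTop_add_const_left
      exact Filter.tendsto_pow_atTop two_ne_zero
    have hlim : Filter.Tendsto (fun T : ℝ => 4 * (K / (Real.log (1 + T^2))^2 * ∫ t, w t))
        Filter.atTop (nhds 0) := by
      have h1 : Filter.Tendsto (fun T : ℝ => ((Real.log (1 + T^2))^2)⁻¹) Filter.atTop (nhds 0) :=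
        Filter.Tendsto.inv_tendsto_atTop ((Filter.tendsto_pow_atTop two_ne_zero).comp htend)
      have := h1.const_mul (4 * K * ∫ t, w t)
      simp only [mul_zero] at this
      refine this.congr fun T => ?_
      rw [div_eq_mul_inv]; ring
    refine ge_of_tendsto hlim ?_
    filter_upwards [Filter.eventually_ge_atTop T0, Filter.eventually_gt_atTop (0:ℝ),
      htend.eventually_ge_atTop (2 * Real.log (1 + T0^2)), htend.eventually_gt_atTop 0]
      with T hT hTp hlT hl0
    have hm := main T hTp
    have hsub : ∫ t in (-T0)..T0, w t * (1/4) ≤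
        ∫ t in (-T)..T, (1 - Real.log (1 + t^2) / Real.log (1 + T^2))^2 * w t := by
      have hcont : Continuous fun t : ℝ => (1 - Real.log (1 + t^2) / Real.log (1 + T^2))^2 * w t := by
        have : Continuous fun t : ℝ => Real.log (1 + t^2) :=
          Continuous.log (by fun_prop) (fun t => by positivity)
        fun_prop
      calc ∫ t in (-T0)..T0, w t * (1/4) ≤
        ∫ t in (-T0)..T0, (1 - Real.log (1 + t^2) / Real.log (1 + T^2))^2 * w t := by
            apply intervalIntegral.integral_mono_on (by linarith)
            · exact Continuous.intervalIntegrable (by fun_prop) _ _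
            · exact hcont.intervalIntegrable _ _
            · intro t ht
              have ht2 : t^2 ≤ T0^2 := by nlinarith [ht.1, ht.2]
              have hlt : Real.log (1+t^2) ≤ Real.log (1+T0^2) :=
                Real.log_le_log (by positivity) (by linarith)
              have hd : Real.log (1+t^2) / Real.log (1+T^2) ≤ 1/2 := by
                rw [div_le_iff₀ hl0]; linarith
              have : (1/4 : ℝ) ≤ (1 - Real.log (1 + t^2) / Real.log (1 + T^2))^2 := by nlinarith
              rw [mul_comm]
              exact mul_le_mul_of_nonneg_right this (hw0 t)
        _ ≤ _ := by
            apply intervalIntegral.integral_mono_interval (by linarith) (by linarith) hT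
            · exact Filter.Eventually.of_forall fun t => mul_nonneg (sq_nonneg _) (hw0 t)
            · exact hcont.intervalIntegrable _ _
    rw [intervalIntegral.integral_mul_const] at hsub
    linarith
  intro t
  by_contra hne
  have hpos : 0 < w t := lt_of_le_of_ne (hw0 t) (Ne.symm hne)
  have hT : 0 < |t| + 1 := by positivity
  have : 0 < ∫ s in (-(|t|+1))..(|t|+1), w s := by
    apply intervalIntegral.integral_pos (by linarith) hw.continuousOn (fun s _ => hw0 s)
    exact ⟨t, ⟨by linarith [neg_abs_le t], by linarith [le_abs_self t]⟩, hpos⟩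
  linarith [hT0 _ hT]


/-! ### The current identity -/

lemma hasDerivAt_end (A : Module.End ℂ (Lam n)) {y : ℝ → Lam n} {y' : Lam n} {t : ℝ}
    (h : HasDerivAt y y' t) : HasDerivAt (fun t => A (y t)) (A y') t := by
  have := ((LinearMap.toContinuousLinearMap A).restrictScalars ℝ).hasFDerivAt.comp_hasDerivAt t h
  exact this

lemma continuous_end (A : Module.End ℂ (Lam n)) : Continuous A :=
  (LinearMap.toContinuousLinearMap A).continuous

/-- the fibre operator -/
def Lsh (c σ : ℝ) (ℓ : Fin n) (x : Fin n → ℝ) (t : ℝ) (v v' v'' : Lam n) : Lam n :=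
  ((qq x + t^2 : ℝ) : ℂ) • v'' + ((2 * t * (1 + σ) : ℝ) : ℂ) • v' - (2:ℂ) • opB ℓ x v'
    - ((2 * c : ℝ) : ℂ) • opN ℓ v

/-- the covariant derivative -/
def yy (ℓ : Fin n) (x : Fin n → ℝ) (t : ℝ) (v v' : Lam n) : Lam n :=
  ((qq x + t^2 : ℝ) : ℂ) • v' - opB ℓ x v

lemma hasDerivAt_rho (x : Fin n → ℝ) (t : ℝ) :
    HasDerivAt (fun t : ℝ => ((qq x + t^2 : ℝ) : ℂ)) ((2 * t : ℝ) : ℂ) t := by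
  have : HasDerivAt (fun t : ℝ => (qq x + t^2 : ℝ)) (2 * t) t := by
    simpa using (hasDerivAt_pow 2 t).const_add (qq x)
  exact this.ofReal_comp

lemma hasDerivAt_yy (ℓ : Fin n) (x : Fin n → ℝ) {v v' : ℝ → Lam n} {v'' : Lam n} {t : ℝ}
    (h : HasDerivAt v (v' t) t) (h' : HasDerivAt v' v'' t) :
    HasDerivAt (fun t => yy ℓ x t (v t) (v' t))
      (((qq x + t^2 : ℝ) : ℂ) • v'' + ((2 * t : ℝ) : ℂ) • v' t - opB ℓ x (v' t)) t :=
  ((hasDerivAt_rho x t).smul h').sub (hasDerivAt_end _ h)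

lemma hasDerivAt_opM (c σ : ℝ) (ℓ : Fin n) (x : Fin n → ℝ) {y : ℝ → Lam n} {y' : Lam n} {t : ℝ}
    (h : HasDerivAt y y' t) :
    HasDerivAt (fun t => opM c σ ℓ x t (y t)) (opM' c σ ℓ x t (y t) + opM c σ ℓ x t y') t := by
  have e1 : HasDerivAt (fun t : ℝ => (((c + σ) * (qq x + t^2) : ℝ) : ℂ))
      (((c + σ) * (2 * t) : ℝ) : ℂ) t := by
    have : HasDerivAt (fun t : ℝ => ((c + σ) * (qq x + t^2) : ℝ)) ((c+σ) * (2 * t)) t := by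
      simpa using ((hasDerivAt_pow 2 t).const_add (qq x)).const_mul (c+σ)
    exact this.ofReal_comp
  have e2 : HasDerivAt (fun t : ℝ => (t : ℂ)) 1 t := by
    simpa using (hasDerivAt_id t).ofReal_comp
  have e3 : HasDerivAt (fun t : ℝ => ((t^2 : ℝ) : ℂ)) ((2 * t : ℝ) : ℂ) t := by
    have : HasDerivAt (fun t : ℝ => (t^2 : ℝ)) (2 * t) t := by
      simpa using (hasDerivAt_pow 2 t)
    exact this.ofReal_comp
  have := (e1.smul h).sub ((((hasDerivAt_end (opE0 x) h).add (e2.smul (hasDerivAt_end (opE1 ℓ x) h))).add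
    (e3.smul (hasDerivAt_end (opN ℓ) h))).const_smul ((2 * σ : ℝ) : ℂ))
  refine this.congr_deriv ?_
  simp only [opM, opM', LinearMap.sub_apply, LinearMap.smul_apply, LinearMap.add_apply,
    Module.End.one_apply]
  module

lemma current (c σ : ℝ) (ℓ : Fin n) (x : Fin n → ℝ) (hx : x ℓ = 0) (hq : 0 < qq x)
    {u v v' : ℝ → Lam n} {u' v'' : Lam n} {t : ℝ}
    (hu : HasDerivAt u u' t)
    (h : HasDerivAt v (v' t) t) (h' : HasDerivAt v' v'' t) :
    HasDerivAt (fun t => (((qq x + t^2) ^ (σ - 1) : ℝ) : ℂ) *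
        inner ℂ (u t) (opM c σ ℓ x t (yy ℓ x t (v t) (v' t))))
      ((((qq x + t^2) ^ (σ - 2) : ℝ) : ℂ) *
          (inner ℂ (yy ℓ x t (u t) u') (opM c σ ℓ x t (yy ℓ x t (v t) (v' t)))
            + inner ℂ (u t) (opM c σ ℓ x t (opQ c σ ℓ x t (v t))))
        + (((qq x + t^2) ^ (σ - 1) : ℝ) : ℂ) *
          inner ℂ (u t) (opM c σ ℓ x t (Lsh c σ ℓ x t (v t) (v' t) v''))) t := by
  have hρ : 0 < qq x + t^2 := by positivity
  have hr : HasDerivAt (fun t : ℝ => (((qq x + t^2) ^ (σ - 1) : ℝ) : ℂ))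
      (((2 * t) * (σ - 1) * (qq x + t^2) ^ (σ - 2) : ℝ) : ℂ) t := by
    have h0 : HasDerivAt (fun t : ℝ => (qq x + t^2 : ℝ)) (2 * t) t := by
      simpa using (hasDerivAt_pow 2 t).const_add (qq x)
    have h1 := h0.rpow_const (p := σ - 1) (Or.inl hρ.ne')
    rw [show σ - 1 - 1 = σ - 2 by ring] at h1
    exact h1.ofReal_comp
  have hM := hasDerivAt_opM c σ ℓ x (hasDerivAt_yy ℓ x h h')
  have hin := hu.inner ℂ hM
  refine (hr.mul hin).congr_deriv ?_
  have hpow : (((qq x + t^2) ^ (σ - 1) : ℝ) : ℂ) =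
      (((qq x + t^2) ^ (σ - 2) : ℝ) : ℂ) * ((qq x + t^2 : ℝ) : ℂ) := by
    rw [← Complex.ofReal_mul, ← Real.rpow_add_one hρ.ne']
    congr 2; ring
  rw [hpow]
  set r : ℂ := (((qq x + t^2) ^ (σ - 2) : ℝ) : ℂ) with hrd
  set y := yy ℓ x t (v t) (v' t) with hy
  set M := opM c σ ℓ x t with hMd
  have hc := opM_comm c σ ℓ x hx t
  have hc' : ((qq x + t^2 : ℝ) : ℂ) * inner ℂ (u t) (opM' c σ ℓ x t y) =
      inner ℂ (u t) (opB ℓ x (M y)) - inner ℂ (u t) (M (opB ℓ x y))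
        + ((2 * t : ℝ) : ℂ) * inner ℂ (u t) (M y) := by
    rw [← inner_smul_right, ← LinearMap.smul_apply, hc]
    simp only [LinearMap.add_apply, LinearMap.sub_apply, LinearMap.smul_apply,
      Module.End.mul_apply, inner_add_right, inner_sub_right, inner_smul_right, ← hMd]
  have hxu : inner ℂ (yy ℓ x t (u t) u') (M y) =
      ((qq x + t^2 : ℝ) : ℂ) * inner ℂ u' (M y) + inner ℂ (u t) (opB ℓ x (M y)) := by
    simp only [yy, inner_sub_left, inner_smul_left, Complex.conj_ofReal, inner_opB ℓ x hx]
    ring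
  have hMy : M y = ((qq x + t^2 : ℝ) : ℂ) • M (v' t) - M (opB ℓ x (v t)) := by
    rw [hy, yy]; simp
  have hMBy : M (opB ℓ x y) = ((qq x + t^2 : ℝ) : ℂ) • M (opB ℓ x (v' t)) - M (opB ℓ x (opB ℓ x (v t))) := by
    rw [hy, yy]; simp
  rw [inner_add_right, hxu]
  have e1 : inner ℂ (u t) (M (((qq x + t^2 : ℝ) : ℂ) • v'' + ((2 * t : ℝ) : ℂ) • v' t - opB ℓ x (v' t)))
      = ((qq x + t^2 : ℝ) : ℂ) * inner ℂ (u t) (M v'') + ((2 * t : ℝ) : ℂ) * inner ℂ (u t) (M (v' t))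
        - inner ℂ (u t) (M (opB ℓ x (v' t))) := by
    simp only [map_add, map_sub, map_smul, inner_add_right, inner_sub_right, inner_smul_right]
  have e2 : inner ℂ (u t) (M (opQ c σ ℓ x t (v t))) =
      ((2 * c * (qq x + t^2) : ℝ) : ℂ) * inner ℂ (u t) (M (opN ℓ (v t)))
       - ((2 * t * σ : ℝ) : ℂ) * inner ℂ (u t) (M (opB ℓ x (v t)))
       + inner ℂ (u t) (M (opB ℓ x (opB ℓ x (v t)))) := by
    simp only [opQ, LinearMap.add_apply, LinearMap.sub_apply, LinearMap.smul_apply,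
      Module.End.mul_apply, map_add, map_sub, map_smul, inner_add_right, inner_sub_right, inner_smul_right]
  have e3 : inner ℂ (u t) (M (Lsh c σ ℓ x t (v t) (v' t) v'')) =
      ((qq x + t^2 : ℝ) : ℂ) * inner ℂ (u t) (M v'')
      + ((2 * t * (1 + σ) : ℝ) : ℂ) * inner ℂ (u t) (M (v' t))
      - 2 * inner ℂ (u t) (M (opB ℓ x (v' t)))
      - ((2 * c : ℝ) : ℂ) * inner ℂ (u t) (M (opN ℓ (v t))) := by
    simp only [Lsh, map_add, map_sub, map_smul, inner_add_right, inner_sub_right, inner_smul_right]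
  have e4 : inner ℂ (u t) (M y) = ((qq x + t^2 : ℝ) : ℂ) * inner ℂ (u t) (M (v' t))
      - inner ℂ (u t) (M (opB ℓ x (v t))) := by
    rw [hMy, inner_sub_right, inner_smul_right]
  have e5 : inner ℂ (u t) (M (opB ℓ x y)) = ((qq x + t^2 : ℝ) : ℂ) * inner ℂ (u t) (M (opB ℓ x (v' t)))
      - inner ℂ (u t) (M (opB ℓ x (opB ℓ x (v t)))) := by
    rw [hMBy, inner_sub_right, inner_smul_right]
  rw [e1, e2, e3]
  rw [e5] at hc'
  simp only [Complex.ofReal_mul, Complex.ofReal_add, Complex.ofReal_sub, Complex.ofReal_one,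
    Complex.ofReal_ofNat] at *
  linear_combination r * hc' + r * 2 * (t:ℂ) * σ * e4


/-! ### Bounds -/

lemma rc_split (ℓ : Fin n) (x ξ : Fin n → ℝ) (t : ℝ)
    (h : ∀ i, ξ i = x i + t * (if i = ℓ then 1 else 0)) :
    epsL (rc ξ) = epsL (rc x) + (t:ℂ) • epsL (ee ℓ) ∧
    iotL (rc ξ) = iotL (rc x) + (t:ℂ) • iotL (ee ℓ) := by
  have e : ∀ i, rc ξ i = rc x i + (t:ℂ) * (if i = ℓ then 1 else 0) := by
    intro i; simp only [rc, h i]; split_ifs <;> simp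
  constructor
  · rw [epsL_eq_sum (rc ξ), epsL_eq_sum (rc x)]
    simp only [e, add_smul, Finset.sum_add_distrib]
    congr 1
    simp
  · rw [iotL_eq_sum (rc ξ), iotL_eq_sum (rc x)]
    simp only [e, add_smul, Finset.sum_add_distrib]
    congr 1
    simp

lemma qq_split (ℓ : Fin n) (x ξ : Fin n → ℝ) (hx : x ℓ = 0) (t : ℝ)
    (h : ∀ i, ξ i = x i + t * (if i = ℓ then 1 else 0)) : qq ξ = qq x + t^2 := by
  have : ∀ i, ξ i ^ 2 = x i ^ 2 + (if i = ℓ then t^2 else 0) := by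
    intro i; rw [h i]; split_ifs with hi
    · subst hi; rw [hx]; ring
    · ring
  simp only [qq, this, Finset.sum_add_distrib]
  simp

lemma opM_eq (c σ : ℝ) (ℓ : Fin n) (x ξ : Fin n → ℝ) (hx : x ℓ = 0) (t : ℝ)
    (h : ∀ i, ξ i = x i + t * (if i = ℓ then 1 else 0)) :
    opM c σ ℓ x t = (((c + σ) * qq ξ : ℝ) : ℂ) • 1
      - ((2 * σ : ℝ) : ℂ) • (epsL (rc ξ) * iotL (rc ξ)) := by
  obtain ⟨h1, h2⟩ := rc_split ℓ x ξ t h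
  rw [opM, qq_split ℓ x ξ hx t h, h1, h2]
  simp only [opE0, opE1, opN, add_mul, mul_add, smul_mul_assoc, mul_smul_comm]
  push_cast
  module

lemma norm_iot_sq_le (ξ : Fin n → ℝ) (v : Lam n) : ‖iotL (rc ξ) v‖^2 ≤ qq ξ * ‖v‖^2 := by
  have := norm_eps_iot ξ v
  rw [qq]; nlinarith [sq_nonneg ‖epsL (rc ξ) v‖]

lemma norm_eps_sq_le (ξ : Fin n → ℝ) (v : Lam n) : ‖epsL (rc ξ) v‖^2 ≤ qq ξ * ‖v‖^2 := by
  have := norm_eps_iot ξ v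
  rw [qq]; nlinarith [sq_nonneg ‖iotL (rc ξ) v‖]

lemma qq_nonneg (ξ : Fin n → ℝ) : 0 ≤ qq ξ := Finset.sum_nonneg fun _ _ => sq_nonneg _

lemma norm_epsiot_le (ξ : Fin n → ℝ) (v : Lam n) : ‖epsL (rc ξ) (iotL (rc ξ) v)‖ ≤ qq ξ * ‖v‖ := by
  have h1 := norm_eps_sq_le ξ (iotL (rc ξ) v)
  have h2 := norm_iot_sq_le ξ v
  have h0 := qq_nonneg ξ
  apply le_of_sq_le_sq _ (by positivity)
  nlinarith [mul_le_mul_of_nonneg_left h2 h0]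

lemma norm_iot_le (ξ : Fin n → ℝ) (v : Lam n) : ‖iotL (rc ξ) v‖ ≤ √(qq ξ) * ‖v‖ := by
  have h0 := qq_nonneg ξ
  apply le_of_sq_le_sq _ (by positivity)
  rw [mul_pow, Real.sq_sqrt h0]; exact norm_iot_sq_le ξ v

lemma norm_eps_le (ξ : Fin n → ℝ) (v : Lam n) : ‖epsL (rc ξ) v‖ ≤ √(qq ξ) * ‖v‖ := by
  have h0 := qq_nonneg ξ
  apply le_of_sq_le_sq _ (by positivity)
  rw [mul_pow, Real.sq_sqrt h0]; exact norm_eps_sq_le ξ v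

lemma upd_split (ℓ : Fin n) (x : Fin n → ℝ) (hx : x ℓ = 0) (t : ℝ) :
    ∀ i, Function.update x ℓ t i = x i + t * (if i = ℓ then 1 else 0) := by
  intro i
  by_cases h : i = ℓ
  · subst h; simp [hx]
  · simp [h]

lemma norm_opM_le (c σ : ℝ) (ℓ : Fin n) (x : Fin n → ℝ) (hx : x ℓ = 0) (t : ℝ) (v : Lam n) :
    ‖opM c σ ℓ x t v‖ ≤ (|c + σ| + 2 * |σ|) * (qq x + t^2) * ‖v‖ := by
  have hs := upd_split ℓ x hx t
  rw [opM_eq c σ ℓ x _ hx t hs, ← qq_split ℓ x _ hx t hs]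
  set ξ := Function.update x ℓ t
  have h0 := qq_nonneg ξ
  simp only [LinearMap.sub_apply, LinearMap.smul_apply, Module.End.one_apply, Module.End.mul_apply]
  refine (norm_sub_le _ _).trans ?_
  rw [norm_smul, norm_smul, Complex.norm_real, Complex.norm_real, Real.norm_eq_abs, Real.norm_eq_abs,
    abs_mul, abs_mul, abs_of_nonneg h0, abs_two]
  have := norm_epsiot_le ξ v
  have h2 : 0 ≤ 2 * |σ| := by positivity
  nlinarith [mul_le_mul_of_nonneg_left this h2]

lemma inner_opM_self (c σ : ℝ) (ℓ : Fin n) (x ξ : Fin n → ℝ) (hx : x ℓ = 0) (t : ℝ)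
    (h : ∀ i, ξ i = x i + t * (if i = ℓ then 1 else 0)) (v : Lam n) :
    inner ℂ v (opM c σ ℓ x t v) = (((c+σ) * qq ξ * ‖v‖^2 - 2 * σ * ‖iotL (rc ξ) v‖^2 : ℝ) : ℂ) := by
  rw [opM_eq c σ ℓ x _ hx t h]
  simp only [LinearMap.sub_apply, LinearMap.smul_apply, Module.End.one_apply, Module.End.mul_apply,
    inner_sub_right, inner_smul_right, ← inner_iot]
  rw [inner_self_eq_norm_sq_to_K, inner_self_eq_norm_sq_to_K]
  push_cast
  simp

lemma inner_opM_bd (c σ : ℝ) (ℓ : Fin n) (x : Fin n → ℝ) (hx : x ℓ = 0) (t : ℝ) (v : Lam n) :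
    ∃ m : ℝ, inner ℂ v (opM c σ ℓ x t v) = (m : ℂ) ∧
      (c - |σ|) * (qq x + t^2) * ‖v‖^2 ≤ m ∧ m ≤ (c + |σ|) * (qq x + t^2) * ‖v‖^2 := by
  have hs := upd_split ℓ x hx t
  refine ⟨_, inner_opM_self c σ ℓ x _ hx t hs v, ?_⟩
  rw [← qq_split ℓ x _ hx t hs]
  set ξ := Function.update x ℓ t
  have h1 := norm_iot_sq_le ξ v
  have h2 := sq_nonneg ‖iotL (rc ξ) v‖
  rcases abs_cases σ with ⟨h, h'⟩ | ⟨h, h'⟩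
  · rw [h]; constructor <;> nlinarith [mul_le_mul_of_nonneg_left h1 h', mul_nonneg h' h2]
  · rw [h]
    have h'' : 0 ≤ -σ := by linarith
    constructor <;> nlinarith [mul_le_mul_of_nonneg_left h1 h'', mul_nonneg h'' h2]

lemma end_bd (A : Module.End ℂ (Lam n)) : ∃ K : ℝ, 0 ≤ K ∧ ∀ v, ‖A v‖ ≤ K * ‖v‖ :=
  ⟨‖LinearMap.toContinuousLinearMap A‖, norm_nonneg _, fun v =>
    (LinearMap.toContinuousLinearMap A).le_opNorm v⟩

lemma norm_opQ_le (c σ : ℝ) (ℓ : Fin n) (x : Fin n → ℝ) (hq : 0 < qq x) :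
    ∃ K : ℝ, 0 ≤ K ∧ ∀ t v, ‖opQ c σ ℓ x t v‖ ≤ K * (qq x + t^2) * ‖v‖ := by
  obtain ⟨KN, hN0, hN⟩ := end_bd (opN ℓ)
  obtain ⟨KB, hB0, hB⟩ := end_bd (opB ℓ x)
  obtain ⟨KC, hC0, hC⟩ := end_bd (opB ℓ x * opB ℓ x)
  refine ⟨2 * |c| * KN + |σ| * KB * (1 + 1 / qq x) + KC / qq x, by positivity, fun t v => ?_⟩
  have hρ : 0 < qq x + t^2 := by positivity
  simp only [opQ, LinearMap.sub_apply, LinearMap.smul_apply, LinearMap.add_apply]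
  have a1 : ‖((2 * c * (qq x + t^2) : ℝ) : ℂ) • opN ℓ v‖ ≤ 2 * |c| * KN * (qq x + t^2) * ‖v‖ := by
    rw [norm_smul, Complex.norm_real, Real.norm_eq_abs, abs_mul, abs_mul, abs_two, abs_of_pos hρ]
    calc _ ≤ 2 * |c| * (qq x + t^2) * (KN * ‖v‖) := by gcongr; exact hN v
      _ = _ := by ring
  have a2 : ‖((2 * t * σ : ℝ) : ℂ) • opB ℓ x v‖ ≤ |σ| * KB * (1 + 1 / qq x) * (qq x + t^2) * ‖v‖ := by
    rw [norm_smul, Complex.norm_real, Real.norm_eq_abs, abs_mul, abs_mul, abs_two]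
    have ht : 2 * |t| ≤ (1 + 1 / qq x) * (qq x + t^2) := by
      have e : (1 + 1 / qq x) * (qq x + t^2) = qq x + t^2 + 1 + t^2 / qq x := by field_simp; ring
      rw [e]
      have : 0 ≤ t^2 / qq x := by positivity
      nlinarith [sq_nonneg (|t| - 1), sq_abs t]
    calc _ ≤ (1 + 1 / qq x) * (qq x + t^2) * |σ| * (KB * ‖v‖) := by gcongr; exact hB v
      _ = _ := by ring
  have a3 : ‖(opB ℓ x * opB ℓ x) v‖ ≤ KC / qq x * (qq x + t^2) * ‖v‖ := by
    refine (hC v).trans ?_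
    have : KC ≤ KC / qq x * (qq x + t^2) := by
      rw [div_mul_eq_mul_div, le_div_iff₀ hq]; nlinarith [sq_nonneg t, mul_nonneg hC0 (sq_nonneg t)]
    gcongr
  calc _ ≤ ‖((2 * c * (qq x + t^2) : ℝ) : ℂ) • opN ℓ v‖ + ‖((2 * t * σ : ℝ) : ℂ) • opB ℓ x v‖
        + ‖(opB ℓ x * opB ℓ x) v‖ := (norm_add_le _ _).trans (by gcongr; exact norm_sub_le _ _)
    _ ≤ _ := by rw [add_mul, add_mul, add_mul, add_mul]; gcongr

lemma fibre_unique (c σ : ℝ) (hσ : |σ| < c) (ℓ : Fin n) (x : Fin n → ℝ) (hx : x ℓ = 0)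
    (hq : 0 < qq x) (μ : ℂ) (hμ : μ = I ∨ μ = -I) (f f' f'' : ℝ → Lam n)
    (h1 : ∀ t, HasDerivAt f (f' t) t) (h2 : ∀ t, HasDerivAt f' (f'' t) t)
    (hc2 : Continuous f'')
    (heq : ∀ t, Lsh c σ ℓ x t (f t) (f' t) (f'' t) = μ • f t)
    (hint : Integrable (fun t => (qq x + t^2) ^ σ * ‖f t‖^2)) : ∀ t, f t = 0 := by
  have hc0 : 0 < c - |σ| := by linarith
  have hρ : ∀ t : ℝ, 0 < qq x + t^2 := fun t => by positivity
  obtain ⟨KQ, hKQ, hQ⟩ := norm_opQ_le c σ ℓ x hq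
  have hM := norm_opM_le c σ ℓ x hx
  set KM := |c + σ| + 2 * |σ| with hKM
  have hKM0 : 0 ≤ KM := by positivity
  set d := c - |σ| with hd
  choose mf hmf hmf1 hmf2 using fun t => inner_opM_bd c σ ℓ x hx t (f t)
  choose mk hmk hmk1 hmk2 using fun t => inner_opM_bd c σ ℓ x hx t (yy ℓ x t (f t) (f' t))
  -- the real potential
  have hreal : ∀ t, ∃ b : ℝ, inner ℂ (f t) (opM c σ ℓ x t (opQ c σ ℓ x t (f t))) = (b:ℂ) := by
    intro t
    refine Complex.conj_eq_iff_real.1 ?_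
    rw [inner_conj_symm, inner_opM]
    exact inner_opMQ c σ ℓ x hx t _ _
  choose b hb using hreal
  set z : ℝ → ℂ := fun t => (((qq x + t^2) ^ (σ - 1) : ℝ) : ℂ) *
        inner ℂ (f t) (opM c σ ℓ x t (yy ℓ x t (f t) (f' t))) with hz
  set w : ℝ → ℝ := fun t => (qq x + t^2) ^ (σ - 1) * mf t with hw
  set k : ℝ → ℝ := fun t => (qq x + t^2) ^ (σ - 2) * mk t with hk
  have hz' : ∀ t, HasDerivAt z ((k t + (qq x + t^2) ^ (σ - 2) * b t : ℝ) + μ * (w t : ℝ)) t := by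
    intro t
    refine (current c σ ℓ x hx hq (h1 t) (h1 t) (h2 t)).congr_deriv ?_
    rw [heq, map_smul, inner_smul_right, hmf, hmk, hb]
    simp only [hk, hw]
    push_cast
    ring
  have hρ1 : ∀ t : ℝ, (qq x + t^2) ^ σ = (qq x + t^2) ^ (σ - 1) * (qq x + t^2) := by
    intro t; rw [← Real.rpow_add_one (hρ t).ne']; congr 1; ring
  have hρ2 : ∀ t : ℝ, (qq x + t^2) ^ (σ - 1) = (qq x + t^2) ^ (σ - 2) * (qq x + t^2) := by
    intro t; rw [← Real.rpow_add_one (hρ t).ne']; congr 1; ring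
  have hr2 : ∀ t : ℝ, 0 < (qq x + t^2) ^ (σ - 2) := fun t => Real.rpow_pos_of_pos (hρ t) _
  have hr1 : ∀ t : ℝ, 0 < (qq x + t^2) ^ (σ - 1) := fun t => Real.rpow_pos_of_pos (hρ t) _
  -- pointwise bounds
  have hw0 : ∀ t, 0 ≤ w t := fun t => mul_nonneg (hr1 t).le
    (le_trans (by have := hρ t; positivity) (hmf1 t))
  have hk0 : ∀ t, 0 ≤ k t := fun t => mul_nonneg (hr2 t).le
    (le_trans (by have := hρ t; positivity) (hmk1 t))
  have hbb : ∀ t, |(qq x + t^2) ^ (σ - 2) * b t| ≤ (KM * KQ / d) * w t := by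
    intro t
    have e0 : |b t| ≤ ‖f t‖ * (KM * (qq x + t^2) * (KQ * (qq x + t^2) * ‖f t‖)) := by
      have : |b t| = ‖inner ℂ (f t) (opM c σ ℓ x t (opQ c σ ℓ x t (f t)))‖ := by
        rw [hb, Complex.norm_real, Real.norm_eq_abs]
      rw [this]
      refine (norm_inner_le_norm _ _).trans ?_
      gcongr
      refine (hM t _).trans ?_
      have := hρ t
      gcongr
      exact hQ t _
    rw [abs_mul, abs_of_pos (hr2 t), hw, div_mul_eq_mul_div, le_div_iff₀ hc0]
    simp only
    rw [hρ2]
    have e1 : KM * KQ * (d * (qq x + t^2) * ‖f t‖^2) ≤ KM * KQ * mf t := by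
      gcongr; exact hmf1 t
    calc (qq x + t^2) ^ (σ - 2) * |b t| * d
        ≤ (qq x + t^2) ^ (σ - 2) * (‖f t‖ * (KM * (qq x + t^2) * (KQ * (qq x + t^2) * ‖f t‖))) * d := by
          have := hr2 t; gcongr
      _ = (qq x + t^2) ^ (σ - 2) * (qq x + t^2) * (KM * KQ * (d * (qq x + t^2) * ‖f t‖^2)) := by ring
      _ ≤ (qq x + t^2) ^ (σ - 2) * (qq x + t^2) * (KM * KQ * mf t) := by
          have := hr2 t; have := hρ t; gcongr
      _ = _ := by ring
  have hzz : ∀ t, ‖z t‖^2 ≤ (KM^2 / d^2) * (qq x + t^2) * (w t * k t) := by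
    intro t
    set y := yy ℓ x t (f t) (f' t) with hy
    have e0 : ‖z t‖ ≤ (qq x + t^2) ^ (σ - 1) * (‖f t‖ * (KM * (qq x + t^2) * ‖y‖)) := by
      simp only [hz]
      rw [norm_mul, Complex.norm_real, Real.norm_eq_abs, abs_of_pos (hr1 t)]
      have := hr1 t
      gcongr
      refine (norm_inner_le_norm _ _).trans ?_
      gcongr
      exact hM t _
    have e1 : d * (qq x + t^2) * ‖f t‖^2 * (d * (qq x + t^2) * ‖y‖^2) ≤ mf t * mk t := by
      have := hρ t
      exact mul_le_mul (hmf1 t) (hmk1 t) (by positivity) (le_trans (by positivity) (hmf1 t))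
    have e2 : w t * k t = (qq x + t^2) ^ (σ - 2) * (qq x + t^2) * (qq x + t^2) ^ (σ - 2) * (mf t * mk t) := by
      simp only [hw, hk]; rw [hρ2]; ring
    rw [div_mul_eq_mul_div, div_mul_eq_mul_div, le_div_iff₀ (by positivity), e2]
    calc ‖z t‖^2 * d^2 ≤ ((qq x + t^2) ^ (σ - 1) * (‖f t‖ * (KM * (qq x + t^2) * ‖y‖)))^2 * d^2 := by
          gcongr
      _ = KM^2 * (qq x + t^2) * ((qq x + t^2) ^ (σ - 2) * (qq x + t^2) * (qq x + t^2) ^ (σ - 2) *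
          (d * (qq x + t^2) * ‖f t‖^2 * (d * (qq x + t^2) * ‖y‖^2))) := by rw [hρ2]; ring
      _ ≤ _ := by
          have := hr2 t; have := hρ t; gcongr
  have hcf : Continuous f := continuous_iff_continuousAt.2 fun t => (h1 t).continuousAt
  have hcf' : Continuous f' := continuous_iff_continuousAt.2 fun t => (h2 t).continuousAt
  have hcrho : Continuous fun t : ℝ => qq x + t^2 := by fun_prop
  have hcr : ∀ τ : ℝ, Continuous fun t : ℝ => (qq x + t^2) ^ τ := fun τ =>
    hcrho.rpow_const fun t => Or.inl (hρ t).ne'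
  have hcopM : ∀ y : ℝ → Lam n, Continuous y → Continuous fun t => opM c σ ℓ x t (y t) := by
    intro y hy
    simp only [opM, LinearMap.sub_apply, LinearMap.smul_apply, LinearMap.add_apply, Module.End.one_apply]
    have := fun A : Module.End ℂ (Lam n) => (continuous_end A).comp hy
    simp only [Function.comp_def] at this
    have a0 := this (opE0 x); have a1 := this (opE1 ℓ x); have a2 := this (opN ℓ)
    have b0 : Continuous fun t : ℝ => (((c + σ) * (qq x + t^2) : ℝ) : ℂ) := by fun_prop
    have b1 : Continuous fun t : ℝ => ((t^2 : ℝ) : ℂ) := by fun_prop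
    have b2 : Continuous fun t : ℝ => (t : ℂ) := by fun_prop
    exact (b0.smul hy).sub (((a0.add (b2.smul a1)).add (b1.smul a2)).const_smul ((2 * σ : ℝ) : ℂ))
  have hcopQ : ∀ y : ℝ → Lam n, Continuous y → Continuous fun t => opQ c σ ℓ x t (y t) := by
    intro y hy
    simp only [opQ, LinearMap.sub_apply, LinearMap.smul_apply, LinearMap.add_apply, Module.End.one_apply]
    have := fun A : Module.End ℂ (Lam n) => (continuous_end A).comp hy
    simp only [Function.comp_def] at this
    have a0 := this (opN ℓ); have a1 := this (opB ℓ x); have a2 := this (opB ℓ x * opB ℓ x)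
    have b0 : Continuous fun t : ℝ => ((2 * c * (qq x + t^2) : ℝ) : ℂ) := by fun_prop
    have b1 : Continuous fun t : ℝ => ((2 * t * σ : ℝ) : ℂ) := by fun_prop
    exact ((b0.smul a0).sub (b1.smul a1)).add a2
  have hcy : Continuous fun t => yy ℓ x t (f t) (f' t) := by
    have b0 : Continuous fun t : ℝ => ((qq x + t^2 : ℝ) : ℂ) := by fun_prop
    exact (b0.smul hcf').sub ((continuous_end _).comp hcf)
  have hcmf : Continuous mf := by
    have : mf = fun t => (inner ℂ (f t) (opM c σ ℓ x t (f t))).re := by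
      ext t; rw [hmf]; simp
    rw [this]; exact Complex.continuous_re.comp (hcf.inner (hcopM _ hcf))
  have hcmk : Continuous mk := by
    have : mk = fun t => (inner ℂ (yy ℓ x t (f t) (f' t)) (opM c σ ℓ x t (yy ℓ x t (f t) (f' t)))).re := by
      ext t; rw [hmk]; simp
    rw [this]; exact Complex.continuous_re.comp (hcy.inner (hcopM _ hcy))
  have hcb : Continuous b := by
    have : b = fun t => (inner ℂ (f t) (opM c σ ℓ x t (opQ c σ ℓ x t (f t)))).re := by
      ext t; rw [hb]; simp
    rw [this]; exact Complex.continuous_re.comp (hcf.inner (hcopM _ (hcopQ _ hcf)))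
  have hcw : Continuous w := (hcr _).mul hcmf
  have hck : Continuous k := (hcr _).mul hcmk
  have hwi : Integrable w := by
    refine (hint.const_mul (c + |σ|)).mono' hcw.aestronglyMeasurable (Filter.Eventually.of_forall fun t => ?_)
    rw [Real.norm_eq_abs, abs_of_nonneg (hw0 t), hρ1]
    simp only [hw]
    have := hr1 t
    calc _ ≤ (qq x + t^2) ^ (σ - 1) * ((c + |σ|) * (qq x + t^2) * ‖f t‖^2) := by
          gcongr; exact hmf2 t
      _ = _ := by ring
  -- the scalar function
  set C := KM * KQ / d with hC
  have hC0 : 0 ≤ C := by positivity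
  set e : ℝ := μ.im with he
  have he2 : e^2 = 1 := by rcases hμ with h | h <;> simp [he, h]
  have hre : μ.re = 0 := by rcases hμ with h | h <;> simp [h]
  have hzre : ∀ t, HasDerivAt (fun t => (z t).re) (k t + (qq x + t^2) ^ (σ - 2) * b t) t := by
    intro t
    have := Complex.reCLM.hasFDerivAt.comp_hasDerivAt t (hz' t)
    refine this.congr_deriv ?_
    simp [hre]
  have hzim : ∀ t, HasDerivAt (fun t => (z t).im) (e * w t) t := by
    intro t
    have := Complex.imCLM.hasFDerivAt.comp_hasDerivAt t (hz' t)
    refine this.congr_deriv ?_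
    simp [he]
  have key := gaffney (qq x) (((C+1)^2 + 1) * (KM^2/d^2)) hq (by positivity)
    (fun t => (C + 1) * (e * (z t).im) + (z t).re)
    (fun t => (C + 1) * (e * (e * w t)) + (k t + (qq x + t^2) ^ (σ - 2) * b t)) w k
    (fun t => (((hzim t).const_mul e).const_mul (C+1)).add (hzre t))
    (by have := hcr (σ - 2); fun_prop) hcw hw0 hk0 hwi
    (by
      intro t
      have := (abs_le.1 (hbb t)).1
      have e1 : e * (e * w t) = w t := by rw [← mul_assoc, ← sq, he2, one_mul]
      rw [e1]; linarith)
    (by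
      intro t
      have := hzz t
      have e1 : ((C + 1) * (e * (z t).im) + (z t).re)^2 ≤ ((C+1)^2 + 1) * ‖z t‖^2 := by
        rw [← Complex.normSq_eq_norm_sq, Complex.normSq_apply]
        have : (e * (z t).im)^2 = (z t).im * (z t).im := by rw [mul_pow, he2]; ring
        nlinarith [sq_nonneg ((e * (z t).im) - (C+1) * (z t).re)]
      refine e1.trans ?_
      calc _ ≤ ((C+1)^2 + 1) * ((KM^2 / d^2) * (qq x + t^2) * (w t * k t)) := by gcongr
        _ = _ := by ring)
  intro t
  have h0 := key t
  have h3 : mf t = 0 := by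
    rcases mul_eq_zero.1 h0 with h | h
    · exact absurd h (hr1 t).ne'
    · exact h
  have h4 := hmf1 t
  rw [h3] at h4
  have h5 : ‖f t‖^2 ≤ 0 := by
    have : 0 < d * (qq x + t^2) := mul_pos hc0 (hρ t)
    by_contra hh
    push Not at hh
    linarith [mul_pos this hh]
  have : ‖f t‖ = 0 := by nlinarith [norm_nonneg (f t)]
  exact norm_eq_zero.1 this


/-! ### du Bois-Reymond lemmas -/

section dbr
variable {E : Type*} [NormedAddCommGroup E] [NormedSpace ℝ E] [CompleteSpace E]

open scoped ContDiff

lemma supp_R {β : ℝ → ℝ} (hs : HasCompactSupport β) :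
    ∃ R : ℝ, 0 < R ∧ ∀ t, R ≤ |t| → β t = 0 ∧ deriv β t = 0 := by
  obtain ⟨R, hR⟩ := hs.isCompact.isBounded.subset_ball 0
  refine ⟨max R 1, by positivity, fun t ht => ?_⟩
  have hn : t ∉ tsupport β := by
    intro h
    have := hR h
    rw [Metric.mem_ball, dist_zero_right, Real.norm_eq_abs] at this
    linarith [le_max_left R 1]
  refine ⟨image_eq_zero_of_notMem_tsupport hn, ?_⟩
  by_contra h
  exact hn (support_deriv_subset (𝕜 := ℝ) h)

lemma li_ii {h : ℝ → E} (hh : LocallyIntegrable h) (a b : ℝ) : IntervalIntegrable h volume a b :=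
  (intervalIntegrable_iff').2 (hh.integrableOn_isCompact isCompact_uIcc)

lemma ibp {h : ℝ → E} (hh : LocallyIntegrable h) {β : ℝ → ℝ} (hβ : ContDiff ℝ 1 β)
    (hs : HasCompactSupport β) :
    ∫ t, deriv β t • (∫ s in (0:ℝ)..t, h s) = - ∫ t, β t • h t := by
  obtain ⟨R, hR0, hR⟩ := supp_R hs
  have hR1 : ∀ t, t ∉ Set.Ioc (-R) R → R ≤ |t| := by
    intro t ht
    by_contra hc
    push Not at hc
    exact ht ⟨(abs_lt.1 hc).1, (abs_lt.1 hc).2.le⟩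
  have hi : ∀ a b, IntervalIntegrable h volume a b := fun a b =>
    li_ii hh a b
  have hcd : Continuous (deriv β) := hβ.continuous_deriv le_rfl
  have hd : ∀ t, HasDerivAt β (deriv β t) t := fun t =>
    (hβ.differentiable one_ne_zero t).hasDerivAt
  set μ := (volume : Measure ℝ).restrict (Set.Ioc (-R) R) with hμ
  have hIh : Integrable h μ := (intervalIntegrable_iff_integrableOn_Ioc_of_le (by linarith)).1 (hi (-R) R)
  have hIb : Integrable (deriv β) μ :=
    (intervalIntegrable_iff_integrableOn_Ioc_of_le (by linarith)).1 (hcd.intervalIntegrable (-R) R)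
  have e1 : ∫ t, deriv β t • (∫ s in (0:ℝ)..t, h s) = ∫ t, deriv β t • (∫ s in (0:ℝ)..t, h s) ∂μ := by
    symm
    apply setIntegral_eq_integral_of_forall_compl_eq_zero
    intro t ht
    rw [(hR t (hR1 t ht)).2, zero_smul]
  have e2 : ∫ t, β t • h t = ∫ t, β t • h t ∂μ := by
    symm
    apply setIntegral_eq_integral_of_forall_compl_eq_zero
    intro t ht
    rw [(hR t (hR1 t ht)).1, zero_smul]
  have hβR : β R = 0 := (hR R (le_abs_self R)).1
  have hβR' : β (-R) = 0 := (hR (-R) (by rw [abs_neg]; exact le_abs_self R)).1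
  have e3 : ∀ t ∈ Set.Ioc (-R) R, ∫ s in (0:ℝ)..t, h s =
      (∫ s in (0:ℝ)..(-R), h s) + ∫ s, (Set.Iic t).indicator h s ∂μ := by
    intro t ht
    rw [← intervalIntegral.integral_add_adjacent_intervals (hi 0 (-R)) (hi (-R) t)]
    congr 1
    rw [intervalIntegral.integral_of_le ht.1.le, integral_indicator measurableSet_Iic, hμ,
      Measure.restrict_restrict measurableSet_Iic]
    congr 2
    ext s; simp only [Set.mem_Ioc, Set.mem_inter_iff, Set.mem_Iic]
    constructor
    · rintro ⟨h1, h2⟩; exact ⟨h2, h1, h2.trans ht.2⟩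
    · rintro ⟨h1, h2, _⟩; exact ⟨h2, h1⟩
  have e4 : ∫ t, deriv β t ∂μ = 0 := by
    rw [hμ, ← intervalIntegral.integral_of_le (by linarith),
      intervalIntegral.integral_eq_sub_of_hasDerivAt (fun t _ => hd t) (hcd.intervalIntegrable _ _), hβR, hβR', sub_zero]
  have hprod : Integrable (fun z : ℝ × ℝ => {z : ℝ × ℝ | z.2 ≤ z.1}.indicator
      (fun z => deriv β z.1 • h z.2) z) (μ.prod μ) :=
    (hIb.smul_prod hIh).indicator (measurableSet_le measurable_snd measurable_fst)
  have e5 : ∀ t s : ℝ, deriv β t • (Set.Iic t).indicator h s =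
      {z : ℝ × ℝ | z.2 ≤ z.1}.indicator (fun z => deriv β z.1 • h z.2) (t, s) := by
    intro t s
    by_cases hst : s ≤ t <;> simp [Set.indicator, hst]
  have e6 : ∀ s ∈ Set.Ioc (-R) R, ∫ t, {z : ℝ × ℝ | z.2 ≤ z.1}.indicator
      (fun z => deriv β z.1 • h z.2) (t, s) ∂μ = - (β s • h s) := by
    intro s hs
    have : ∀ t, {z : ℝ × ℝ | z.2 ≤ z.1}.indicator (fun z => deriv β z.1 • h z.2) (t, s)
        = ((Set.Ici s).indicator (deriv β) t) • h s := by
      intro t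
      by_cases hst : s ≤ t <;> simp [Set.indicator, hst]
    simp only [this]
    rw [integral_smul_const, integral_indicator measurableSet_Ici, hμ,
      Measure.restrict_restrict measurableSet_Ici]
    have : Set.Ici s ∩ Set.Ioc (-R) R = Set.Icc s R := by
      ext t; simp only [Set.mem_Ioc, Set.mem_inter_iff, Set.mem_Ici, Set.mem_Icc]
      constructor
      · rintro ⟨h1, h2, h3⟩; exact ⟨h1, h3⟩
      · rintro ⟨h1, h2⟩; exact ⟨h1, lt_of_lt_of_le hs.1 h1, h2⟩
    rw [this, integral_Icc_eq_integral_Ioc, ← intervalIntegral.integral_of_le hs.2,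
      intervalIntegral.integral_eq_sub_of_hasDerivAt (fun t _ => hd t) (hcd.intervalIntegrable _ _), hβR, zero_sub, neg_smul]
  rw [e1, e2]
  have s1 : ∫ t, deriv β t • (∫ s in (0:ℝ)..t, h s) ∂μ =
      ∫ t, (deriv β t • (∫ s in (0:ℝ)..(-R), h s)
        + ∫ s, {z : ℝ × ℝ | z.2 ≤ z.1}.indicator (fun z => deriv β z.1 • h z.2) (t, s) ∂μ) ∂μ := by
    apply setIntegral_congr_fun measurableSet_Ioc
    intro t ht
    simp only
    rw [e3 t ht, smul_add, ← integral_smul]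
    simp only [e5]
  rw [s1, integral_add (hIb.smul_const _) hprod.integral_prod_left, integral_smul_const, e4, zero_smul, zero_add,
    integral_integral_swap hprod]
  rw [setIntegral_congr_fun measurableSet_Ioc e6, integral_neg]

/-- a primitive of a mean zero test function is a test function -/
lemma prim_test {θ : ℝ → ℝ} (hθ : ContDiff ℝ ∞ θ) (hs : HasCompactSupport θ) (h0 : ∫ t, θ t = 0) :
    ∃ β : ℝ → ℝ, ContDiff ℝ ∞ β ∧ HasCompactSupport β ∧ deriv β = θ := by
  obtain ⟨R, hR0, hR⟩ := supp_R hs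
  refine ⟨fun t => ∫ s in (-R)..t, θ s, ?_, ?_, ?_⟩
  · have hd : ∀ t, HasDerivAt (fun t => ∫ s in (-R)..t, θ s) (θ t) t := fun t =>
      intervalIntegral.integral_hasDerivAt_right (hθ.continuous.intervalIntegrable _ _)
        (hθ.continuous.stronglyMeasurableAtFilter _ _) hθ.continuous.continuousAt
    rw [contDiff_infty_iff_deriv]
    refine ⟨fun t => (hd t).differentiableAt, ?_⟩
    have : deriv (fun t => ∫ s in (-R)..t, θ s) = θ := funext fun t => (hd t).deriv
    rw [this]; exact hθ
  · apply HasCompactSupport.intro (K := Set.Icc (-R) R) isCompact_Icc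
    intro t ht
    rw [Set.mem_Icc, not_and_or, not_le, not_le] at ht
    rcases ht with ht | ht
    · have : Set.EqOn θ 0 (Set.uIcc (-R) t) := by
        intro s hs'
        rw [Set.uIcc_of_ge ht.le] at hs'
        exact (hR s (by rw [abs_of_nonpos (by linarith [hs'.2])]; linarith [hs'.2])).1
      rw [intervalIntegral.integral_congr this]; simp
    · rw [← h0, intervalIntegral.integral_of_le (by linarith)]
      apply setIntegral_eq_integral_of_forall_compl_eq_zero
      intro s hs'
      rw [Set.mem_Ioc, not_and_or, not_lt, not_le] at hs'
      rcases hs' with hs' | hs'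
      · exact (hR s (by rw [abs_of_nonpos (by linarith)]; linarith)).1
      · exact (hR s (by rw [abs_of_nonneg (by linarith)]; linarith)).1
  · ext t
    exact (intervalIntegral.integral_hasDerivAt_right (hθ.continuous.intervalIntegrable _ _)
        (hθ.continuous.stronglyMeasurableAtFilter _ _) hθ.continuous.continuousAt).deriv

lemma exists_eta : ∃ η : ℝ → ℝ, ContDiff ℝ ∞ η ∧ HasCompactSupport η ∧ ∫ t, η t = 1 := by
  let b : ContDiffBump (0:ℝ) := ⟨1, 2, one_pos, one_lt_two⟩
  exact ⟨b.normed volume, b.contDiff_normed, b.hasCompactSupport_normed, b.integral_normed⟩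

lemma integrable_test {h : ℝ → E} (hh : LocallyIntegrable h) {β : ℝ → ℝ} (hβ : Continuous β)
    (hs : HasCompactSupport β) : Integrable (fun t => β t • h t) :=
  hh.integrable_smul_left_of_hasCompactSupport hβ hs

lemma dbr1 {h : ℝ → E} (hh : LocallyIntegrable h)
    (H : ∀ β : ℝ → ℝ, ContDiff ℝ ∞ β → HasCompactSupport β → ∫ t, deriv β t • h t = 0) :
    ∃ A : E, ∀ᵐ t, h t = A := by
  obtain ⟨η, hη, hηs, hη1⟩ := exists_eta
  refine ⟨∫ t, η t • h t, ?_⟩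
  set A := ∫ t, η t • h t with hA
  have : ∀ᵐ t, h t - A = 0 := by
    apply ae_eq_zero_of_integral_contDiff_smul_eq_zero (hh.sub (continuous_const.locallyIntegrable))
    intro g hg hgs
    have ig := hg.continuous.integrable_of_hasCompactSupport (μ := volume) hgs
    have iη := hη.continuous.integrable_of_hasCompactSupport (μ := volume) hηs
    obtain ⟨β, hβ, hβs, hβd⟩ := prim_test (θ := fun t => g t - (∫ t, g t) * η t)
      (hg.sub (contDiff_const.mul hη)) (hgs.sub (hηs.mul_left)) (by
        rw [integral_sub ig (iη.const_mul _), integral_const_mul, hη1]; ring)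
    have := H β hβ hβs
    rw [hβd] at this
    simp only [sub_smul, mul_smul] at this
    have iη' : Integrable fun t => (∫ t, g t) • η t • h t := (integrable_test hh hη.continuous hηs).smul _
    rw [integral_sub (integrable_test hh hg.continuous hgs) iη', integral_smul] at this
    simp only [Pi.sub_apply, smul_sub]
    rw [integral_sub (integrable_test hh hg.continuous hgs) (ig.smul_const A), integral_smul_const]
    exact this
  filter_upwards [this] with t ht
  exact sub_eq_zero.1 ht

lemma dbr2 {h : ℝ → E} (hh : LocallyIntegrable h)
    (H : ∀ β : ℝ → ℝ, ContDiff ℝ ∞ β → HasCompactSupport β → ∫ t, deriv (deriv β) t • h t = 0) :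
    ∃ A B : E, ∀ᵐ t, h t = A + t • B := by
  obtain ⟨η, hη, hηs, hη1⟩ := exists_eta
  set κ := ∫ t, deriv η t • h t with hκ
  have hdη : ContDiff ℝ ∞ (deriv η) := (contDiff_infty_iff_deriv.1 hη).2
  have hid : LocallyIntegrable (fun t : ℝ => t • κ) :=
    (continuous_id.smul continuous_const).locallyIntegrable
  obtain ⟨A, hA⟩ := dbr1 (h := fun t => h t + t • κ) (hh.add hid) (by
    intro θ hθ hθs
    have hdθ : ContDiff ℝ ∞ (deriv θ) := (contDiff_infty_iff_deriv.1 hθ).2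
    have iθ := hθ.continuous.integrable_of_hasCompactSupport (μ := volume) hθs
    have iη := hη.continuous.integrable_of_hasCompactSupport (μ := volume) hηs
    obtain ⟨β, hβ, hβs, hβd⟩ := prim_test (θ := fun t => θ t - (∫ t, θ t) * η t)
      (hθ.sub (contDiff_const.mul hη)) (hθs.sub (hηs.mul_left)) (by
        rw [integral_sub iθ (iη.const_mul _), integral_const_mul, hη1]; ring)
    have := H β hβ hβs
    have hdd : deriv (deriv β) = fun t => deriv θ t - (∫ t, θ t) * deriv η t := by
      rw [hβd]; ext t
      exact (((hθ.differentiable (by simp) t).hasDerivAt).sub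
        (((hη.differentiable (by simp) t).hasDerivAt).const_mul _)).deriv
    rw [hdd] at this
    simp only [sub_smul, mul_smul] at this
    have iη' : Integrable fun t => (∫ t, θ t) • deriv η t • h t :=
      (integrable_test hh hdη.continuous hηs.deriv).smul _
    rw [integral_sub (integrable_test hh hdθ.continuous hθs.deriv) iη', integral_smul, ← hκ, sub_eq_zero] at this
    simp only [smul_add]
    rw [integral_add (integrable_test hh hdθ.continuous hθs.deriv)
      (integrable_test hid hdθ.continuous hθs.deriv), this]
    have e := ibp (h := fun _ => κ) continuous_const.locallyIntegrable (hθ.of_le (by simp)) hθs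
    simp only [intervalIntegral.integral_const, sub_zero] at e
    rw [e, integral_smul_const, add_neg_cancel])
  refine ⟨A, -κ, ?_⟩
  filter_upwards [hA] with t ht
  rw [← ht]; simp

lemma dbr {F2 F1 F0 : ℝ → E} (h2 : LocallyIntegrable F2) (h1 : LocallyIntegrable F1)
    (h0 : LocallyIntegrable F0)
    (H : ∀ β : ℝ → ℝ, ContDiff ℝ ∞ β → HasCompactSupport β →
      ∫ t, (deriv (deriv β) t • F2 t + deriv β t • F1 t + β t • F0 t) = 0) :
    ∃ A B : E, ∀ᵐ t, F2 t = A + t • B + ∫ s in (0:ℝ)..t, (F1 s - ∫ r in (0:ℝ)..s, F0 r) := by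
  have hi : ∀ a b, IntervalIntegrable F0 volume a b := fun a b => li_ii h0 a b
  have hG0 : Continuous fun s => ∫ r in (0:ℝ)..s, F0 r :=
    intervalIntegral.continuous_primitive hi 0
  have h10 : LocallyIntegrable fun s => F1 s - ∫ r in (0:ℝ)..s, F0 r := h1.sub hG0.locallyIntegrable
  have hi1 : ∀ a b, IntervalIntegrable (fun s => F1 s - ∫ r in (0:ℝ)..s, F0 r) volume a b :=
    fun a b => li_ii h10 a b
  have hG1 : Continuous fun t => ∫ s in (0:ℝ)..t, (F1 s - ∫ r in (0:ℝ)..s, F0 r) :=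
    intervalIntegral.continuous_primitive hi1 0
  obtain ⟨A, B, hAB⟩ := dbr2 (h2.sub hG1.locallyIntegrable) (by
    intro β hβ hβs
    have hdβ : ContDiff ℝ ∞ (deriv β) := (contDiff_infty_iff_deriv.1 hβ).2
    have hddβ : ContDiff ℝ ∞ (deriv (deriv β)) := (contDiff_infty_iff_deriv.1 hdβ).2
    have e0 := ibp h0 (hβ.of_le (by simp)) hβs
    have e1 := ibp h10 (hdβ.of_le (by simp)) hβs.deriv
    have := H β hβ hβs
    have i2 := integrable_test h2 hddβ.continuous hβs.deriv.deriv
    have i1 := integrable_test h1 hdβ.continuous hβs.deriv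
    have i0 := integrable_test h0 hβ.continuous hβs
    have j1 := integrable_test hG1.locallyIntegrable hddβ.continuous hβs.deriv.deriv
    have j0 := integrable_test hG0.locallyIntegrable hdβ.continuous hβs.deriv
    have i21 : Integrable fun t => deriv (deriv β) t • F2 t + deriv β t • F1 t := i2.add i1
    rw [integral_add i21 i0, integral_add i2 i1] at this
    simp only [Pi.sub_apply, smul_sub]
    rw [integral_sub i2 j1, e1]
    simp only [smul_sub]
    rw [integral_sub i1 j0, e0, ← this]
    abel)
  refine ⟨A, B, ?_⟩
  filter_upwards [hAB] with t ht
  simp only [Pi.sub_apply] at ht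
  rw [← ht]; abel

end dbr


/-! ### Weak uniqueness on a fibre -/

lemma locInt_end (A : Module.End ℂ (Lam n)) {f : ℝ → Lam n} (hf : LocallyIntegrable f) :
    LocallyIntegrable (fun t => A (f t)) := by
  rw [locallyIntegrable_iff] at hf ⊢
  exact fun K hK => (LinearMap.toContinuousLinearMap A).integrable_comp (hf K hK)

lemma locInt_smul {g : ℝ → ℂ} (hg : Continuous g) {f : ℝ → Lam n} (hf : LocallyIntegrable f) :
    LocallyIntegrable (fun t => g t • f t) := hf.continuous_smul hg

/-- first order coefficient -/
def A1f (s : ℝ) (ℓ : Fin n) (x : Fin n → ℝ) (t : ℝ) (v : Lam n) : Lam n :=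
  ((2 * (1 + s) * t : ℝ) : ℂ) • v + (2:ℂ) • opB ℓ x v
/-- zeroth order coefficient -/
def A0f (c s : ℝ) (κ : ℂ) (ℓ : Fin n) (v : Lam n) : Lam n :=
  ((2 * s : ℝ) : ℂ) • v - ((2 * c : ℝ) : ℂ) • opN ℓ v + κ • v

open scoped ContDiff in
lemma fibre_weak_unique (c s : ℝ) (hs : |s| < c) (ℓ : Fin n) (x : Fin n → ℝ) (hx : x ℓ = 0)
    (hq : 0 < qq x) (κ : ℂ) (hκ : κ = I ∨ κ = -I) (f : ℝ → Lam n) (hf : LocallyIntegrable f)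
    (hint : Integrable (fun t => (qq x + t^2) ^ (-s) * ‖f t‖^2))
    (H : ∀ β : ℝ → ℝ, ContDiff ℝ ∞ β → HasCompactSupport β →
      ∫ t, (deriv (deriv β) t • (((qq x + t^2 : ℝ) : ℂ) • f t) + deriv β t • A1f s ℓ x t (f t)
        + β t • A0f c s κ ℓ (f t)) = 0) :
    ∀ᵐ t, f t = 0 := by
  have hρ : ∀ t : ℝ, 0 < qq x + t^2 := fun t => by positivity
  have cρ : Continuous fun t : ℝ => ((qq x + t^2 : ℝ) : ℂ) := by fun_prop
  have ct : Continuous fun t : ℝ => ((2 * (1 + s) * t : ℝ) : ℂ) := by fun_prop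
  have l2 := locInt_smul cρ hf
  have l1 : LocallyIntegrable (fun t => A1f s ℓ x t (f t)) :=
    (locInt_smul ct hf).add (locInt_smul continuous_const (locInt_end (opB ℓ x) hf))
  have l0 : LocallyIntegrable (fun t => A0f c s κ ℓ (f t)) :=
    ((locInt_smul continuous_const hf).sub (locInt_smul continuous_const (locInt_end (opN ℓ) hf))).add
      (locInt_smul continuous_const hf)
  obtain ⟨A, B, hAB⟩ := dbr l2 l1 l0 H
  set h : ℝ → Lam n := fun t => A + t • B + ∫ s' in (0:ℝ)..t, (A1f s ℓ x s' (f s') -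
    ∫ r in (0:ℝ)..s', A0f c s κ ℓ (f r)) with hh
  set F : ℝ → Lam n := fun t => (((qq x + t^2 : ℝ) : ℂ))⁻¹ • h t with hF
  have hρc : ∀ t : ℝ, ((qq x + t^2 : ℝ) : ℂ) ≠ 0 := fun t => by
    exact_mod_cast (hρ t).ne'
  have hfF : ∀ᵐ t, f t = F t := by
    filter_upwards [hAB] with t ht
    have ht' : ((qq x + t^2 : ℝ) : ℂ) • f t = h t := ht
    simp only [hF]
    rw [← ht', smul_smul, inv_mul_cancel₀ (hρc t), one_smul]
  have hG0e : ∀ s' : ℝ, ∫ r in (0:ℝ)..s', A0f c s κ ℓ (f r) = ∫ r in (0:ℝ)..s', A0f c s κ ℓ (F r) := by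
    intro s'
    apply intervalIntegral.integral_congr_ae
    filter_upwards [hfF] with r hr _
    rw [hr]
  set G0 : ℝ → Lam n := fun s' => ∫ r in (0:ℝ)..s', A0f c s κ ℓ (F r) with hG0
  have hhe : ∀ t, h t = A + t • B + ∫ s' in (0:ℝ)..t, (A1f s ℓ x s' (F s') - G0 s') := by
    intro t
    simp only [hh]
    congr 1
    apply intervalIntegral.integral_congr_ae
    filter_upwards [hfF] with r hr _
    rw [hr, hG0e]
  -- continuity
  have hch : Continuous h := by
    have hi : ∀ a b, IntervalIntegrable (fun s' => A1f s ℓ x s' (f s') -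
        ∫ r in (0:ℝ)..s', A0f c s κ ℓ (f r)) volume a b := by
      intro a b
      refine li_ii (l1.sub ?_) a b
      exact (intervalIntegral.continuous_primitive (fun a b => li_ii l0 a b) 0).locallyIntegrable
    have := intervalIntegral.continuous_primitive hi 0
    simp only [hh]
    fun_prop
  have hcinv : Continuous fun t : ℝ => (((qq x + t^2 : ℝ) : ℂ))⁻¹ := cρ.inv₀ hρc
  have hcF : Continuous F := hcinv.smul hch
  have cA1 : ∀ g : ℝ → Lam n, Continuous g → Continuous fun t => A1f s ℓ x t (g t) := fun g hg =>
    (ct.smul hg).add (((continuous_end (opB ℓ x)).comp hg).const_smul (2:ℂ))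
  have cA0 : ∀ g : ℝ → Lam n, Continuous g → Continuous fun t => A0f c s κ ℓ (g t) := fun g hg =>
    ((hg.const_smul ((2 * s : ℝ) : ℂ)).sub (((continuous_end (opN ℓ)).comp hg).const_smul
      ((2 * c : ℝ) : ℂ))).add (hg.const_smul κ)
  have hdG0 : ∀ t, HasDerivAt G0 (A0f c s κ ℓ (F t)) t := fun t =>
    intervalIntegral.integral_hasDerivAt_right ((cA0 F hcF).intervalIntegrable _ _)
      ((cA0 F hcF).stronglyMeasurableAtFilter _ _) (cA0 F hcF).continuousAt
  have hcG0 : Continuous G0 := continuous_iff_continuousAt.2 fun t => (hdG0 t).continuousAt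
  have hcI : Continuous fun s' => A1f s ℓ x s' (F s') - G0 s' := (cA1 F hcF).sub hcG0
  set h' : ℝ → Lam n := fun t => B + (A1f s ℓ x t (F t) - G0 t) with hh'
  have hdh : ∀ t, HasDerivAt h (h' t) t := by
    intro t
    have e1 : HasDerivAt (fun t => ∫ s' in (0:ℝ)..t, (A1f s ℓ x s' (F s') - G0 s'))
        (A1f s ℓ x t (F t) - G0 t) t :=
      intervalIntegral.integral_hasDerivAt_right (hcI.intervalIntegrable _ _)
        (hcI.stronglyMeasurableAtFilter _ _) hcI.continuousAt
    have e2 : HasDerivAt (fun t : ℝ => A + t • B) B t := by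
      simpa using ((hasDerivAt_id t).smul_const B).const_add A
    have := e2.add e1
    rw [show h = _ from funext hhe]
    exact this
  have hdinv : ∀ t, HasDerivAt (fun t : ℝ => (((qq x + t^2 : ℝ) : ℂ))⁻¹)
      (-((2 * t : ℝ) : ℂ) / ((qq x + t^2 : ℝ) : ℂ)^2) t := fun t => (hasDerivAt_rho x t).fun_inv (hρc t)
  set F' : ℝ → Lam n := fun t => (((qq x + t^2 : ℝ) : ℂ))⁻¹ • (h' t - ((2 * t : ℝ) : ℂ) • F t) with hF'
  have hdF : ∀ t, HasDerivAt F (F' t) t := by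
    intro t
    refine ((hdinv t).smul (hdh t)).congr_deriv ?_
    simp only [hF', hF, smul_sub, smul_smul]
    rw [sub_eq_add_neg, ← neg_smul]
    congr 2
    have := hρc t
    field_simp
  set h'' : ℝ → Lam n := fun t => ((2 * (1 + s) : ℝ) : ℂ) • F t + A1f s ℓ x t (F' t)
    - A0f c s κ ℓ (F t) with hh''
  have hdt : ∀ (k t : ℝ), HasDerivAt (fun t : ℝ => ((k * t : ℝ) : ℂ)) (k : ℂ) t := by
    intro k t
    have := ((hasDerivAt_id t).const_mul k).ofReal_comp
    simpa using this
  have hdh' : ∀ t, HasDerivAt h' (h'' t) t := by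
    intro t
    have e1 : HasDerivAt (fun t => A1f s ℓ x t (F t))
        (((2 * (1 + s) : ℝ) : ℂ) • F t + A1f s ℓ x t (F' t)) t := by
      refine (((hdt (2 * (1+s)) t).smul (hdF t)).add
        ((hasDerivAt_end (opB ℓ x) (hdF t)).const_smul (2:ℂ))).congr_deriv ?_
      simp only [A1f]
      abel
    exact (e1.sub (hdG0 t)).const_add B
  have hcF' : Continuous F' := by
    have : Continuous h' := continuous_iff_continuousAt.2 fun t => (hdh' t).continuousAt
    have c2 : Continuous fun t : ℝ => ((2 * t : ℝ) : ℂ) := by fun_prop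
    exact hcinv.smul (this.sub (c2.smul hcF))
  set F'' : ℝ → Lam n := fun t => (((qq x + t^2 : ℝ) : ℂ))⁻¹ • (h'' t - (2:ℂ) • F t
    - ((4 * t : ℝ) : ℂ) • F' t) with hF''
  have hdF' : ∀ t, HasDerivAt F' (F'' t) t := by
    intro t
    have e1 : HasDerivAt (fun t => h' t - ((2 * t : ℝ) : ℂ) • F t)
        (h'' t - (((2 * t : ℝ) : ℂ) • F' t + (2:ℂ) • F t)) t := by
      refine ((hdh' t).sub ((hdt 2 t).smul (hdF t))).congr_deriv ?_
      simp
    refine ((hdinv t).smul e1).congr_deriv ?_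
    have e2 : h' t - ((2 * t : ℝ) : ℂ) • F t = ((qq x + t^2 : ℝ) : ℂ) • F' t := by
      simp only [hF', smul_smul]; rw [mul_inv_cancel₀ (hρc t), one_smul]
    rw [e2]
    have e3 : -((2 * t : ℝ) : ℂ) / ((qq x + t^2 : ℝ) : ℂ)^2 * ((qq x + t^2 : ℝ) : ℂ) =
        (((qq x + t^2 : ℝ) : ℂ))⁻¹ * (-((2 * t : ℝ) : ℂ)) := by
      have := hρc t
      field_simp
    have e4 : (-((2 * t : ℝ) : ℂ) / ((qq x + t^2 : ℝ) : ℂ)^2) • ((qq x + t^2 : ℝ) : ℂ) • F' t =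
        ((((qq x + t^2 : ℝ) : ℂ))⁻¹ * (-((2 * t : ℝ) : ℂ))) • F' t := by
      rw [← e3, ← smul_smul]
    rw [e4]
    simp only [hF'']
    generalize F' t = z
    push_cast
    module
  have hch'' : Continuous h'' :=
    ((hcF.const_smul ((2 * (1 + s) : ℝ) : ℂ)).add (cA1 F' hcF')).sub (cA0 F hcF)
  have hcF'' : Continuous F'' := by
    have c2 : Continuous fun t : ℝ => ((4 * t : ℝ) : ℂ) := by fun_prop
    exact hcinv.smul ((hch''.sub (hcF.const_smul (2:ℂ))).sub (c2.smul hcF'))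
  have hode : ∀ t, Lsh c (-s) ℓ x t (F t) (F' t) (F'' t) = (-κ) • F t := by
    intro t
    simp only [Lsh, hF'']
    rw [smul_smul, mul_inv_cancel₀ (hρc t), one_smul]
    simp only [hh'', A1f, A0f]
    push_cast
    module
  have hintF : Integrable (fun t => (qq x + t^2) ^ (-s) * ‖F t‖^2) := by
    refine hint.congr ?_
    filter_upwards [hfF] with t ht
    rw [ht]
  have hz := fibre_unique c (-s) (by rwa [abs_neg]) ℓ x hx hq (-κ)
    (by rcases hκ with h | h <;> simp [h]) F F' F'' hdF hdF' hcF'' hode hintF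
  filter_upwards [hfF] with t ht
  rw [ht, hz t]


/-! ### Fourier transform on Schwartz space -/

/-- Schwartz space of forms -/
abbrev Sch (n : ℕ) := SchwartzMap (Rn n) (Lam n)

/-- dilation -/
def dil (n : ℕ) (r : ℝ) (hr : r ≠ 0) : Rn n ≃L[ℝ] Rn n := ContinuousLinearEquiv.smulLeft (Units.mk0 r hr)

lemma dil_apply (r : ℝ) (hr : r ≠ 0) (x : Rn n) : dil n r hr x = r • x := rfl

lemma tpi : (2 * Real.pi) ≠ 0 := by positivity
lemma tpi' : (2 * Real.pi)⁻¹ ≠ 0 := by positivity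

/-- normalized Fourier transform -/
def FTc (n : ℕ) : Sch n →L[ℂ] Sch n :=
  (((2 * Real.pi) ^ (-(n:ℝ)/2) : ℝ) : ℂ) •
    ((SchwartzMap.compCLMOfContinuousLinearEquiv ℂ (dil n _ tpi')) ∘L
      (SchwartzMap.fourierTransformCLM ℂ))

/-- normalized inverse Fourier transform -/
def IFTc (n : ℕ) (u : Sch n) : Sch n :=
  (((2 * Real.pi) ^ (-(n:ℝ)/2) : ℝ) : ℂ)⁻¹ •
    FourierTransformInv.fourierInv ((SchwartzMap.compCLMOfContinuousLinearEquiv ℂ (dil n _ tpi)) u)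

open FourierTransform in
lemma FTc_apply (u : Sch n) (ξ : Rn n) : FTc n u ξ = (((2 * Real.pi) ^ (-(n:ℝ)/2) : ℝ) : ℂ) •
    (𝓕 u : Sch n) ((2 * Real.pi)⁻¹ • ξ) := rfl

lemma FTc_IFTc (u : Sch n) : FTc n (IFTc n u) = u := by
  have h : (((2 * Real.pi) ^ (-(n:ℝ)/2) : ℝ) : ℂ) ≠ 0 := by
    exact_mod_cast (Real.rpow_pos_of_pos (by positivity) _).ne'
  unfold IFTc
  rw [map_smul]
  ext1 ξ
  rw [smul_apply, FTc_apply, smul_smul, inv_mul_cancel₀ h, one_smul,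
    FourierTransform.fourier_fourierInv_eq, SchwartzMap.compCLMOfContinuousLinearEquiv_apply]
  simp only [Function.comp_apply, dil_apply, smul_smul]
  rw [mul_inv_cancel₀ tpi, one_smul]

lemma ft_eq (u : Sch n) (ξ : Rn n) : ft (fun x => u x) ξ = FTc n u ξ := by
  rw [FTc_apply, SchwartzMap.fourier_coe, Real.fourier_eq']
  unfold ft
  rw [← Complex.coe_smul]
  congr 2
  ext1 x
  congr 2
  rw [real_inner_smul_right, ← neg_mul, ← Complex.ofReal_neg]
  congr 2
  rw [neg_mul, neg_mul, ← mul_assoc, mul_inv_cancel₀ tpi, one_mul, PiLp.inner_apply]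
  congr 1
  exact Finset.sum_congr rfl fun j _ => by simp [mul_comm]

/-- partial derivative on Schwartz space -/
def Dj (j : Fin n) : Sch n →L[ℂ] Sch n :=
  LineDeriv.lineDerivOpCLM ℂ (Sch n) (EuclideanSpace.single j (1:ℝ))
/-- coordinate multiplication on Schwartz space -/
def Xj (j : Fin n) : Sch n →L[ℂ] Sch n := SchwartzMap.smulLeftCLM (Lam n) (fun x : Rn n => ((x j : ℝ) : ℂ))
/-- pointwise endomorphism on Schwartz space -/
def Ej (A : Module.End ℂ (Lam n)) : Sch n →L[ℂ] Sch n :=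
  SchwartzMap.postcompCLM (LinearMap.toContinuousLinearMap A)

lemma tg (j : Fin n) : (fun x : Rn n => ((x j : ℝ) : ℂ)).HasTemperateGrowth := by
  have : (fun x : Rn n => ((x j : ℝ) : ℂ)) = (Complex.ofRealCLM ∘L (EuclideanSpace.proj j : Rn n →L[ℝ] ℝ)) := by
    ext x; simp
  rw [this]
  exact ContinuousLinearMap.hasTemperateGrowth _

lemma tgi (j : Fin n) : (fun x : Rn n => inner ℝ x (EuclideanSpace.single j (1:ℝ))).HasTemperateGrowth := by
  fun_prop

lemma Dj_apply (j : Fin n) (u : Sch n) (x : Rn n) :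
    Dj j u x = fderiv ℝ (fun y => u y) x (EuclideanSpace.single j (1:ℝ)) := rfl
lemma pd_eq (j : Fin n) (u : Sch n) : pd j (fun y => u y) = fun x => Dj j u x := rfl
lemma Xj_apply (j : Fin n) (u : Sch n) (x : Rn n) : Xj j u x = ((x j : ℝ) : ℂ) • u x :=
  SchwartzMap.smulLeftCLM_apply_apply (tg j) u x
lemma Ej_apply (A : Module.End ℂ (Lam n)) (u : Sch n) (x : Rn n) : Ej A u x = A (u x) := rfl

lemma Dj_Ej (j : Fin n) (A : Module.End ℂ (Lam n)) (u : Sch n) : Dj j (Ej A u) = Ej A (Dj j u) := by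
  ext1 x
  rw [Ej_apply, Dj_apply, Dj_apply]
  have h := ((LinearMap.toContinuousLinearMap A).restrictScalars ℝ).hasFDerivAt.comp x (u.hasFDerivAt x)
  have : fderiv ℝ (fun y => Ej A u y) x = _ := h.fderiv
  rw [this]; rfl

lemma Dj_Xj (j k : Fin n) (u : Sch n) :
    Dj j (Xj k u) = Xj k (Dj j u) + (if k = j then (1:ℂ) else 0) • u := by
  ext1 x
  rw [add_apply, smul_apply, Xj_apply, Dj_apply, Dj_apply]
  have h1 : HasFDerivAt (fun x : Rn n => ((x k : ℝ) : ℂ))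
      (Complex.ofRealCLM ∘L (EuclideanSpace.proj k : Rn n →L[ℝ] ℝ)) x :=
    (Complex.ofRealCLM ∘L (EuclideanSpace.proj k : Rn n →L[ℝ] ℝ)).hasFDerivAt
  have h := h1.fun_smul (u.hasFDerivAt x)
  have e : (fun y => Xj k u y) = fun y => ((y k : ℝ) : ℂ) • u y := funext fun y => Xj_apply k u y
  rw [e, h.fderiv]
  simp [PiLp.single_apply]

lemma FTc_Ej (A : Module.End ℂ (Lam n)) (u : Sch n) : FTc n (Ej A u) = Ej A (FTc n u) := by
  ext1 ξ
  rw [Ej_apply, FTc_apply, FTc_apply, A.map_smul, SchwartzMap.fourier_coe, SchwartzMap.fourier_coe,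
    Real.fourier_eq', Real.fourier_eq']
  congr 1
  have := (LinearMap.toContinuousLinearMap A).integral_comp_comm
    (φ := fun v => Complex.exp (↑(-2 * Real.pi * inner ℝ v ((2 * Real.pi)⁻¹ • ξ)) * I) • u v) (μ := volume) ?_
  · rw [LinearMap.coe_toContinuousLinearMap'] at this
    rw [← this]
    congr 1
    ext1 v
    rw [map_smul]; rfl
  · refine u.integrable.mono (Continuous.aestronglyMeasurable ?_) (Filter.Eventually.of_forall fun v => ?_)
    · have := u.continuous
      fun_prop
    · rw [norm_smul, Complex.norm_exp_ofReal_mul_I, one_mul]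

lemma FTc_Dj (j : Fin n) (u : Sch n) : FTc n (Dj j u) = I • Xj j (FTc n u) := by
  ext1 ξ
  rw [smul_apply, Xj_apply, FTc_apply, FTc_apply]
  have : (FourierTransform.fourier (Dj j u) : Sch n) = _ :=
    SchwartzMap.fourier_lineDerivOp_eq u (EuclideanSpace.single j (1:ℝ))
  rw [this, smul_apply, SchwartzMap.smulLeftCLM_apply_apply (tgi j), real_inner_smul_left,
    EuclideanSpace.inner_single_right]
  simp only [conj_trivial, one_mul, ← Complex.coe_smul (E := Lam n), smul_smul]
  congr 1
  have := Real.pi_ne_zero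
  push_cast
  field_simp

lemma FTc_Xj (j : Fin n) (u : Sch n) : FTc n (Xj j u) = I • Dj j (FTc n u) := by
  have h1 : Dj j (FTc n u) = (((2 * Real.pi) ^ (-(n:ℝ)/2) : ℝ) : ℂ) •
      LineDeriv.lineDerivOp (EuclideanSpace.single j (1:ℝ))
      ((SchwartzMap.compCLMOfContinuousLinearEquiv ℂ (dil n _ tpi'))
        (FourierTransform.fourier u : Sch n)) := by
    simp only [FTc, Dj]
    rw [smul_apply, map_smul]; rfl
  rw [h1, SchwartzMap.lineDerivOp_compCLMOfContinuousLinearEquiv]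
  have h2 : (dil n _ tpi') (EuclideanSpace.single j (1:ℝ)) =
    ((2 * Real.pi)⁻¹) • (EuclideanSpace.single j (1:ℝ)) := rfl
  rw [h2, LineDeriv.lineDerivOp_left_smul, SchwartzMap.lineDerivOp_fourier_eq]
  have h3 : (SchwartzMap.smulLeftCLM (Lam n) (fun x : Rn n => inner ℝ x (EuclideanSpace.single j (1:ℝ)))) u
      = Xj j u := by
    ext1 x
    rw [SchwartzMap.smulLeftCLM_apply_apply (tgi j), Xj_apply, EuclideanSpace.inner_single_right]
    simp [← Complex.coe_smul]
  rw [h3, FourierTransform.fourier_smul]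
  ext1 ξ
  rw [FTc_apply]
  have h4 : ∀ w : Sch n, (SchwartzMap.compCLMOfContinuousLinearEquiv ℂ (dil n _ tpi')) w ξ =
    w ((2 * Real.pi)⁻¹ • ξ) := fun w => rfl
  simp only [smul_apply, h4, ← Complex.coe_smul (E := Lam n), smul_smul]
  congr 1
  have := Real.pi_ne_zero
  push_cast
  field_simp
  simp

/-- the operator on Schwartz space -/
def DapS (a : ℝ) (p : ℕ) (ℓ : Fin n) (u : Sch n) : Sch n :=
  Xj ℓ (Xj ℓ (∑ j, Dj j (Dj j u))) + (a : ℂ) • Xj ℓ (Dj ℓ u)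
  + (2 : ℂ) • Xj ℓ (∑ j ∈ univ.erase ℓ, Ej (iotL (ee ℓ) * epsL (ee j) + epsL (ee ℓ) * iotL (ee j)) (Dj j u))
  - (((n : ℝ) - 2 * p : ℝ) : ℂ) • Ej (opN ℓ) u

lemma sch_sum_apply {ι : Type*} (S : Finset ι) (f : ι → Sch n) (x : Rn n) :
    (∑ i ∈ S, f i) x = ∑ i ∈ S, f i x := by
  classical
  induction S using Finset.induction_on with
  | empty => simp
  | insert a s ha ih => rw [Finset.sum_insert ha, Finset.sum_insert ha, add_apply, ih]

lemma Dap_eq (a : ℝ) (p : ℕ) (ℓ : Fin n) (u : Sch n) (x : Rn n) :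
    Dap a p ℓ (fun y => u y) x = DapS a p ℓ u x := by
  simp only [Dap, DapS, pd_eq]
  simp only [sub_apply, add_apply, smul_apply, Xj_apply, sch_sum_apply, Ej_apply, opN]
  simp only [← epsL_apply, ← iotL_apply, map_sum, map_neg, LinearMap.add_apply, Module.End.mul_apply,
    Finset.sum_add_distrib, sub_neg_eq_add, ← Complex.coe_smul (E := Lam n), smul_smul]
  push_cast
  rw [pow_two]

lemma FTc_DapS (a : ℝ) (p : ℕ) (ℓ : Fin n) (u : Sch n) (ξ : Rn n) :
    FTc n (DapS a p ℓ u) ξ =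
      Lsh ((n:ℝ)/2 - p) ((2-a)/2) ℓ (Function.update ξ.ofLp ℓ 0) (ξ ℓ) (FTc n u ξ) (Dj ℓ (FTc n u) ξ)
        (Dj ℓ (Dj ℓ (FTc n u)) ξ) + (((2 * ((2-a)/2) : ℝ)) : ℂ) • FTc n u ξ := by
  have hI : ∀ w : Sch n, I • I • w = -w := fun w => by rw [smul_smul, I_mul_I, neg_one_smul]
  simp only [DapS, map_sub, map_add, map_smul, FTc_Xj, FTc_Dj, FTc_Ej, map_sum]
  set ψ := FTc n u
  rw [← Finset.add_sum_erase _ _ (Finset.mem_univ ℓ)]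
  have hs : ∀ j ∈ univ.erase ℓ, I • I • I • I • Dj ℓ (Dj ℓ (Xj j (Xj j ψ))) =
      Xj j (Xj j (Dj ℓ (Dj ℓ ψ))) := by
    intro j hj
    have hj : j ≠ ℓ := Finset.ne_of_mem_erase hj
    simp only [map_smul, map_neg, Dj_Xj, if_neg hj, zero_smul, add_zero, hI, smul_neg, neg_neg]
  have hs2 : ∀ j ∈ univ.erase ℓ, I • I • Dj ℓ (Ej (iotL (ee ℓ) * epsL (ee j) + epsL (ee ℓ) * iotL (ee j))
      (Xj j ψ)) = -(Ej (iotL (ee ℓ) * epsL (ee j) + epsL (ee ℓ) * iotL (ee j)) (Xj j (Dj ℓ ψ))) := by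
    intro j hj
    have hj : j ≠ ℓ := Finset.ne_of_mem_erase hj
    simp only [map_smul, Dj_Ej, Dj_Xj, if_neg hj, zero_smul, add_zero, hI]
  rw [Finset.sum_congr rfl hs]
  simp only [Finset.smul_sum]
  rw [Finset.sum_congr rfl (fun j hj => congrArg ((2:ℂ) • ·) (hs2 j hj))]
  simp only [map_smul, map_add, Dj_Xj, if_true, one_smul, hI, smul_neg, neg_neg, smul_add]
  simp only [sub_apply, add_apply, neg_apply, smul_apply, Xj_apply, sch_sum_apply, Ej_apply]
  have hB : opB ℓ (Function.update ξ.ofLp ℓ 0) (Dj ℓ ψ ξ) = ∑ j ∈ univ.erase ℓ,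
      (iotL (ee ℓ) * epsL (ee j) + epsL (ee ℓ) * iotL (ee j)) (((ξ j : ℝ) : ℂ) • Dj ℓ ψ ξ) := by
    unfold opB
    rw [epsL_eq_sum (rc _), iotL_eq_sum (rc _)]
    simp only [LinearMap.add_apply, Module.End.mul_apply, LinearMap.sum_apply, LinearMap.smul_apply,
      map_sum, map_smul]
    rw [← Finset.sum_add_distrib, ← Finset.add_sum_erase _ _ (Finset.mem_univ ℓ)]
    simp only [rc, Function.update_self, Complex.ofReal_zero, zero_smul, add_zero, zero_add]
    refine Finset.sum_congr rfl fun j hj => ?_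
    rw [Function.update_of_ne (Finset.ne_of_mem_erase hj), smul_add]
  have hq : qq (Function.update ξ.ofLp ℓ 0) = ∑ j ∈ univ.erase ℓ, (ξ j)^2 := by
    unfold qq
    rw [← Finset.add_sum_erase _ _ (Finset.mem_univ ℓ)]
    simp only [Function.update_self, ne_eq, OfNat.ofNat_ne_zero, not_false_eq_true, zero_pow, zero_add]
    refine Finset.sum_congr rfl fun j hj => ?_
    rw [Function.update_of_ne (Finset.ne_of_mem_erase hj)]
  have hS : ∑ j ∈ univ.erase ℓ, ((ξ j : ℝ) : ℂ) • ((ξ j : ℝ) : ℂ) • Dj ℓ (Dj ℓ ψ) ξ =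
      ((qq (Function.update ξ.ofLp ℓ 0) : ℝ) : ℂ) • Dj ℓ (Dj ℓ ψ) ξ := by
    rw [hq, Complex.ofReal_sum, Finset.sum_smul]
    refine Finset.sum_congr rfl fun j hj => ?_
    rw [smul_smul]; push_cast; rw [pow_two]
  rw [hS]
  simp only [Lsh, hB, Finset.sum_neg_distrib, ← Finset.smul_sum]
  generalize (∑ j ∈ univ.erase ℓ,
      (iotL (ee ℓ) * epsL (ee j) + epsL (ee ℓ) * iotL (ee j)) (((ξ j : ℝ) : ℂ) • Dj ℓ ψ ξ)) = b
  push_cast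
  module

lemma ft_Dap (a : ℝ) (p : ℕ) (ℓ : Fin n) (u : Sch n) (ξ : Rn n) :
    ft (fun x => Dap a p ℓ (fun y => u y) x) ξ =
      Lsh ((n:ℝ)/2 - p) ((2-a)/2) ℓ (Function.update ξ.ofLp ℓ 0) (ξ ℓ) (FTc n u ξ) (Dj ℓ (FTc n u) ξ)
        (Dj ℓ (Dj ℓ (FTc n u)) ξ) + (((2 * ((2-a)/2) : ℝ)) : ℂ) • FTc n u ξ := by
  rw [← FTc_DapS, ← ft_eq]
  congr 1
  ext1 x
  exact Dap_eq a p ℓ u x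

lemma ft_Dap_add (a : ℝ) (p : ℕ) (ℓ : Fin n) (u : Sch n) (c : ℂ) (ξ : Rn n) :
    ft (fun x => Dap a p ℓ (fun y => u y) x + c • u x) ξ =
      Lsh ((n:ℝ)/2 - p) ((2-a)/2) ℓ (Function.update ξ.ofLp ℓ 0) (ξ ℓ) (FTc n u ξ) (Dj ℓ (FTc n u) ξ)
        (Dj ℓ (Dj ℓ (FTc n u)) ξ) + (((2 * ((2-a)/2) : ℝ)) : ℂ) • FTc n u ξ + c • FTc n u ξ := by
  rw [← FTc_DapS, ← smul_apply, ← map_smul, ← add_apply, ← map_add, ← ft_eq]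
  congr 1
  ext1 x
  rw [Dap_eq]; rfl

/-- projection onto p-forms -/
def prP (n p : ℕ) : Module.End ℂ (Lam n) where
  toFun v := WithLp.toLp 2 fun S => if S.card = p then v S else 0
  map_add' u v := by ext S; simp; split_ifs <;> simp
  map_smul' c v := by ext S; simp

lemma prP_apply (p : ℕ) (v : Lam n) (S : Finset (Fin n)) :
    prP n p v S = if S.card = p then v S else 0 := rfl

lemma isForm_iff (p : ℕ) (v : Lam n) : IsForm p v ↔ prP n p v = v := by
  constructor
  · intro h
    ext S
    rw [prP_apply]
    split_ifs with hS
    · rfl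
    · exact (h S hS).symm
  · intro h S hS
    rw [← h, prP_apply, if_neg hS]

lemma isForm_prP (p : ℕ) (v : Lam n) : IsForm p (prP n p v) := fun S hS => by
  rw [prP_apply, if_neg hS]

lemma norm_prP_le (p : ℕ) (v : Lam n) : ‖prP n p v‖ ≤ ‖v‖ := by
  rw [EuclideanSpace.norm_eq, EuclideanSpace.norm_eq]
  apply Real.sqrt_le_sqrt
  refine Finset.sum_le_sum fun S _ => ?_
  rw [prP_apply]
  split_ifs
  · rfl
  · simp

/-- every Schwartz p-form is the Fourier transform of a Schwartz p-form -/
lemma exists_ft (p : ℕ) (ψ : Sch n) (h : ∀ x, IsForm p (ψ x)) :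
    ∃ u : Sch n, (∀ x, IsForm p (u x)) ∧ FTc n u = ψ := by
  refine ⟨Ej (prP n p) (IFTc n ψ), fun x => isForm_prP p _, ?_⟩
  rw [FTc_Ej, FTc_IFTc]
  ext1 x
  exact (isForm_iff p _).1 (h x)

lemma isForm_FTc (p : ℕ) (u : Sch n) (h : ∀ x, IsForm p (u x)) (ξ : Rn n) : IsForm p (FTc n u ξ) := by
  have : Ej (prP n p) u = u := by
    ext1 x
    exact (isForm_iff p _).1 (h x)
  rw [← this, FTc_Ej]
  exact isForm_prP p _


/-! ### Fibration -/

variable {m : ℕ}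

/-- measurable equivalence -/
def PE (ℓ : Fin (m+1)) : ((Fin m → ℝ) × ℝ) ≃ᵐ Rn (m+1) :=
  MeasurableEquiv.prodComm.trans ((MeasurableEquiv.piFinSuccAbove (fun _ => ℝ) ℓ).symm.trans
    (MeasurableEquiv.toLp 2 (Fin (m+1) → ℝ)))

/-- the point with parameters -/
def pt (ℓ : Fin (m+1)) (y : Fin m → ℝ) (t : ℝ) : Rn (m+1) := WithLp.toLp 2 (ℓ.insertNth t y)

/-- base point of a fibre -/
def xx (ℓ : Fin (m+1)) (y : Fin m → ℝ) : Fin (m+1) → ℝ := ℓ.insertNth (0:ℝ) y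

lemma PE_apply (ℓ : Fin (m+1)) (z : (Fin m → ℝ) × ℝ) : PE ℓ z = pt ℓ z.1 z.2 := rfl

lemma PE_mp (ℓ : Fin (m+1)) : MeasurePreserving (PE ℓ) (volume.prod volume) volume := by
  have h1 : MeasurePreserving (MeasurableEquiv.prodComm : ((Fin m → ℝ) × ℝ) ≃ᵐ ℝ × (Fin m → ℝ))
    (volume.prod volume) (volume.prod volume) := Measure.measurePreserving_swap
  have h2 := (volume_preserving_piFinSuccAbove (fun _ : Fin (m+1) => ℝ) ℓ).symm
  have h3 := PiLp.volume_preserving_toLp (Fin (m+1))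
  exact (h3.comp h2).comp h1

lemma fub_ae (ℓ : Fin (m+1)) {P : Rn (m+1) → Prop} (h : ∀ᵐ ξ, P ξ) :
    ∀ᵐ y, ∀ᵐ t, P (pt ℓ y t) :=
  Measure.ae_ae_of_ae_prod ((PE_mp ℓ).quasiMeasurePreserving.ae h)

lemma fub_zero (ℓ : Fin (m+1)) {F : Rn (m+1) → Lam (m+1)} (hF : AEStronglyMeasurable F volume)
    (h : ∀ᵐ y, ∀ᵐ t, F (pt ℓ y t) = 0) : ∀ᵐ ξ, F ξ = 0 := by
  obtain ⟨G, hG, hGF⟩ := hF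
  have h1 := fub_ae ℓ hGF
  have h2 : ∀ᵐ y, ∀ᵐ t, G (pt ℓ y t) = 0 := by
    filter_upwards [h, h1] with y a b
    filter_upwards [a, b] with t c d
    rw [← d, c]
  have hms : MeasurableSet {ξ | G ξ = 0} := hG.measurableSet_eq_fun stronglyMeasurable_const
  have h3 : ∀ᵐ z ∂((volume : Measure (Fin m → ℝ)).prod (volume : Measure ℝ)), G (PE ℓ z) = 0 := by
    rw [Measure.ae_prod_iff_ae_ae]
    · exact h2
    · exact (PE ℓ).measurable hms
  have h4 : ∀ᵐ ξ, G ξ = 0 := by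
    rw [← (PE_mp ℓ).map_eq, (PE ℓ).measurableEmbedding.ae_map_iff]
    exact h3
  filter_upwards [hGF, h4] with ξ a b
  rw [a, b]

lemma fub_int {E : Type*} [NormedAddCommGroup E] [NormedSpace ℝ E] (ℓ : Fin (m+1))
    {F : Rn (m+1) → E} (h : Integrable F) :
    (∀ᵐ y, Integrable fun t => F (pt ℓ y t)) ∧ (Integrable fun y => ∫ t, F (pt ℓ y t)) ∧
      ∫ ξ, F ξ = ∫ y, ∫ t, F (pt ℓ y t) := by
  have h1 : Integrable (fun z => F (PE ℓ z)) ((volume : Measure (Fin m → ℝ)).prod (volume : Measure ℝ)) :=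
    (PE_mp ℓ).integrable_comp_of_integrable h
  refine ⟨h1.prod_right_ae, h1.integral_prod_left, ?_⟩
  rw [← (PE_mp ℓ).integral_comp (PE ℓ).measurableEmbedding, integral_prod _ h1]
  rfl

lemma xx_self (ℓ : Fin (m+1)) (y : Fin m → ℝ) : xx ℓ y ℓ = 0 := by simp [xx]

lemma pt_self (ℓ : Fin (m+1)) (y : Fin m → ℝ) (t : ℝ) : (pt ℓ y t) ℓ = t := by simp [pt]

lemma upd_pt (ℓ : Fin (m+1)) (y : Fin m → ℝ) (t : ℝ) :
    Function.update (pt ℓ y t).ofLp ℓ 0 = xx ℓ y := by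
  simp [pt, xx, Fin.update_insertNth]

lemma pt_split (ℓ : Fin (m+1)) (y : Fin m → ℝ) (t : ℝ) (i : Fin (m+1)) :
    (pt ℓ y t) i = xx ℓ y i + t * (if i = ℓ then 1 else 0) := by
  rw [← upd_pt ℓ y t]
  by_cases h : i = ℓ
  · subst h; simp [pt_self]
  · simp [h]

lemma qq_xx (ℓ : Fin (m+1)) (y : Fin m → ℝ) : qq (xx ℓ y) = ∑ i, y i ^ 2 := by
  simp [qq, xx, Fin.sum_univ_succAbove _ ℓ]

lemma qq_norm (ξ : Rn n) : qq ξ.ofLp = ‖ξ‖^2 := by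
  rw [EuclideanSpace.real_norm_sq_eq]; rfl

lemma qq_pt (ℓ : Fin (m+1)) (y : Fin m → ℝ) (t : ℝ) : qq (pt ℓ y t).ofLp = qq (xx ℓ y) + t^2 :=
  qq_split ℓ _ _ (xx_self ℓ y) t (pt_split ℓ y t)

lemma norm_pt (ℓ : Fin (m+1)) (y : Fin m → ℝ) (t : ℝ) : ‖pt ℓ y t‖^2 = qq (xx ℓ y) + t^2 := by
  rw [← qq_norm, qq_pt]

lemma qq_pos_ae (hm : 1 ≤ m) (ℓ : Fin (m+1)) : ∀ᵐ y : Fin m → ℝ, 0 < qq (xx ℓ y) := by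
  haveI : Nonempty (Fin m) := ⟨⟨0, hm⟩⟩
  have : ∀ᵐ y : Fin m → ℝ, y ≠ 0 := by
    rw [ae_iff]; simp
  filter_upwards [this] with y hy
  rw [qq_xx]
  obtain ⟨i, hi⟩ := Function.ne_iff.1 hy
  exact Finset.sum_pos' (fun j _ => sq_nonneg _) ⟨i, Finset.mem_univ _, by simpa using sq_pos_of_ne_zero hi⟩

lemma pt_line (ℓ : Fin (m+1)) (y : Fin m → ℝ) (t : ℝ) :
    pt ℓ y t = pt ℓ y 0 + t • EuclideanSpace.single ℓ (1:ℝ) := by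
  ext i
  rw [pt_split]
  simp [pt_split]

lemma continuous_pt (ℓ : Fin (m+1)) (y : Fin m → ℝ) : Continuous (pt ℓ y) := by
  rw [show pt ℓ y = _ from funext (pt_line ℓ y)]
  fun_prop

lemma sch_hasDerivAt (ℓ : Fin (m+1)) (y : Fin m → ℝ) (ψ : Sch (m+1)) (t : ℝ) :
    HasDerivAt (fun t => ψ (pt ℓ y t)) (Dj ℓ ψ (pt ℓ y t)) t := by
  have h1 : HasDerivAt (pt ℓ y) (EuclideanSpace.single ℓ (1:ℝ)) t := by
    rw [show pt ℓ y = _ from funext (pt_line ℓ y)]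
    simpa using ((hasDerivAt_id t).smul_const (EuclideanSpace.single ℓ (1:ℝ))).const_add (pt ℓ y 0)
  exact (ψ.hasFDerivAt (pt ℓ y t)).comp_hasDerivAt t h1

/-- weight -/
lemma weight_eq (c σ : ℝ) (ℓ : Fin n) (ξ : Rn n) (x : Fin n → ℝ) (hx : x ℓ = 0) (t : ℝ)
    (h : ∀ i, ξ i = x i + t * (if i = ℓ then 1 else 0)) (hξ : ξ ≠ 0) (v : Lam n) :
    ((‖ξ‖ ^ (-(2 * (-σ))) : ℝ) : ℂ) • opC c (-σ) (‖ξ‖⁻¹ • ξ).ofLp v =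
      (((qq x + t^2) ^ (σ - 1) : ℝ) : ℂ) • opM c σ ℓ x t v := by
  have hpos : 0 < ‖ξ‖ := norm_pos_iff.2 hξ
  rw [opM_eq c σ ℓ x ξ.ofLp hx t h, ← qq_split ℓ x ξ.ofLp hx t h, qq_norm]
  have h1 : ((‖ξ‖^2) ^ (σ - 1) : ℝ) = ‖ξ‖ ^ (-(2 * (-σ))) * (‖ξ‖⁻¹)^2 := by
    rw [← Real.rpow_natCast (‖ξ‖⁻¹), Real.inv_rpow hpos.le, ← Real.rpow_neg hpos.le,
      ← Real.rpow_add hpos, ← Real.rpow_natCast, ← Real.rpow_mul hpos.le]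
    congr 1
    push_cast; ring
  rw [h1]
  have hrc : rc (‖ξ‖⁻¹ • ξ).ofLp = ((‖ξ‖⁻¹ : ℝ) : ℂ) • rc ξ.ofLp := by
    ext i; simp [rc]
  have he : ∀ (r : ℂ) (z : Fin n → ℂ), epsL (r • z) = r • epsL z := fun r z => by
    rw [epsL_eq_sum, epsL_eq_sum z, Finset.smul_sum]
    simp [smul_smul]
  have hi : ∀ (r : ℂ) (z : Fin n → ℂ), iotL (r • z) = r • iotL z := fun r z => by
    rw [iotL_eq_sum, iotL_eq_sum z, Finset.smul_sum]
    simp [smul_smul]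
  have hie : iotL (rc ξ.ofLp) (epsL (rc ξ.ofLp) v) = ((‖ξ‖^2 : ℝ) : ℂ) • v
      - epsL (rc ξ.ofLp) (iotL (rc ξ.ofLp) v) := by
    have := LinearMap.congr_fun (iot_eps (rc ξ.ofLp) (rc ξ.ofLp)) v
    rw [Module.End.mul_apply] at this
    rw [this, ← qq_norm]
    simp [qq, rc, pow_two]
  simp only [opC, ← epsL_apply, ← iotL_apply, hrc, he, hi, LinearMap.smul_apply, map_smul, hie,
    LinearMap.sub_apply, Module.End.mul_apply, Module.End.one_apply]
  push_cast
  module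


/-! ### The conformal form: measurability, bounds, symmetry -/

lemma continuous_opC (c lam : ℝ) :
    Continuous fun z : (Fin n → ℝ) × Lam n => opC c lam z.1 z.2 := by
  have hr : ∀ j, Continuous fun z : (Fin n → ℝ) × Lam n => rc z.1 j := fun j => by
    unfold rc
    fun_prop
  have he : Continuous fun z : (Fin n → ℝ) × Lam n => epsL (rc z.1) z.2 := by
    simp only [epsL_eq_sum (rc _), LinearMap.sum_apply, LinearMap.smul_apply]
    refine continuous_finsetSum _ fun j _ => ?_
    have h2 : Continuous fun z : (Fin n → ℝ) × Lam n => epsL (ee j) z.2 :=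
      (continuous_end (epsL (ee j))).comp continuous_snd
    exact (hr j).smul h2
  have hi : Continuous fun z : (Fin n → ℝ) × Lam n => iotL (rc z.1) z.2 := by
    simp only [iotL_eq_sum (rc _), LinearMap.sum_apply, LinearMap.smul_apply]
    refine continuous_finsetSum _ fun j _ => ?_
    have h2 : Continuous fun z : (Fin n → ℝ) × Lam n => iotL (ee j) z.2 :=
      (continuous_end (iotL (ee j))).comp continuous_snd
    exact (hr j).smul h2
  have h1 : Continuous fun z : (Fin n → ℝ) × Lam n => iotL (rc z.1) (epsL (rc z.1) z.2) :=
    hi.comp (continuous_fst.prodMk he)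
  have h2 : Continuous fun z : (Fin n → ℝ) × Lam n => epsL (rc z.1) (iotL (rc z.1) z.2) :=
    he.comp (continuous_fst.prodMk hi)
  unfold opC
  simp only [← epsL_apply, ← iotL_apply]
  exact (h1.const_smul ((c - lam : ℝ) : ℂ)).add (h2.const_smul ((c + lam : ℝ) : ℂ))

lemma meas_opC (c lam : ℝ) {g : Rn n → Lam n} (hg : AEStronglyMeasurable g volume) :
    AEStronglyMeasurable (fun ξ => opC c lam (‖ξ‖⁻¹ • ξ).ofLp (g ξ)) volume := by
  have h1 : Measurable fun ξ : Rn n => (‖ξ‖⁻¹ • ξ).ofLp := by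
    refine measurable_pi_lambda _ fun i => ?_
    simp only [PiLp.smul_apply, smul_eq_mul]
    fun_prop
  have h2 : AEStronglyMeasurable (fun ξ : Rn n => ((‖ξ‖⁻¹ • ξ).ofLp, g ξ)) volume :=
    h1.aestronglyMeasurable.prodMk hg
  have h3 := continuous_opC (n := n) c lam
  generalize hF : (fun z : (Fin n → ℝ) × Lam n => opC c lam z.1 z.2) = F at h3
  have h4 := h3.comp_aestronglyMeasurable h2
  have h5 : (fun ξ => opC c lam (‖ξ‖⁻¹ • ξ).ofLp (g ξ)) = fun ξ : Rn n => F ((‖ξ‖⁻¹ • ξ).ofLp, g ξ) := by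
    rw [← hF]
  rw [h5]
  exact h4

lemma qq_unit (ξ : Rn n) : qq (‖ξ‖⁻¹ • ξ).ofLp ≤ 1 := by
  rw [qq_norm, norm_smul, norm_inv, norm_norm]
  by_cases h : ‖ξ‖ = 0
  · simp [h]
  · rw [inv_mul_cancel₀ h]; simp

lemma norm_opC_le (c lam : ℝ) (ξ : Rn n) (v : Lam n) :
    ‖opC c lam (‖ξ‖⁻¹ • ξ).ofLp v‖ ≤ (|c - lam| + |c + lam|) * ‖v‖ := by
  have h1 := qq_unit ξ
  set x := (‖ξ‖⁻¹ • ξ).ofLp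
  have hs : √(qq x) ≤ 1 := (Real.sqrt_le_sqrt h1).trans (by simp)
  have he : ∀ v, ‖epsL (rc x) v‖ ≤ ‖v‖ := fun v => (norm_eps_le x v).trans
    (by nlinarith [norm_nonneg v])
  have hi : ∀ v, ‖iotL (rc x) v‖ ≤ ‖v‖ := fun v => (norm_iot_le x v).trans
    (by nlinarith [norm_nonneg v])
  unfold opC
  refine (norm_add_le _ _).trans ?_
  rw [norm_smul, norm_smul, Complex.norm_real, Complex.norm_real, Real.norm_eq_abs, Real.norm_eq_abs, add_mul]
  have := (hi (epsL (rc x) v)).trans (he v)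
  have := (he (iotL (rc x) v)).trans (hi v)
  simp only [← epsL_apply, ← iotL_apply]
  gcongr

/-- integrand of the conformal form -/
def wf (c s : ℝ) (f g : Rn n → Lam n) (ξ : Rn n) : ℂ :=
  (‖ξ‖ ^ (-(2*(-s))) : ℝ) • (inner ℂ (f ξ) (opC c (-s) (‖ξ‖⁻¹ • ξ).ofLp (g ξ)) : ℂ)

lemma meas_pow (r : ℝ) : Measurable fun ξ : Rn n => ‖ξ‖ ^ r := by fun_prop

lemma wf_integrable (c s : ℝ) {f g : Rn n → Lam n} (hf : AEStronglyMeasurable f volume)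
    (hg : AEStronglyMeasurable g volume) (hf2 : Integrable fun ξ => ‖ξ‖ ^ (2*s) * ‖f ξ‖^2)
    (hg2 : Integrable fun ξ => ‖ξ‖ ^ (2*s) * ‖g ξ‖^2) : Integrable (wf c s f g) := by
  refine ((hf2.add hg2).const_mul (|c - (-s)| + |c + (-s)|)).mono' ?_ (Filter.Eventually.of_forall fun ξ => ?_)
  · unfold wf
    exact (meas_pow _).aestronglyMeasurable.smul (hf.inner (meas_opC c (-s) hg))
  · unfold wf
    rw [norm_smul, Real.norm_of_nonneg (by positivity), show -(2 * (-s)) = 2 * s by ring]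
    have h1 := norm_inner_le_norm (𝕜 := ℂ) (f ξ) (opC c (-s) (‖ξ‖⁻¹ • ξ).ofLp (g ξ))
    have h2 := norm_opC_le c (-s) ξ (g ξ)
    set K := |c - (-s)| + |c + (-s)|
    have hK : 0 ≤ K := by positivity
    have hw : 0 ≤ ‖ξ‖ ^ (2*s) := by positivity
    simp only [Pi.add_apply]
    have h3 : ‖f ξ‖ * ‖g ξ‖ ≤ ‖f ξ‖^2 + ‖g ξ‖^2 := by nlinarith [sq_nonneg (‖f ξ‖ - ‖g ξ‖), sq_nonneg ‖f ξ‖, sq_nonneg ‖g ξ‖]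
    calc _ ≤ ‖ξ‖ ^ (2*s) * (‖f ξ‖ * (K * ‖g ξ‖)) := by
          gcongr; exact h1.trans (by gcongr)
      _ = K * (‖ξ‖ ^ (2*s) * (‖f ξ‖ * ‖g ξ‖)) := by ring
      _ ≤ K * (‖ξ‖ ^ (2*s) * (‖f ξ‖^2 + ‖g ξ‖^2)) := by gcongr
      _ = _ := by ring

lemma sch_w (s : ℝ) (hs : 0 ≤ s) (f : Sch n) : Integrable fun ξ => ‖ξ‖ ^ (2*s) * ‖f ξ‖^2 := by
  obtain ⟨k, hk⟩ := exists_nat_ge (2*s)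
  obtain ⟨C, hC⟩ : ∃ C, ∀ ξ, ‖f ξ‖ ≤ C := ⟨_, fun ξ => by simpa using f.norm_le_seminorm ℝ ξ⟩
  have h0 := f.integrable_pow_mul volume 0
  have h1 := f.integrable_pow_mul volume k
  refine ((h0.add h1).mul_const C).mono' ?_ (Filter.Eventually.of_forall fun ξ => ?_)
  · exact ((meas_pow _).mul (f.continuous.norm.pow 2).measurable).aestronglyMeasurable
  · rw [Real.norm_of_nonneg (by positivity)]
    simp only [Pi.add_apply, pow_zero, one_mul]
    have hw : ‖ξ‖ ^ (2*s) ≤ 1 + ‖ξ‖^k := by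
      rcases le_total ‖ξ‖ 1 with h | h
      · have := Real.rpow_le_one (norm_nonneg ξ) h (by linarith : 0 ≤ 2*s)
        have : 0 ≤ ‖ξ‖^k := by positivity
        linarith
      · have := Real.rpow_le_rpow_of_exponent_le h hk
        rw [Real.rpow_natCast] at this
        linarith
    calc _ ≤ (1 + ‖ξ‖^k) * (‖f ξ‖ * C) := by
          rw [pow_two]; gcongr; exact hC ξ
      _ = _ := by ring

lemma pt_ne (ℓ : Fin (m+1)) (y : Fin m → ℝ) (hq : 0 < qq (xx ℓ y)) (t : ℝ) : pt ℓ y t ≠ 0 := by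
  intro h
  have := norm_pt ℓ y t
  rw [h] at this
  simp at this
  nlinarith [sq_nonneg t]

lemma wf_fib (c s : ℝ) (ℓ : Fin (m+1)) (y : Fin m → ℝ) (hq : 0 < qq (xx ℓ y)) (t : ℝ)
    (f g : Rn (m+1) → Lam (m+1)) :
    wf c s f g (pt ℓ y t) = (((qq (xx ℓ y) + t^2) ^ (s - 1) : ℝ) : ℂ) *
      inner ℂ (f (pt ℓ y t)) (opM c s ℓ (xx ℓ y) t (g (pt ℓ y t))) := by
  have := weight_eq c s ℓ (pt ℓ y t) (xx ℓ y) (xx_self ℓ y) t (pt_split ℓ y t) (pt_ne ℓ y hq t) (g (pt ℓ y t))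
  rw [← inner_smul_right, ← this, inner_smul_right]
  unfold wf
  rw [Complex.real_smul]

/-- covariant derivative on Schwartz space -/
def YS (ℓ : Fin n) (ψ : Sch n) : Sch n :=
  ∑ j, Xj j (Xj j (Dj ℓ ψ)) -
    ∑ j ∈ univ.erase ℓ, Ej (iotL (ee ℓ) * epsL (ee j) + epsL (ee ℓ) * iotL (ee j)) (Xj j ψ)

lemma opB_upd (ℓ : Fin n) (ξ : Fin n → ℝ) (v : Lam n) :
    opB ℓ (Function.update ξ ℓ 0) v = ∑ j ∈ univ.erase ℓ,
      (iotL (ee ℓ) * epsL (ee j) + epsL (ee ℓ) * iotL (ee j)) (((ξ j : ℝ) : ℂ) • v) := by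
  unfold opB
  rw [epsL_eq_sum (rc _), iotL_eq_sum (rc _)]
  simp only [LinearMap.add_apply, Module.End.mul_apply, LinearMap.sum_apply, LinearMap.smul_apply,
    map_sum, map_smul]
  rw [← Finset.sum_add_distrib, ← Finset.add_sum_erase _ _ (Finset.mem_univ ℓ)]
  simp only [rc, Function.update_self, Complex.ofReal_zero, zero_smul, add_zero, zero_add]
  refine Finset.sum_congr rfl fun j hj => ?_
  rw [Function.update_of_ne (Finset.ne_of_mem_erase hj), smul_add]

lemma YS_apply (ℓ : Fin (m+1)) (ψ : Sch (m+1)) (y : Fin m → ℝ) (t : ℝ) :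
    YS ℓ ψ (pt ℓ y t) = yy ℓ (xx ℓ y) t (ψ (pt ℓ y t)) (Dj ℓ ψ (pt ℓ y t)) := by
  unfold YS yy
  rw [← qq_pt, ← upd_pt ℓ y t, opB_upd]
  simp only [sub_apply, sch_sum_apply, Xj_apply, Ej_apply, smul_smul, ← Finset.sum_smul]
  congr 2
  simp [qq, pow_two]

/-- the operator on the Fourier side -/
lemma FTc_fib (a : ℝ) (p : ℕ) (ℓ : Fin (m+1)) (u : Sch (m+1)) (y : Fin m → ℝ) (t : ℝ) :
    FTc (m+1) (DapS a p ℓ u) (pt ℓ y t) =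
      Lsh (((m+1:ℕ):ℝ)/2 - p) ((2-a)/2) ℓ (xx ℓ y) t (FTc (m+1) u (pt ℓ y t)) (Dj ℓ (FTc (m+1) u) (pt ℓ y t))
        (Dj ℓ (Dj ℓ (FTc (m+1) u)) (pt ℓ y t)) + (((2 * ((2-a)/2) : ℝ)) : ℂ) • FTc (m+1) u (pt ℓ y t) := by
  rw [FTc_DapS, upd_pt, pt_self]

lemma symm_main (hm : 1 ≤ m) (a : ℝ) (ha2 : a ≤ 2) (p : ℕ) (ℓ : Fin (m+1)) (u v : Sch (m+1)) :
    ∫ ξ, wf (((m+1:ℕ):ℝ)/2 - p) ((2-a)/2) (FTc (m+1) (DapS a p ℓ u)) (FTc (m+1) v) ξ =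
    ∫ ξ, wf (((m+1:ℕ):ℝ)/2 - p) ((2-a)/2) (FTc (m+1) u) (FTc (m+1) (DapS a p ℓ v)) ξ := by
  have hs : 0 ≤ (2-a)/2 := by linarith
  have hint : ∀ f g : Sch (m+1), Integrable (wf (((m+1:ℕ):ℝ)/2 - p) ((2-a)/2) f g) := fun f g =>
    wf_integrable _ _ f.continuous.aestronglyMeasurable g.continuous.aestronglyMeasurable
      (sch_w _ hs f) (sch_w _ hs g)
  set φ := FTc (m+1) u with hφ
  set ψ := FTc (m+1) v with hψ
  obtain ⟨a1, -, c1⟩ := fub_int ℓ (hint (FTc (m+1) (DapS a p ℓ u)) ψ)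
  obtain ⟨a2, -, c2⟩ := fub_int ℓ (hint φ (FTc (m+1) (DapS a p ℓ v)))
  obtain ⟨a3, -, -⟩ := fub_int ℓ (hint φ (YS ℓ ψ))
  obtain ⟨a4, -, -⟩ := fub_int ℓ (hint ψ (YS ℓ φ))
  rw [c1, c2]
  apply integral_congr_ae
  filter_upwards [a1, a2, a3, a4, qq_pos_ae hm ℓ] with y b1 b2 b3 b4 hq
  simp only [wf_fib _ _ ℓ y hq, YS_apply, FTc_fib] at b1 b2 b3 b4 ⊢
  simp only [← hφ, ← hψ] at b1 b2 b3 b4 ⊢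
  set c := (((m+1:ℕ):ℝ)/2 - p) with hc
  set s := (2-a)/2
  have hx := xx_self ℓ y
  have k1 := fun t => current c s ℓ (xx ℓ y) hx hq (sch_hasDerivAt ℓ y φ t) (sch_hasDerivAt ℓ y ψ t)
    (sch_hasDerivAt ℓ y (Dj ℓ ψ) t)
  have k2 := fun t => current c s ℓ (xx ℓ y) hx hq (sch_hasDerivAt ℓ y ψ t) (sch_hasDerivAt ℓ y φ t)
    (sch_hasDerivAt ℓ y (Dj ℓ φ) t)
  have k3 := fun t => ((k2 t).star.sub (k1 t))
  rw [← sub_eq_zero, ← integral_sub b1 b2]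
  refine integral_eq_zero_of_hasDerivAt_of_integrable (f := fun t => star ((((qq (xx ℓ y) + t^2) ^ (s - 1) : ℝ) : ℂ) *
        inner ℂ (ψ (pt ℓ y t)) (opM c s ℓ (xx ℓ y) t (yy ℓ (xx ℓ y) t (φ (pt ℓ y t)) (Dj ℓ φ (pt ℓ y t)))))
      - (((qq (xx ℓ y) + t^2) ^ (s - 1) : ℝ) : ℂ) *
        inner ℂ (φ (pt ℓ y t)) (opM c s ℓ (xx ℓ y) t (yy ℓ (xx ℓ y) t (ψ (pt ℓ y t)) (Dj ℓ ψ (pt ℓ y t))))) ?_ (b1.sub b2) ?_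
  · intro t
    refine (k3 t).congr_deriv ?_
    have hst : ∀ u v : Lam (m+1), star (inner ℂ u v : ℂ) = inner ℂ v u := fun u v => inner_conj_symm v u
    simp only [star_add, star_mul', hst]
    simp only [Complex.star_def, Complex.conj_ofReal, inner_opM, inner_add_left, map_add, inner_add_right, inner_smul_left, map_smul,
      inner_smul_right]
    rw [← inner_opMQ c s ℓ (xx ℓ y) hx t (φ (pt ℓ y t)), ]
    ring
  · refine Integrable.sub ?_ b3
    exact (Complex.conjCLE : ℂ →L[ℝ] ℂ).integrable_comp b4


/-! ### A countable family of test functions -/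

lemma cont_pair {E : Type*} [NormedAddCommGroup E] [NormedSpace ℝ E] {h : ℝ → E}
    (hh : LocallyIntegrable h) (K : Set ℝ) (hK : IsCompact K) :
    Continuous fun b : C(ℝ, ℝ) => ∫ t in K, b t • h t := by
  rw [continuous_iff_continuousAt]
  intro b₀
  have hi : IntegrableOn h K := hh.integrableOn_isCompact hK
  obtain ⟨C, hC⟩ := hK.exists_bound_of_continuousOn b₀.continuous.continuousOn
  refine continuousAt_of_dominated (bound := fun t => (C + 1) * ‖h t‖) ?_ ?_ ?_ ?_
  · exact Filter.Eventually.of_forall fun b =>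
      b.continuous.aestronglyMeasurable.smul hi.aestronglyMeasurable
  · have h1 := ContinuousMap.tendsto_iff_forall_isCompact_tendstoUniformlyOn.1
      (Filter.tendsto_id (x := nhds b₀)) K hK
    have h2 := (Metric.tendstoUniformlyOn_iff.1 h1) 1 one_pos
    filter_upwards [h2] with b hb
    filter_upwards [ae_restrict_mem hK.measurableSet] with t ht
    rw [norm_smul]
    gcongr
    have h3 := hb t ht
    have h4 := hC t ht
    rw [dist_eq_norm, norm_sub_rev] at h3
    have h5 := norm_le_norm_add_norm_sub' (b t) (b₀ t)
    simp only [id] at h3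
    linarith
  · exact hi.norm.const_mul _
  · refine Filter.Eventually.of_forall fun t => ?_
    exact ((continuous_eval_const t).smul continuous_const).continuousAt

lemma contDiff_d {β : ℝ → ℝ} (h : ContDiff ℝ (⊤ : ℕ∞) β) : ContDiff ℝ (⊤ : ℕ∞) (deriv β) :=
  ((contDiff_infty_iff_deriv).1 h).2

/-- test functions supported in [-k,k] -/
def Tk (k : ℕ) : Set (ℝ → ℝ) :=
  {β | ContDiff ℝ (⊤ : ℕ∞) β ∧ tsupport β ⊆ Set.Icc (-(k:ℝ)) k}

lemma exists_Tk {β : ℝ → ℝ} (h : ContDiff ℝ (⊤ : ℕ∞) β) (hs : HasCompactSupport β) :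
    ∃ k, β ∈ Tk k := by
  obtain ⟨R, hR⟩ := hs.isCompact.isBounded.subset_closedBall 0
  obtain ⟨k, hk⟩ := exists_nat_ge R
  refine ⟨k, h, hR.trans ?_⟩
  rw [Real.closedBall_eq_Icc]
  apply Set.Icc_subset_Icc <;> linarith

lemma tsupp_d (β : ℝ → ℝ) : tsupport (deriv β) ⊆ tsupport β :=
  closure_minimal support_deriv_subset isClosed_closure

lemma Tk_zero {k : ℕ} {β : ℝ → ℝ} (hβ : tsupport β ⊆ Set.Icc (-(k:ℝ)) k) (t : ℝ)
    (ht : t ∉ Set.Icc (-(k:ℝ)) k) : β t = 0 ∧ deriv β t = 0 ∧ deriv (deriv β) t = 0 := by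
  refine ⟨image_eq_zero_of_notMem_tsupport fun h => ht (hβ h),
    image_eq_zero_of_notMem_tsupport fun h => ht (hβ (tsupp_d _ h)),
    image_eq_zero_of_notMem_tsupport fun h => ht (hβ (tsupp_d _ (tsupp_d _ h)))⟩

lemma countable_test_k (E : Type*) [NormedAddCommGroup E] [NormedSpace ℝ E] (k : ℕ) :
    ∃ D : Set (ℝ → ℝ), D.Countable ∧ D ⊆ Tk k ∧
      ∀ h2 h1 h0 : ℝ → E, LocallyIntegrable h2 → LocallyIntegrable h1 → LocallyIntegrable h0 →
        (∀ β ∈ D, ∫ t, (deriv (deriv β) t • h2 t + deriv β t • h1 t + β t • h0 t) = 0) →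
        ∀ β ∈ Tk k, ∫ t, (deriv (deriv β) t • h2 t + deriv β t • h1 t + β t • h0 t) = 0 := by
  classical
  let J : Tk k → C(ℝ, ℝ) × C(ℝ, ℝ) × C(ℝ, ℝ) := fun β =>
    (⟨deriv (deriv β.1), (contDiff_d (contDiff_d β.2.1)).continuous⟩,
      ⟨deriv β.1, (contDiff_d β.2.1).continuous⟩, ⟨β.1, β.2.1.continuous⟩)
  obtain ⟨T, hT1, hT2, hT3⟩ := (TopologicalSpace.IsSeparable.of_separableSpace
    (Set.range J)).exists_countable_dense_subset
  have : Nonempty (Tk k) := ⟨⟨fun _ => 0, contDiff_const, by simp [tsupport]⟩⟩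
  choose! r hr using fun z (hz : z ∈ T) => hT1 hz
  refine ⟨(fun z => (r z).1) '' T, hT2.image _, ?_, ?_⟩
  · rintro _ ⟨z, hz, rfl⟩; exact (r z).2
  intro h2 h1 h0 i2 i1 i0 H β hβ
  set K := Set.Icc (-(k:ℝ)) k
  have hK : IsCompact K := isCompact_Icc
  let Λ : C(ℝ, ℝ) × C(ℝ, ℝ) × C(ℝ, ℝ) → E := fun b =>
    (∫ t in K, b.1 t • h2 t) + (∫ t in K, b.2.1 t • h1 t) + ∫ t in K, b.2.2 t • h0 t
  have hΛ : Continuous Λ :=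
    (((cont_pair i2 K hK).comp continuous_fst).add ((cont_pair i1 K hK).comp
      (continuous_fst.comp continuous_snd))).add ((cont_pair i0 K hK).comp
      (continuous_snd.comp continuous_snd))
  have key : ∀ β : Tk k, Λ (J β) =
      ∫ t, (deriv (deriv β.1) t • h2 t + deriv β.1 t • h1 t + β.1 t • h0 t) := by
    intro β
    have e : ∀ {b : ℝ → ℝ} {h : ℝ → E}, Continuous b → LocallyIntegrable h →
        IntegrableOn (fun t => b t • h t) K := fun hb hh =>
      (hh.integrableOn_isCompact hK).continuousOn_smul hb.continuousOn hK
    rw [← setIntegral_eq_integral_of_forall_compl_eq_zero (s := K)]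
    · have e2 := e (contDiff_d (contDiff_d β.2.1)).continuous i2
      have e1 := e (contDiff_d β.2.1).continuous i1
      have e0 := e β.2.1.continuous i0
      have e21 : IntegrableOn (fun t => deriv (deriv β.1) t • h2 t + deriv β.1 t • h1 t) K := e2.add e1
      rw [integral_add e21 e0, integral_add e2 e1]
      rfl
    · intro t ht
      obtain ⟨z0, z1, z2⟩ := Tk_zero β.2.2 t ht
      simp [z0, z1, z2]
  have hcl : Set.range J ⊆ {b | Λ b = 0} := by
    refine hT3.trans (closure_minimal ?_ (isClosed_eq hΛ continuous_const))
    intro z hz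
    show Λ z = 0
    rw [← hr z hz, key]
    exact H _ ⟨z, hz, rfl⟩
  rw [← key ⟨β, hβ⟩]
  exact hcl ⟨_, rfl⟩

lemma countable_test (E : Type*) [NormedAddCommGroup E] [NormedSpace ℝ E] :
    ∃ D : Set (ℝ → ℝ), D.Countable ∧ (∀ β ∈ D, ContDiff ℝ (⊤ : ℕ∞) β ∧ HasCompactSupport β) ∧
      ∀ h2 h1 h0 : ℝ → E, LocallyIntegrable h2 → LocallyIntegrable h1 → LocallyIntegrable h0 →
        (∀ β ∈ D, ∫ t, (deriv (deriv β) t • h2 t + deriv β t • h1 t + β t • h0 t) = 0) →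
        ∀ β : ℝ → ℝ, ContDiff ℝ (⊤ : ℕ∞) β → HasCompactSupport β →
          ∫ t, (deriv (deriv β) t • h2 t + deriv β t • h1 t + β t • h0 t) = 0 := by
  choose D hD1 hD2 hD3 using countable_test_k E
  refine ⟨⋃ k, D k, Set.countable_iUnion hD1, ?_, ?_⟩
  · intro β hβ
    obtain ⟨k, hk⟩ := Set.mem_iUnion.1 hβ
    have := hD2 k hk
    exact ⟨this.1, HasCompactSupport.of_support_subset_isCompact isCompact_Icc
      ((subset_tsupport β).trans this.2)⟩
  · intro h2 h1 h0 i2 i1 i0 H β hβ hs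
    obtain ⟨k, hk⟩ := exists_Tk hβ hs
    exact hD3 k h2 h1 h0 i2 i1 i0 (fun b hb => H b (Set.mem_iUnion.2 ⟨k, hb⟩)) β hk

/-! ### Product test functions -/

lemma continuous_pt2 (ℓ : Fin (m+1)) : Continuous fun z : (Fin m → ℝ) × ℝ => pt ℓ z.1 z.2 := by
  unfold pt
  exact (PiLp.continuous_toLp 2 _).comp (Continuous.finInsertNth ℓ continuous_snd continuous_fst)

lemma exists_prod_test (ℓ : Fin (m+1)) {α : (Fin m → ℝ) → ℝ} {β : ℝ → ℝ}
    (hα : ContDiff ℝ (⊤ : ℕ∞) α) (hαs : HasCompactSupport α)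
    (hβ : ContDiff ℝ (⊤ : ℕ∞) β) (hβs : HasCompactSupport β) (v : Lam (m+1)) :
    ∃ ψ : Sch (m+1), (∀ ξ, ∃ r : ℂ, ψ ξ = r • v) ∧
      (∀ y t, ψ (pt ℓ y t) = (((α y * β t : ℝ)) : ℂ) • v) ∧
      (∀ y t, Dj ℓ ψ (pt ℓ y t) = (((α y * deriv β t : ℝ)) : ℂ) • v) ∧
      (∀ y t, Dj ℓ (Dj ℓ ψ) (pt ℓ y t) = (((α y * deriv (deriv β) t : ℝ)) : ℂ) • v) := by
  let F : Rn (m+1) → Lam (m+1) := fun ξ =>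
    (α (fun i => ξ (ℓ.succAbove i)) * β (ξ ℓ)) • v
  have hF : ContDiff ℝ (⊤ : ℕ∞) F := by
    have h1 : ContDiff ℝ (⊤ : ℕ∞) fun ξ : Rn (m+1) => fun i : Fin m => ξ (ℓ.succAbove i) := by
      fun_prop
    have h2 : ContDiff ℝ (⊤ : ℕ∞) fun ξ : Rn (m+1) => ξ ℓ := by fun_prop
    exact ((hα.comp h1).mul (hβ.comp h2)).smul contDiff_const
  have hFs : HasCompactSupport F := by
    refine HasCompactSupport.intro ((hαs.isCompact.prod hβs.isCompact).image (continuous_pt2 ℓ)) ?_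
    intro ξ hξ
    by_contra hne
    apply hξ
    have h1 : α (fun i => ξ (ℓ.succAbove i)) ≠ 0 := fun h => hne (by simp [F, h])
    have h2 : β (ξ ℓ) ≠ 0 := fun h => hne (by simp [F, h])
    refine ⟨(fun i => ξ (ℓ.succAbove i), ξ ℓ), ⟨subset_tsupport _ h1, subset_tsupport _ h2⟩, ?_⟩
    ext i
    simp only [pt]
    refine Fin.succAboveCases ℓ ?_ ?_ i
    · simp
    · intro j; simp
  let ψ : Sch (m+1) := hFs.toSchwartzMap hF
  have e0 : ∀ y t, ψ (pt ℓ y t) = (((α y * β t : ℝ)) : ℂ) • v := by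
    intro y t
    show F _ = _
    simp only [F, pt_self]
    have : (fun i => (pt ℓ y t) (ℓ.succAbove i)) = y := by ext i; simp [pt]
    rw [this]
    exact RCLike.real_smul_eq_coe_smul (K := ℂ) _ _
  have hd : ∀ {b : ℝ → ℝ}, ContDiff ℝ (⊤ : ℕ∞) b → ∀ y t,
      HasDerivAt (fun t => (((α y * b t : ℝ)) : ℂ) • v) ((((α y * deriv b t : ℝ)) : ℂ) • v) t := by
    intro b hb y t
    have h1 := ((hb.differentiable (by simp)) t).hasDerivAt.const_mul (α y)
    exact h1.ofReal_comp.smul_const v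
  have e1 : ∀ y t, Dj ℓ ψ (pt ℓ y t) = (((α y * deriv β t : ℝ)) : ℂ) • v := fun y t => by
    have h1 := sch_hasDerivAt ℓ y ψ t
    rw [show (fun t => ψ (pt ℓ y t)) = _ from funext (e0 y)] at h1
    exact h1.unique (hd hβ y t)
  have e2 : ∀ y t, Dj ℓ (Dj ℓ ψ) (pt ℓ y t) = (((α y * deriv (deriv β) t : ℝ)) : ℂ) • v := fun y t => by
    have h1 := sch_hasDerivAt ℓ y (Dj ℓ ψ) t
    rw [show (fun t => Dj ℓ ψ (pt ℓ y t)) = _ from funext (e1 y)] at h1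
    exact h1.unique (hd (contDiff_d hβ) y t)
  refine ⟨ψ, fun ξ => ⟨((α (fun i => ξ (ℓ.succAbove i)) * β (ξ ℓ) : ℝ) : ℂ), ?_⟩, e0, e1, e2⟩
  exact RCLike.real_smul_eq_coe_smul (K := ℂ) _ _


/-! ### Deficiency spaces -/

lemma isForm_opB {p : ℕ} {v : Lam n} (hv : IsForm p v) (ℓ : Fin n) (x : Fin n → ℝ) :
    IsForm p (opB ℓ x v) :=
  (hv.iot_eps _ _).add (hv.eps_iot _ _)

lemma isForm_opN {p : ℕ} {v : Lam n} (hv : IsForm p v) (ℓ : Fin n) : IsForm p (opN ℓ v) :=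
  hv.eps_iot _ _

lemma isForm_opM {p : ℕ} {v : Lam n} (hv : IsForm p v) (c s : ℝ) (ℓ : Fin n) (x : Fin n → ℝ) (t : ℝ) :
    IsForm p (opM c s ℓ x t v) :=
  IsForm.sub (hv.smul _) (IsForm.smul (IsForm.add (IsForm.add (hv.eps_iot _ _)
    (IsForm.smul (IsForm.add (hv.eps_iot _ _) (hv.eps_iot _ _)) _)) (IsForm.smul (hv.eps_iot _ _) _)) _)

/-- the weighted fibre function -/
def ff (c s : ℝ) (ℓ : Fin (m+1)) (g : Rn (m+1) → Lam (m+1)) (y : Fin m → ℝ) (t : ℝ) : Lam (m+1) :=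
  (((qq (xx ℓ y) + t^2) ^ (s - 1) : ℝ) : ℂ) • opM c s ℓ (xx ℓ y) t (g (pt ℓ y t))

/-- weak integrand on the fibre -/
def XX (c s : ℝ) (κ : ℂ) (ℓ : Fin n) (x : Fin n → ℝ) (β : ℝ → ℝ) (f : ℝ → Lam n) (t : ℝ) : Lam n :=
  deriv (deriv β) t • (((qq x + t^2 : ℝ) : ℂ) • f t) + deriv β t • A1f s ℓ x t (f t)
    + β t • A0f c s κ ℓ (f t)

lemma isForm_XX {p : ℕ} (c s : ℝ) (κ : ℂ) (ℓ : Fin n) (x : Fin n → ℝ) (β : ℝ → ℝ) (f : ℝ → Lam n) (t : ℝ)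
    (h : IsForm p (f t)) : IsForm p (XX c s κ ℓ x β f t) :=
  IsForm.add (IsForm.add ((h.smul _).rsmul _) (IsForm.rsmul (IsForm.add (h.smul _)
    ((isForm_opB h ℓ x).smul _)) _)) (IsForm.rsmul (IsForm.add (IsForm.sub (h.smul _)
    ((isForm_opN h ℓ).smul _)) (h.smul _)) _)

lemma inner_Lsh (c s : ℝ) (cc : ℂ) (ℓ : Fin n) (x : Fin n → ℝ) (hx : x ℓ = 0) (t r : ℝ) (β : ℝ → ℝ)
    (v : Lam n) (f : ℝ → Lam n) :
    inner ℂ (Lsh c s ℓ x t (((r * β t : ℝ) : ℂ) • v) (((r * deriv β t : ℝ) : ℂ) • v)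
      (((r * deriv (deriv β) t : ℝ) : ℂ) • v) + ((2 * s : ℝ) : ℂ) • (((r * β t : ℝ) : ℂ) • v)
      + cc • (((r * β t : ℝ) : ℂ) • v)) (f t) =
    r • inner ℂ v (XX c s (starRingEnd ℂ cc) ℓ x β f t) := by
  unfold Lsh XX A1f A0f
  simp only [RCLike.real_smul_eq_coe_smul (K := ℂ), map_smul, inner_add_left, inner_sub_left,
    inner_smul_left, inner_add_right, inner_sub_right, inner_smul_right, inner_opB ℓ x hx, inner_opN,
    Complex.conj_ofReal, smul_add, smul_sub, map_ofNat, Complex.coe_algebraMap, smul_eq_mul]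
  push_cast
  ring

lemma meas_fib (ℓ : Fin (m+1)) {g : Rn (m+1) → Lam (m+1)} (hg : AEStronglyMeasurable g volume) :
    ∀ᵐ y, AEStronglyMeasurable (fun t => g (pt ℓ y t)) volume :=
  (hg.comp_quasiMeasurePreserving (PE_mp ℓ).quasiMeasurePreserving).prodMk_left

lemma continuous_rho (x : Fin n → ℝ) (hq : 0 < qq x) (r : ℝ) :
    Continuous fun t : ℝ => (qq x + t^2) ^ r :=
  Continuous.rpow_const (by fun_prop) fun t => Or.inl (by positivity)

lemma meas_ff (c s : ℝ) (ℓ : Fin (m+1)) (g : Rn (m+1) → Lam (m+1)) (y : Fin m → ℝ)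
    (hq : 0 < qq (xx ℓ y)) (hg : AEStronglyMeasurable (fun t => g (pt ℓ y t)) volume) :
    AEStronglyMeasurable (ff c s ℓ g y) volume := by
  have hA : ∀ A : Module.End ℂ (Lam (m+1)), AEStronglyMeasurable (fun t => A (g (pt ℓ y t))) volume :=
    fun A => (continuous_end A).comp_aestronglyMeasurable hg
  have hr : AEStronglyMeasurable (fun t : ℝ => (((qq (xx ℓ y) + t^2) ^ (s - 1) : ℝ) : ℂ)) volume :=
    (Complex.continuous_ofReal.comp (continuous_rho _ hq _)).aestronglyMeasurable
  have h1 : AEStronglyMeasurable (fun t : ℝ => (((c + s) * (qq (xx ℓ y) + t^2) : ℝ) : ℂ)) volume :=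
    (by fun_prop : Continuous _).aestronglyMeasurable
  have h2 : AEStronglyMeasurable (fun t : ℝ => (t : ℂ)) volume :=
    (by fun_prop : Continuous _).aestronglyMeasurable
  have h3 : AEStronglyMeasurable (fun t : ℝ => ((t^2 : ℝ) : ℂ)) volume :=
    (by fun_prop : Continuous _).aestronglyMeasurable
  unfold ff opM
  simp only [LinearMap.sub_apply, LinearMap.smul_apply, LinearMap.add_apply, Module.End.one_apply]
  have k1 : AEStronglyMeasurable (fun t : ℝ => opE0 (xx ℓ y) (g (pt ℓ y t)) +
      (t : ℂ) • opE1 ℓ (xx ℓ y) (g (pt ℓ y t)) + ((t^2 : ℝ) : ℂ) • opN ℓ (g (pt ℓ y t))) volume :=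
    ((hA _).add (h2.smul (hA _))).add (h3.smul (hA _))
  exact hr.smul ((h1.smul hg).sub (k1.const_smul ((2 * s : ℝ) : ℂ)))

lemma ff_props (c s : ℝ) (ℓ : Fin (m+1)) (g : Rn (m+1) → Lam (m+1)) (y : Fin m → ℝ)
    (hq : 0 < qq (xx ℓ y)) (hg : AEStronglyMeasurable (fun t => g (pt ℓ y t)) volume)
    (hg2 : Integrable fun t => ‖pt ℓ y t‖ ^ (2*s) * ‖g (pt ℓ y t)‖^2) :
    LocallyIntegrable (ff c s ℓ g y) ∧
      Integrable (fun t => (qq (xx ℓ y) + t^2) ^ (-s) * ‖ff c s ℓ g y t‖^2) := by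
  have hm := meas_ff c s ℓ g y hq hg
  set K := |c + s| + 2 * |s| with hK
  have hK0 : 0 ≤ K := by positivity
  have hw : ∀ t, ‖pt ℓ y t‖ ^ (2*s) = (qq (xx ℓ y) + t^2) ^ s := fun t => by
    rw [← norm_pt, ← Real.rpow_natCast, ← Real.rpow_mul (norm_nonneg _)]; norm_num
  simp only [hw] at hg2
  have hb : ∀ t, ‖ff c s ℓ g y t‖ ≤ K * (qq (xx ℓ y) + t^2) ^ s * ‖g (pt ℓ y t)‖ := by
    intro t
    have hρ : 0 < qq (xx ℓ y) + t^2 := by positivity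
    unfold ff
    rw [norm_smul, Complex.norm_real, Real.norm_of_nonneg (by positivity)]
    calc _ ≤ (qq (xx ℓ y) + t^2) ^ (s - 1) * (K * (qq (xx ℓ y) + t^2) * ‖g (pt ℓ y t)‖) := by
          gcongr; exact norm_opM_le c s ℓ (xx ℓ y) (xx_self ℓ y) t _
      _ = K * ((qq (xx ℓ y) + t^2) ^ (s - 1) * (qq (xx ℓ y) + t^2)) * ‖g (pt ℓ y t)‖ := by ring
      _ = _ := by
          rw [← Real.rpow_add_one hρ.ne']; norm_num
  constructor
  · have hl : LocallyIntegrable fun t => K * ((qq (xx ℓ y) + t^2) ^ s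
        + (qq (xx ℓ y) + t^2) ^ s * ‖g (pt ℓ y t)‖^2) := by
      have h1 := (continuous_rho (xx ℓ y) hq s).locallyIntegrable (μ := volume)
      have h2 := (h1.add hg2.locallyIntegrable).smul K
      exact h2
    refine hl.mono hm (Filter.Eventually.of_forall fun t => ?_)
    have hρ : 0 < qq (xx ℓ y) + t^2 := by positivity
    rw [Real.norm_of_nonneg (by positivity)]
    refine (hb t).trans ?_
    rw [mul_assoc]
    gcongr
    have : ‖g (pt ℓ y t)‖ ≤ 1 + ‖g (pt ℓ y t)‖^2 := by nlinarith [sq_nonneg (‖g (pt ℓ y t)‖ - 1/2)]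
    calc _ ≤ (qq (xx ℓ y) + t^2) ^ s * (1 + ‖g (pt ℓ y t)‖^2) := by gcongr
      _ = _ := by ring
  · refine (hg2.const_mul (K^2)).mono' ?_ (Filter.Eventually.of_forall fun t => ?_)
    · exact (continuous_rho _ hq _).aestronglyMeasurable.mul (hm.norm.pow 2)
    · have hρ : 0 < qq (xx ℓ y) + t^2 := by positivity
      rw [Real.norm_of_nonneg (by positivity)]
      calc _ ≤ (qq (xx ℓ y) + t^2) ^ (-s) * (K * (qq (xx ℓ y) + t^2) ^ s * ‖g (pt ℓ y t)‖)^2 := by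
            gcongr; exact hb t
        _ = K^2 * ((qq (xx ℓ y) + t^2) ^ (-s) * (qq (xx ℓ y) + t^2) ^ s) *
              ((qq (xx ℓ y) + t^2) ^ s * ‖g (pt ℓ y t)‖^2) := by ring
        _ = _ := by
            rw [← Real.rpow_add hρ]; simp

lemma ff_zero (c s : ℝ) (hs : |s| < c) (ℓ : Fin (m+1)) (g : Rn (m+1) → Lam (m+1)) (y : Fin m → ℝ)
    (hq : 0 < qq (xx ℓ y)) (t : ℝ) (h : ff c s ℓ g y t = 0) : g (pt ℓ y t) = 0 := by
  have hρ : 0 < qq (xx ℓ y) + t^2 := by positivity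
  unfold ff at h
  rw [smul_eq_zero] at h
  have h0 : opM c s ℓ (xx ℓ y) t (g (pt ℓ y t)) = 0 := by
    refine h.resolve_left ?_
    exact Complex.ofReal_ne_zero.2 (by positivity)
  obtain ⟨M, hM1, hM2, -⟩ := inner_opM_bd c s ℓ (xx ℓ y) (xx_self ℓ y) t (g (pt ℓ y t))
  rw [h0, inner_zero_right] at hM1
  have : M = 0 := by exact_mod_cast hM1.symm
  rw [this] at hM2
  by_contra hne
  have h2 : 0 < ‖g (pt ℓ y t)‖ := norm_pos_iff.2 hne
  have : 0 < (c - |s|) * (qq (xx ℓ y) + t^2) * ‖g (pt ℓ y t)‖^2 := by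
    have : 0 < c - |s| := by linarith
    positivity
  linarith

lemma wf_fib_test (a : ℝ) (p : ℕ) (ℓ : Fin (m+1)) (cc : ℂ) {g : Rn (m+1) → Lam (m+1)}
    {α : (Fin m → ℝ) → ℝ} {β : ℝ → ℝ} {v : Lam (m+1)} {u ψ : Sch (m+1)} (hu : FTc (m+1) u = ψ)
    (e0 : ∀ y t, ψ (pt ℓ y t) = (((α y * β t : ℝ)) : ℂ) • v)
    (e1 : ∀ y t, Dj ℓ ψ (pt ℓ y t) = (((α y * deriv β t : ℝ)) : ℂ) • v)
    (e2 : ∀ y t, Dj ℓ (Dj ℓ ψ) (pt ℓ y t) = (((α y * deriv (deriv β) t : ℝ)) : ℂ) • v)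
    (y : Fin m → ℝ) (hq : 0 < qq (xx ℓ y)) (t : ℝ) :
    wf (((m+1:ℕ):ℝ)/2 - p) ((2-a)/2) (FTc (m+1) (DapS a p ℓ u + cc • u)) g (pt ℓ y t) =
      α y • inner ℂ v (XX (((m+1:ℕ):ℝ)/2 - p) ((2-a)/2) (starRingEnd ℂ cc) ℓ (xx ℓ y) β
        (ff (((m+1:ℕ):ℝ)/2 - p) ((2-a)/2) ℓ g y) t) := by
  rw [wf_fib _ _ ℓ y hq, ← inner_Lsh _ _ cc ℓ (xx ℓ y) (xx_self ℓ y) t (α y) β v]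
  unfold ff
  rw [inner_smul_right]
  congr 2
  rw [map_add, map_smul, add_apply, smul_apply, FTc_fib, hu, e0, e1, e2]

lemma weak_fibre_test (hm : 1 ≤ m) (a : ℝ) (ha2 : a ≤ 2) (p : ℕ) (ℓ : Fin (m+1)) (cc : ℂ)
    (g : Rn (m+1) → Lam (m+1)) (hg : AEStronglyMeasurable g volume)
    (hg2 : Integrable fun ξ => ‖ξ‖ ^ (2*((2-a)/2)) * ‖g ξ‖^2)
    (H : ∀ φ : Sch (m+1), (∀ x, IsForm p (φ x)) →
      ∫ ξ, wf (((m+1:ℕ):ℝ)/2 - p) ((2-a)/2) (FTc (m+1) (DapS a p ℓ φ + cc • φ)) g ξ = 0)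
    {β : ℝ → ℝ} (hβ : ContDiff ℝ (⊤ : ℕ∞) β) (hβs : HasCompactSupport β) (v : Lam (m+1))
    (hv : IsForm p v) :
    ∀ᵐ y, ∫ t, inner ℂ v (XX (((m+1:ℕ):ℝ)/2 - p) ((2-a)/2) (starRingEnd ℂ cc) ℓ (xx ℓ y) β
        (ff (((m+1:ℕ):ℝ)/2 - p) ((2-a)/2) ℓ g y) t) = 0 := by
  set Φ : (Fin m → ℝ) → ℂ := fun y => ∫ t, inner ℂ v (XX (((m+1:ℕ):ℝ)/2 - p) ((2-a)/2)
    (starRingEnd ℂ cc) ℓ (xx ℓ y) β (ff (((m+1:ℕ):ℝ)/2 - p) ((2-a)/2) ℓ g y) t) with hΦ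
  have hs : 0 ≤ (2-a)/2 := by linarith
  have key : ∀ α : (Fin m → ℝ) → ℝ, ContDiff ℝ (⊤ : ℕ∞) α → HasCompactSupport α →
      Integrable (fun y => α y • Φ y) ∧ ∫ y, α y • Φ y = 0 := by
    intro α hα hαs
    obtain ⟨ψ, hψ, e0, e1, e2⟩ := exists_prod_test ℓ hα hαs hβ hβs v
    obtain ⟨u, hu1, hu2⟩ := exists_ft p ψ (fun ξ => by
      obtain ⟨r, hr⟩ := hψ ξ
      rw [hr]; exact hv.smul r)
    have hI : Integrable (wf (((m+1:ℕ):ℝ)/2 - p) ((2-a)/2) (FTc (m+1) (DapS a p ℓ u + cc • u)) g) :=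
      wf_integrable _ _ (SchwartzMap.continuous _).aestronglyMeasurable hg (sch_w _ hs _) hg2
    obtain ⟨-, k2, k3⟩ := fub_int ℓ hI
    have hae : (fun y => ∫ t, wf (((m+1:ℕ):ℝ)/2 - p) ((2-a)/2)
        (FTc (m+1) (DapS a p ℓ u + cc • u)) g (pt ℓ y t)) =ᵐ[volume] fun y => α y • Φ y := by
      filter_upwards [qq_pos_ae hm ℓ] with y hq
      simp only [wf_fib_test a p ℓ cc hu2 e0 e1 e2 y hq]
      rw [integral_smul]
    refine ⟨k2.congr hae, ?_⟩
    rw [← integral_congr_ae hae, ← k3]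
    exact H u hu1
  have hloc : LocallyIntegrable Φ := by
    intro y
    let b : ContDiffBump y := ⟨1, 2, one_pos, one_lt_two⟩
    obtain ⟨i1, -⟩ := key b b.contDiff b.hasCompactSupport
    refine ⟨Metric.closedBall y 1, Metric.closedBall_mem_nhds y one_pos, ?_⟩
    refine (i1.integrableOn (s := Metric.closedBall y 1)).congr_fun (fun z hz => ?_)
      Metric.isClosed_closedBall.measurableSet
    simp only []
    rw [b.one_of_mem_closedBall hz, one_smul]
  exact ae_eq_zero_of_integral_contDiff_smul_eq_zero hloc fun α h1 h2 => (key α h1 h2).2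

lemma locInt_A (c s : ℝ) (κ : ℂ) (ℓ : Fin n) (x : Fin n → ℝ) {f : ℝ → Lam n} (hf : LocallyIntegrable f) :
    LocallyIntegrable (fun t => ((qq x + t^2 : ℝ) : ℂ) • f t) ∧
    LocallyIntegrable (fun t => A1f s ℓ x t (f t)) ∧ LocallyIntegrable (fun t => A0f c s κ ℓ (f t)) := by
  refine ⟨locInt_smul (by fun_prop) hf, ?_, ?_⟩
  · unfold A1f
    exact (locInt_smul (by fun_prop) hf).add (locInt_smul continuous_const (locInt_end _ hf))
  · unfold A0f
    exact ((locInt_smul continuous_const hf).sub (locInt_smul continuous_const (locInt_end _ hf))).add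
      (locInt_smul continuous_const hf)

lemma deficiency (hm : 1 ≤ m) (a : ℝ) (ha2 : a ≤ 2) (p : ℕ) (ℓ : Fin (m+1))
    (hc : |(2-a)/2| < ((m+1:ℕ):ℝ)/2 - p) (cc : ℂ) (hcc : cc = I ∨ cc = -I)
    (g : Rn (m+1) → Lam (m+1)) (hg : AEStronglyMeasurable g volume) (hgp : ∀ ξ, IsForm p (g ξ))
    (hg2 : Integrable fun ξ => ‖ξ‖ ^ (2*((2-a)/2)) * ‖g ξ‖^2)
    (H : ∀ φ : Sch (m+1), (∀ x, IsForm p (φ x)) →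
      ∫ ξ, wf (((m+1:ℕ):ℝ)/2 - p) ((2-a)/2) (FTc (m+1) (DapS a p ℓ φ + cc • φ)) g ξ = 0) :
    ∀ᵐ ξ, g ξ = 0 := by
  obtain ⟨D, hD1, hD2, hD3⟩ := countable_test (Lam (m+1))
  have hκ : starRingEnd ℂ cc = I ∨ starRingEnd ℂ cc = -I := by
    rcases hcc with h | h <;> simp [h]
  have hW : ∀ᵐ y, ∀ β ∈ D, ∀ S : Finset (Fin (m+1)), S.card = p →
      ∫ t, inner ℂ (EuclideanSpace.single S (1:ℂ) : Lam (m+1)) (XX (((m+1:ℕ):ℝ)/2 - p) ((2-a)/2)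
        (starRingEnd ℂ cc) ℓ (xx ℓ y) β (ff (((m+1:ℕ):ℝ)/2 - p) ((2-a)/2) ℓ g y) t) = 0 := by
    rw [ae_ball_iff hD1]
    intro β hβ
    rw [ae_all_iff]
    intro S
    by_cases hS : S.card = p
    · filter_upwards [weak_fibre_test hm a ha2 p ℓ cc g hg hg2 H (hD2 β hβ).1 (hD2 β hβ).2
        (EuclideanSpace.single S (1:ℂ)) (fun T hT => by
          have : T ≠ S := fun h => hT (h ▸ hS)
          simp [this])] with y hy _
      exact hy
    · exact Filter.Eventually.of_forall fun y h => absurd h hS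
  refine fub_zero ℓ hg ?_
  filter_upwards [hW, qq_pos_ae hm ℓ, meas_fib ℓ hg, (fub_int ℓ hg2).1] with y hy hq hgm hgi
  set c := (((m+1:ℕ):ℝ)/2 - p)
  set s := (2-a)/2
  obtain ⟨hl, hi⟩ := ff_props c s ℓ g y hq hgm hgi
  obtain ⟨l2, l1, l0⟩ := locInt_A c s (starRingEnd ℂ cc) ℓ (xx ℓ y) hl
  have hz : ∀ᵐ t, ff c s ℓ g y t = 0 := by
    refine fibre_weak_unique c s hc ℓ (xx ℓ y) (xx_self ℓ y) hq (starRingEnd ℂ cc) hκ _ hl hi ?_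
    refine hD3 _ _ _ l2 l1 l0 ?_
    intro β hβ
    have hX : Integrable (XX c s (starRingEnd ℂ cc) ℓ (xx ℓ y) β (ff c s ℓ g y)) := by
      have hb := hD2 β hβ
      exact ((integrable_test l2 (contDiff_d (contDiff_d hb.1)).continuous hb.2.deriv.deriv).add
        (integrable_test l1 (contDiff_d hb.1).continuous hb.2.deriv)).add
        (integrable_test l0 hb.1.continuous hb.2)
    show ∫ t, XX c s (starRingEnd ℂ cc) ℓ (xx ℓ y) β (ff c s ℓ g y) t = 0
    ext S
    have hev : ∀ v : Lam (m+1), v S = inner ℂ (EuclideanSpace.single S (1:ℂ) : Lam (m+1)) v := by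
      intro v; simp [EuclideanSpace.inner_single_left]
    rw [hev, ← integral_inner hX]
    by_cases hS : S.card = p
    · rw [hy β hβ S hS]; rfl
    · rw [integral_eq_zero_of_ae]
      · rfl
      · refine Filter.Eventually.of_forall fun t => ?_
        simp only [← hev]
        exact isForm_XX (p := p) c s _ ℓ _ β _ t ((isForm_opM (hgp _) c s ℓ _ t).smul _) S hS
  filter_upwards [hz] with t ht
  exact ff_zero c s hc ℓ g y hq t ht


/-! ### Density -/

lemma approx (s : ℝ) (hs : 0 ≤ s) (g : Rn n → Lam n) (hg : AEStronglyMeasurable g volume)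
    (hg2 : Integrable fun ξ => ‖ξ‖ ^ (2*s) * ‖g ξ‖^2) (δ : ℝ) (hδ : 0 < δ) :
    ∃ h : Rn n → Lam n, HasCompactSupport h ∧ ContDiff ℝ (⊤ : ℕ∞) h ∧
      Integrable (fun ξ => ‖ξ‖ ^ (2*s) * ‖g ξ - h ξ‖^2) ∧
      ∫ ξ, ‖ξ‖ ^ (2*s) * ‖g ξ - h ξ‖^2 ≤ δ^2 := by
  have hcont : Continuous fun ξ : Rn n => ‖ξ‖ ^ (2*s) :=
    Continuous.rpow_const continuous_norm fun ξ => Or.inr (by linarith)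
  set w : Rn n → ENNReal := fun ξ => ENNReal.ofReal (‖ξ‖ ^ (2*s)) with hw
  have hwm : Measurable w := hcont.measurable.ennreal_ofReal
  have hwt : ∀ ξ, (w ξ).toReal = ‖ξ‖ ^ (2*s) := fun ξ => ENNReal.toReal_ofReal (by positivity)
  have hlt : ∀ᵐ ξ : Rn n, w ξ < ⊤ := Filter.Eventually.of_forall fun ξ => ENNReal.ofReal_lt_top
  set μ : Measure (Rn n) := volume.withDensity w with hμ
  have : IsLocallyFiniteMeasure μ := IsLocallyFiniteMeasure.withDensity_ofReal hcont
  have hac : μ ≪ volume := withDensity_absolutelyContinuous _ _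
  have hiff : ∀ f : Rn n → ℝ, Integrable f μ ↔ Integrable fun ξ => ‖ξ‖ ^ (2*s) * f ξ := by
    intro f
    rw [hμ, integrable_withDensity_iff hwm hlt]
    simp only [hwt, mul_comm]
  have hgL : MemLp g 2 μ := by
    rw [memLp_two_iff_integrable_sq_norm (hg.mono_ac hac), hiff]
    exact hg2
  obtain ⟨h, h1, h2, h3⟩ := hgL.exist_eLpNorm_sub_le (by simp) (by norm_num) hδ
  have hhL : MemLp h 2 μ := h2.continuous.memLp_of_hasCompactSupport h1
  have hd : MemLp (g - h) 2 μ := hgL.sub hhL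
  have hint := (memLp_two_iff_integrable_sq_norm hd.1).1 hd
  have hint2 := (hiff _).1 hint
  refine ⟨h, h1, h2, hint2, ?_⟩
  have e1 : ∫ ξ, ‖ξ‖ ^ (2*s) * ‖g ξ - h ξ‖^2 = ∫ ξ, ‖(g - h) ξ‖^2 ∂μ := by
    rw [hμ, integral_withDensity_eq_integral_toReal_smul hwm hlt]
    simp only [hwt, smul_eq_mul, Pi.sub_apply]
  rw [e1]
  rw [hd.eLpNorm_eq_integral_rpow_norm (by simp) (by simp), ENNReal.ofReal_le_ofReal_iff hδ.le] at h3
  have hnn : 0 ≤ ∫ ξ, ‖(g - h) ξ‖^2 ∂μ := integral_nonneg fun ξ => by positivity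
  simp only [ENNReal.toReal_ofNat, Real.rpow_ofNat] at h3
  rw [show (2:ℝ)⁻¹ = 1/2 by norm_num, ← Real.sqrt_eq_rpow] at h3
  exact (Real.sqrt_le_left hδ.le).1 h3

lemma density (c s : ℝ) (hs : 0 ≤ s) (p : ℕ) (g : Rn n → Lam n) (hg : AEStronglyMeasurable g volume)
    (hgp : ∀ ξ, IsForm p (g ξ))
    (hg2 : Integrable fun ξ => ‖ξ‖ ^ (2*s) * ‖g ξ‖^2) (ε : ℝ) (hε : 0 < ε) :
    ∃ u : Sch n, (∀ x, IsForm p (u x)) ∧ cSq c (-s) (fun ξ => g ξ - FTc n u ξ) < ε := by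
  set K := |c - (-s)| + |c + (-s)| with hK
  have hK0 : 0 ≤ K := by positivity
  have hpos : 0 < ε / (2 * (K + 1)) := by positivity
  obtain ⟨h, h1, h2, h3, h4⟩ := approx s hs g hg hg2 (√(ε / (2 * (K + 1)))) (Real.sqrt_pos.2 hpos)
  rw [Real.sq_sqrt hpos.le] at h4
  obtain ⟨u, hu1, hu2⟩ := exists_ft p (Ej (prP n p) (h1.toSchwartzMap h2)) (fun x => isForm_prP p _)
  refine ⟨u, hu1, ?_⟩
  rw [hu2]
  unfold cSq
  have hb : ∀ ξ, ‖g ξ - Ej (prP n p) (h1.toSchwartzMap h2) ξ‖ ≤ ‖g ξ - h ξ‖ := by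
    intro ξ
    have e : g ξ - Ej (prP n p) (h1.toSchwartzMap h2) ξ = prP n p (g ξ - h ξ) := by
      rw [map_sub, (isForm_iff p _).1 (hgp ξ)]
      rfl
    rw [e]
    exact norm_prP_le p _
  refine ((Real.le_norm_self _).trans (norm_integral_le_of_norm_le (h3.const_mul K)
    (Filter.Eventually.of_forall fun ξ => ?_))).trans_lt ?_
  · set d := g ξ - Ej (prP n p) (h1.toSchwartzMap h2) ξ
    have i1 := norm_inner_le_norm (𝕜 := ℂ) d (opC c (-s) (‖ξ‖⁻¹ • ξ).ofLp d)
    have i2 := norm_opC_le c (-s) ξ d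
    have i3 := Complex.abs_re_le_norm (inner ℂ d (opC c (-s) (‖ξ‖⁻¹ • ξ).ofLp d))
    rw [norm_mul, Real.norm_of_nonneg (by positivity), Real.norm_eq_abs, show -(2 * (-s)) = 2 * s by ring]
    calc _ ≤ ‖ξ‖ ^ (2*s) * (‖d‖ * (K * ‖d‖)) := by
          gcongr; exact (i3.trans i1).trans (by gcongr)
      _ = K * (‖ξ‖ ^ (2*s) * ‖d‖^2) := by ring
      _ ≤ _ := by gcongr; exact hb ξ
  · rw [integral_const_mul]
    calc _ ≤ K * (ε / (2 * (K + 1))) := by gcongr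
      _ < ε := by
        rw [mul_div_assoc', div_lt_iff₀ (by positivity)]
        nlinarith

lemma cIp_wf (c lam : ℝ) (f g : Rn n → Lam n) : cIp c lam f g = ∫ ξ, wf c (-lam) f g ξ := by
  unfold cIp wf
  rw [neg_neg]

/-- For 2-n+2p < a ≤ 2 the operator Δ_{a,p}, defined on the dense subspace of
Schwartz p-forms of the Hilbert space Ḣ^{(2-a)/2,p}(ℝ^n) with the conformally invariant
inner product (λ = (a-2)/2), is symmetric and essentially self-adjoint. Essential
self-adjointness is expressed by the standard criterion that the deficiency spaces
ker(Δ* ∓ i) vanish. Everything is expressed on the Fourier transform side (g = û). -/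
theorem stmt4 (n p : ℕ) (hn : 2 ≤ n) (hp : 2*p ≤ n)
    (a : ℝ) (ha1 : 2 - (n:ℝ) + 2*p < a) (ha2 : a ≤ 2)
    (ℓ : Fin n) (hℓ : (ℓ : ℕ) = n - 1) :
    -- the Schwartz p-forms are dense in Ḣ^{(2-a)/2,p}(ℝ^n)
    (∀ g ∈ Hdot n ((2-a)/2) p, ∀ ε : ℝ, 0 < ε →
      ∃ u : SchwartzMap (Rn n) (Lam n), (∀ x, IsForm p (u x)) ∧
        cSq ((n:ℝ)/2 - p) ((a-2)/2) (fun ξ => g ξ - ft (fun x => u x) ξ) < ε) ∧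
    -- Δ_{a,p} is symmetric on Schwartz p-forms w.r.t. the conformally invariant inner product
    (∀ u v : SchwartzMap (Rn n) (Lam n), (∀ x, IsForm p (u x)) → (∀ x, IsForm p (v x)) →
      cIp ((n:ℝ)/2 - p) ((a-2)/2) (ft (fun x => Dap a p ℓ (fun y => u y) x)) (ft (fun x => v x))
        = cIp ((n:ℝ)/2 - p) ((a-2)/2) (ft (fun x => u x)) (ft (fun x => Dap a p ℓ (fun y => v y) x))) ∧
    -- essential self-adjointness: the deficiency spaces ker(Δ* ∓ i) are trivial
    (∀ c : ℂ, (c = Complex.I ∨ c = -Complex.I) →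
      ∀ g ∈ Hdot n ((2-a)/2) p,
        (∀ φ : SchwartzMap (Rn n) (Lam n), (∀ x, IsForm p (φ x)) →
          cIp ((n:ℝ)/2 - p) ((a-2)/2)
            (ft (fun x => Dap a p ℓ (fun y => φ y) x + c • φ x)) g = 0) →
        ∀ᵐ ξ, g ξ = 0) := by
  obtain ⟨m, rfl⟩ : ∃ m, n = m + 1 := ⟨n - 1, by omega⟩
  have hm : 1 ≤ m := by omega
  have hs0 : 0 ≤ (2-a)/2 := by linarith
  have hs1 : |(2-a)/2| < ((m+1:ℕ):ℝ)/2 - p := by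
    rw [abs_of_nonneg hs0]; linarith
  have hneg : (a-2)/2 = -((2-a)/2) := by ring
  have hneg2 : -((a-2)/2) = (2-a)/2 := by ring
  have hft : ∀ u : Sch (m+1), ft (fun x => u x) = FTc (m+1) u := fun u => funext fun ξ => ft_eq u ξ
  have hftD : ∀ u : Sch (m+1), ft (fun x => Dap a p ℓ (fun y => u y) x) = FTc (m+1) (DapS a p ℓ u) :=
    fun u => funext fun ξ => by rw [ft_Dap, FTc_DapS]
  refine ⟨?_, ?_, ?_⟩
  · rintro g ⟨hg1, hg2, hg3⟩ ε hε
    obtain ⟨u, hu1, hu2⟩ := density (((m+1:ℕ):ℝ)/2 - p) ((2-a)/2) hs0 p g hg1 hg2 hg3 ε hε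
    refine ⟨u, hu1, ?_⟩
    rw [hneg, hft]
    exact hu2
  · intro u v _ _
    rw [cIp_wf, cIp_wf, hneg2, hft, hft, hftD, hftD]
    exact symm_main hm a ha2 p ℓ u v
  · rintro c hc g ⟨hg1, hg2, hg3⟩ H
    refine deficiency hm a ha2 p ℓ hs1 c hc g hg1 hg2 hg3 fun φ hφ => ?_
    have h := H φ hφ
    have e : ft (fun x => Dap a p ℓ (fun y => φ y) x + c • φ x) = FTc (m+1) (DapS a p ℓ φ + c • φ) :=
      funext fun ξ => by rw [ft_Dap_add, map_add, map_smul, add_apply, smul_apply, FTc_DapS]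
    rw [cIp_wf, hneg2, e] at h
    exact h
end
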